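/- Let A be a finite alphabet and X ⊆ A^ℤ a sofic subshift. Then Aut(X) contains a distortion element if and only if X is uncountable. -/

import Mathlib

/-- The word norm of `g` with respect to the generating set `F`:
the least `n` such that `g` is a product of `n` elements of `F ∪ F⁻¹`. -/
noncomputable def wordNorm {G : Type*} [Group G] (F : Set G) (g : G) : ℕ :=
  sInf {n : ℕ | ∃ w : List G, w.length = n ∧ (∀ x ∈ w, x ∈ F ∨ x⁻¹ ∈ F) ∧ w.prod = g}
/-- The shift map on the full shift `A^ℤ`. -/
def shiftMap (A : Type*) : (ℤ → A) → (ℤ → A) := fun x i => x (i + 1)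

/-- A subshift: a closed, shift-invariant subset of `A^ℤ`. -/
def IsSubshift {A : Type*} [TopologicalSpace A] (X : Set (ℤ → A)) : Prop :=
  IsClosed X ∧ shiftMap A '' X = X

/-- The automorphism group of the full shift `A^ℤ`, as the set of those permutations of
`A^ℤ` which are homeomorphisms commuting with the shift. -/
def FullShiftAut (A : Type*) [TopologicalSpace A] : Set (Equiv.Perm (ℤ → A)) :=
  {f | Continuous f ∧ Continuous f.symm ∧ ∀ x, f (shiftMap A x) = shiftMap A (f x)}

/-- The automorphism group of a subshift `X ⊆ A^ℤ`, as the set of those permutations of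
`X` which are homeomorphisms (for the subspace topology) commuting with the shift. -/
def SubshiftAut {A : Type*} [TopologicalSpace A] (X : Set (ℤ → A)) :
    Set (Equiv.Perm X) :=
  {f | Continuous f ∧ Continuous f.symm ∧
    ∀ x y : X, (y : ℤ → A) = shiftMap A (x : ℤ → A) →
      ((f y : X) : ℤ → A) = shiftMap A ((f x : X) : ℤ → A)}

/-- The number of words of length `k` appearing in elements of `X`. -/
noncomputable def wordCount {A : Type*} (X : Set (ℤ → A)) (k : ℕ) : ℕ :=
  Set.ncard {w : Fin k → A | ∃ x ∈ X, ∃ i : ℤ, ∀ j : Fin k, x (i + (j : ℤ)) = w j}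

/-- The lower entropy dimension of a subshift,
`liminf_k log (log N_k(X)) / log k` (base-2 logarithms). -/
noncomputable def lowerEntropyDim {A : Type*} (X : Set (ℤ → A)) : ℝ :=
  Filter.liminf
    (fun k : ℕ => Real.logb 2 (Real.logb 2 (wordCount X k)) / Real.logb 2 k)
    Filter.atTop

/-- The language of a subshift: the set of finite words over `A` occurring as subwords of
elements of `X`. -/
def subshiftLanguage {A : Type*} (X : Set (ℤ → A)) : Language A :=
  {w | ∃ x ∈ X, ∃ i : ℤ, ∀ j : Fin w.length, x (i + (j : ℤ)) = w.get j}

/-- `g` is a distortion element of the (sub)group described by the subset `S` of an ambient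
group: `g ∈ S` has infinite order, and lies in a finitely generated subgroup `⟨F⟩` with
`F ⊆ S` in which the word norms of its powers grow sublinearly. -/
def IsDistortionElement {G : Type*} [Group G] (S : Set G) (g : G) : Prop :=
  g ∈ S ∧ (∀ n : ℕ, 1 ≤ n → g ^ n ≠ 1) ∧
    ∃ F : Finset G, ↑F ⊆ S ∧ g ∈ Subgroup.closure (F : Set G) ∧
      Filter.Tendsto (fun n : ℕ => (wordNorm (F : Set G) (g ^ n) : ℝ) / n)
        Filter.atTop (nhds 0)

namespace Conveyor

/-- Core state of the head: control bit, delay counter, direction (`true` is left), sheet. -/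
abbrev Core := Bool × Fin 3 × Bool × Fin 3

/-- State of the head: core state and a one-symbol buffer. -/
abbrev State := Core × Fin 3

/-- Gates: a permutation of the state and the scanned symbol, or a conditional move. -/
abbrev Gate := Equiv.Perm (State × Fin 3) ⊕ (Core → Bool)

/-- Configurations of the machine on a cyclic tape, read from the head onwards. -/
abbrev Cfg (n : ℕ) := State × ZMod n × List (Fin 3)

/-- Apply a permutation to the state and the scanned symbol. -/
def actP (n : ℕ) (π : Equiv.Perm (State × Fin 3)) : Equiv.Perm (Cfg n) where
  toFun c := match c with
    | (s, o, []) => (s, o, [])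
    | (s, o, z :: t) => ((π (s, z)).1, o, (π (s, z)).2 :: t)
  invFun c := match c with
    | (s, o, []) => (s, o, [])
    | (s, o, z :: t) => ((π.symm (s, z)).1, o, (π.symm (s, z)).2 :: t)
  left_inv := by rintro ⟨s, o, _ | ⟨z, t⟩⟩ <;> simp
  right_inv := by rintro ⟨s, o, _ | ⟨z, t⟩⟩ <;> simp

/-- Move the head one cell forward if the core state satisfies `U`. -/
def actM (n : ℕ) (U : Core → Bool) : Equiv.Perm (Cfg n) where
  toFun c := if U c.1.1 then (c.1, c.2.1 + 1, c.2.2.rotate 1) else c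
  invFun c := if U c.1.1 then (c.1, c.2.1 - 1, c.2.2.rotate (c.2.2.length - 1)) else c
  left_inv := by
    rintro ⟨s, o, w⟩
    by_cases h : U s.1
    · rcases w with _ | ⟨z, t⟩
      · simp [h]
      · simp only [h, if_true, add_sub_cancel_right, List.length_rotate, List.rotate_rotate,
          List.length_cons, Nat.add_sub_cancel, Nat.add_comm 1]
        rw [← List.length_cons (a := z), List.rotate_length]
    · simp [h]
  right_inv := by
    rintro ⟨s, o, w⟩
    by_cases h : U s.1
    · rcases w with _ | ⟨z, t⟩
      · simp [h]
      · simp only [h, if_true, sub_add_cancel, List.rotate_rotate,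
          List.length_cons, Nat.add_sub_cancel]
        rw [← List.length_cons (a := z), List.rotate_length]
    · simp [h]

/-- Action of words in the gates on configurations. -/
def eval (n : ℕ) : FreeGroup Gate →* Equiv.Perm (Cfg n) :=
  FreeGroup.lift (Sum.elim (actP n) (actM n))

/-- The word consisting of a single symbol gate. -/
def gP (π : Equiv.Perm (State × Fin 3)) : FreeGroup Gate := FreeGroup.of (Sum.inl π)

/-- The word consisting of a single conditional move. -/
def gM (U : Core → Bool) : FreeGroup Gate := FreeGroup.of (Sum.inr U)

/-- The unconditional move. -/
def mv : FreeGroup Gate := gM fun _ => true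

variable {n : ℕ}

@[simp] lemma eval_gP_cons (π : Equiv.Perm (State × Fin 3)) (s : State) (o : ZMod n) (z : Fin 3)
    (t : List (Fin 3)) :
    eval n (gP π) (s, o, z :: t) = ((π (s, z)).1, o, (π (s, z)).2 :: t) := by
  simp [eval, gP, actP]

lemma eval_gM (U : Core → Bool) (s : State) (o : ZMod n) (w : List (Fin 3)) :
    eval n (gM U) (s, o, w) = if U s.1 then (s, o + 1, w.rotate 1) else (s, o, w) := by
  simp [eval, gM, actM]

lemma eval_gM_inv (U : Core → Bool) (s : State) (o : ZMod n) (w : List (Fin 3)) :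
    eval n (gM U)⁻¹ (s, o, w) =
      if U s.1 then (s, o - 1, w.rotate (w.length - 1)) else (s, o, w) := by
  rw [map_inv]
  simp [eval, gM, actM, Equiv.Perm.inv_def]

@[simp] lemma eval_gM_cons (U : Core → Bool) (s : State) (o : ZMod n) (z : Fin 3)
    (t : List (Fin 3)) :
    eval n (gM U) (s, o, z :: t) = if U s.1 then (s, o + 1, t ++ [z]) else (s, o, z :: t) := by
  simp [eval_gM]

lemma eval_inv_eq_iff (u : FreeGroup Gate) (c d : Cfg n) :
    eval n u⁻¹ c = d ↔ c = eval n u d := by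
  rw [map_inv, Equiv.Perm.inv_eq_iff_eq]

@[simp] lemma eval_mv_cons (s : State) (o : ZMod n) (z : Fin 3) (t : List (Fin 3)) :
    eval n mv (s, o, z :: t) = (s, o + 1, t ++ [z]) := by
  simp [mv]

@[simp] lemma eval_mv_inv_cons_append (s : State) (o : ZMod n) (x z : Fin 3) (t : List (Fin 3)) :
    eval n mv⁻¹ (s, o, x :: (t ++ [z])) = (s, o - 1, z :: x :: t) := by
  rw [eval_inv_eq_iff]; simp

lemma eval_mul (u v : FreeGroup Gate) (c : Cfg n) : eval n (u * v) c = eval n u (eval n v c) := by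
  simp

lemma length_eval (u : FreeGroup Gate) (c : Cfg n) : (eval n u c).2.2.length = c.2.2.length := by
  induction u using FreeGroup.induction_on generalizing c with
  | C1 => simp
  | of g =>
    obtain ⟨s, o, w⟩ := c
    rcases g with π | U
    · change (eval n (gP π) _).2.2.length = _
      rcases w with _ | ⟨z, t⟩
      · simp [eval, gP, actP]
      · simp
    · change (eval n (gM U) _).2.2.length = _
      rw [eval_gM]
      split_ifs <;> simp
  | inv_of g ih =>
    have := ih (eval n (FreeGroup.of g)⁻¹ c)
    simpa using this.symm
  | mul x y hx hy => rw [eval_mul, hx, hy]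

/-- Swap the buffer and the scanned symbol if `U` holds. -/
def swapPerm (U : Core → Bool) : Equiv.Perm (State × Fin 3) :=
  Function.Involutive.toPerm
    (fun x => if U x.1.1 then ((x.1.1, x.2), x.1.2) else x)
    (by rintro ⟨⟨c, β⟩, z⟩; by_cases h : U c <;> simp [h])

@[simp] lemma swapPerm_apply (U : Core → Bool) (c : Core) (β z : Fin 3) :
    swapPerm U ((c, β), z) = if U c then ((c, z), β) else ((c, β), z) := rfl

/-- Swap the buffer and the scanned symbol if `U` holds. -/
def sw (U : Core → Bool) : FreeGroup Gate := gP (swapPerm U)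

/-- Exchange the scanned symbol and the next one if `U` holds. -/
def tau (U : Core → Bool) : FreeGroup Gate := sw U * mv⁻¹ * sw U * mv * sw U

lemma eval_tau (U : Core → Bool) (s : State) (o : ZMod n) (x y : Fin 3) (t : List (Fin 3)) :
    eval n (tau U) (s, o, x :: y :: t) =
      if U s.1 then (s, o, y :: x :: t) else (s, o, x :: y :: t) := by
  obtain ⟨c, β⟩ := s
  by_cases h : U c <;> simp [tau, eval_mul, sw, h, -map_mul, -map_inv]

/-- Move the scanned block of `j` symbols past the following symbol if `U` holds. -/
def carry (U : Core → Bool) : ℕ → FreeGroup Gate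
  | 0 => 1
  | j + 1 => tau U * mv⁻¹ * carry U j * mv

lemma exists_cons_cons {w : List (Fin 3)} (h : 2 ≤ w.length) : ∃ z y t, w = z :: y :: t := by
  match w, h with
  | z :: y :: t, _ => exact ⟨z, y, t, rfl⟩

lemma eval_carry_of_not {U : Core → Bool} {s : State} (h : ¬ U s.1) (j : ℕ) (o : ZMod n)
    {w : List (Fin 3)} (hw : 2 ≤ w.length) :
    eval n (carry U j) (s, o, w) = (s, o, w) := by
  induction j generalizing o w with
  | zero => simp [carry]
  | succ j ih =>
    obtain ⟨x, y, t, rfl⟩ := exists_cons_cons hw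
    simp only [carry, eval_mul, eval_mv_cons]
    rw [ih _ (by simp), List.cons_append, eval_mv_inv_cons_append, eval_tau]
    simp [h]

lemma eval_carry (U : Core → Bool) (s : State) (o : ZMod n) (m : List (Fin 3)) (y : Fin 3)
    (t : List (Fin 3)) :
    eval n (carry U m.length) (s, o, m ++ y :: t) =
      if U s.1 then (s, o, y :: (m ++ t)) else (s, o, m ++ y :: t) := by
  induction m generalizing o t with
  | nil => simp [carry]
  | cons x m ih =>
    by_cases h : U s.1
    · simp only [List.length_cons, carry, List.cons_append, eval_mul, eval_mv_cons]
      rw [List.append_assoc, List.cons_append, ih]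
      simp only [h, if_true]
      rw [← List.append_assoc, eval_mv_inv_cons_append, eval_tau]
      simp [h]
    · rw [eval_carry_of_not h _ _ (by simp; omega), if_neg h]

/-- Insert the passive block `m` after the second cell. -/
def emb (m : List (Fin 3)) (c : Cfg n) : Cfg n :=
  (c.1, c.2.1, c.2.2.take 2 ++ (m ++ c.2.2.drop 2))

@[simp] lemma emb_mk (m : List (Fin 3)) (s : State) (o : ZMod n) (z y : Fin 3)
    (t : List (Fin 3)) : emb m (s, o, z :: y :: t) = (s, o, z :: y :: (m ++ t)) := rfl

/-- The substitution making words skip a passive block of `j` cells after the second cell. -/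
def skip (j : ℕ) : FreeGroup Gate →* FreeGroup Gate :=
  FreeGroup.lift (Sum.elim gP fun U => mv⁻¹ * carry U j * mv * gM U)

lemma skip_gP (j : ℕ) (π : Equiv.Perm (State × Fin 3)) : skip j (gP π) = gP π := by
  simp [skip, gP]

lemma skip_gM (j : ℕ) (U : Core → Bool) :
    skip j (gM U) = mv⁻¹ * carry U j * mv * gM U := by
  simp [skip, gM]

lemma eval_skip_emb (m : List (Fin 3)) (u : FreeGroup Gate) (c : Cfg n) (hc : 2 ≤ c.2.2.length) :
    eval n (skip m.length u) (emb m c) = emb m (eval n u c) := by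
  induction u using FreeGroup.induction_on generalizing c with
  | C1 => simp
  | of g =>
    obtain ⟨s, o, w⟩ := c
    obtain ⟨z, y, t, rfl⟩ := exists_cons_cons hc
    rcases g with π | U
    · change eval n (skip m.length (gP π)) _ = emb m (eval n (gP π) _)
      simp [skip_gP]
    · change eval n (skip m.length (gM U)) _ = emb m (eval n (gM U) _)
      rw [skip_gM]
      by_cases h : U s.1
      · simp only [emb_mk, eval_mul, eval_gM_cons, h, if_true, List.cons_append, eval_mv_cons]
        obtain ⟨x, t', ht⟩ : ∃ x t', t ++ [z] = x :: t' := by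
          rcases t with _ | ⟨x, t'⟩
          · exact ⟨z, [], rfl⟩
          · exact ⟨x, t' ++ [z], rfl⟩
        have : m ++ t ++ [z] ++ [y] = m ++ x :: (t' ++ [y]) := by
          rw [List.append_assoc m, ht]; simp
        rw [this, eval_carry, ht, emb_mk]
        simp only [h, if_true]
        rw [← List.append_assoc, eval_mv_inv_cons_append]
        simp
      · simp only [emb_mk, eval_mul, eval_gM_cons, h, List.cons_append]
        simp only [Bool.false_eq_true, if_false, eval_mv_cons]
        rw [eval_carry_of_not h _ _ (by simp; omega), List.cons_append, eval_mv_inv_cons_append]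
        simp
  | inv_of g ih =>
    rw [map_inv, eval_inv_eq_iff, ih _ (by rwa [length_eval])]
    simp
  | mul x y hx hy =>
    rw [map_mul, eval_mul, eval_mul, hy _ hc, hx _ (by simpa [length_eval] using hc)]

end Conveyor

namespace Conveyor

variable {n : ℕ}

/-- Control bit, delay counter and direction. -/
abbrev Ctl := Bool × Fin 3 × Bool

/-- The delay of the instruction scanning `z` in control state `q`. -/
def delay : Bool → Fin 3 → ℕ
  | false, 0 => 3
  | false, _ => 2
  | true, 1 => 3
  | true, _ => 1

/-- The instructions: new control state, new symbol, and whether the direction is reversed. -/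
def instr : Bool → Fin 3 → Bool × Fin 3 × Bool
  | false, 0 => (false, 1, true)
  | false, 1 => (true, 0, false)
  | false, 2 => (true, 1, false)
  | true, 0 => (false, 0, true)
  | true, 1 => (true, 2, true)
  | true, 2 => (false, 2, true)

/-- The stationary part of one step. -/
def stepFun (x : Ctl × Fin 3) : Ctl × Fin 3 :=
  if delay x.1.1 x.2 ≤ x.1.2.1.val then x
  else if x.1.2.1.val + 1 < delay x.1.1 x.2 then ((x.1.1, x.1.2.1 + 1, x.1.2.2), x.2)
  else (((instr x.1.1 x.2).1, 0, xor (instr x.1.1 x.2).2.2 x.1.2.2), (instr x.1.1 x.2).2.1)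

lemma stepFun_injective : Function.Injective stepFun := by
  decide +kernel

/-- Stationary steps inside a window of two cells. -/
def winStep (x : Ctl × Fin 3 × Fin 3) : Ctl × Fin 3 × Fin 3 :=
  if x.1.2.2 then ((stepFun (x.1, x.2.1)).1, (stepFun (x.1, x.2.1)).2, x.2.2)
  else ((stepFun (x.1, x.2.2)).1, x.2.1, (stepFun (x.1, x.2.2)).2)

/-- The substitution replacing a scanned symbol by two symbols. -/
def psiFun (x : Ctl × Fin 3 × Fin 3) : Ctl × Fin 3 × Fin 3 :=
  if delay x.1.1 x.2.1 ≤ x.1.2.1.val then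
    if x.1.2.2 then x else (x.1, x.2.2, x.2.1)
  else
    winStep^[3 * x.1.2.1.val + x.2.2.val]
      (if x.1.2.2 then ((true, 0, true), x.2.1, if x.1.1 then 1 else 0)
        else ((true, 0, false), if x.1.1 then 1 else 0, x.2.1))

lemma psiFun_injective : Function.Injective psiFun := by
  decide +kernel

/-- Window of four cells with the position of the head. -/
abbrev Win := Ctl × Fin 4 × Fin 3 × Fin 3 × Fin 3 × Fin 3

/-- The move following a stationary step. -/
def winMove (c : Ctl) (p : Fin 4) (x : Fin 3 × Fin 3 × Fin 3 × Fin 3) : Option Win :=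
  if c.2.1 = 0 then
    if c.2.2 then (if p = 0 then none else some (c, p - 1, x))
    else (if p = 3 then none else some (c, p + 1, x))
  else some (c, p, x)

/-- One step of the machine inside a window. -/
def winRun : Win → Option Win
  | (c, 0, u, l, r, y) => winMove (stepFun (c, u)).1 0 ((stepFun (c, u)).2, l, r, y)
  | (c, 1, u, l, r, y) => winMove (stepFun (c, l)).1 1 (u, (stepFun (c, l)).2, r, y)
  | (c, 2, u, l, r, y) => winMove (stepFun (c, r)).1 2 (u, l, (stepFun (c, r)).2, y)
  | (c, 3, u, l, r, y) => winMove (stepFun (c, y)).1 3 (u, l, r, (stepFun (c, y)).2)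

/-- The substitution in a window, applied to the middle cell. -/
def winMid (c : Ctl) (u z y x : Fin 3) : Win :=
  ((psiFun (c, z, x)).1, if (psiFun (c, z, x)).1.2.2 then 1 else 2,
    u, (psiFun (c, z, x)).2.1, (psiFun (c, z, x)).2.2, y)

/-- The substitution in a window, applied to the right cell. -/
def winRight (c : Ctl) (u z y x : Fin 3) : Win :=
  ((psiFun (c, y, x)).1, if (psiFun (c, y, x)).1.2.2 then 2 else 3,
    u, z, (psiFun (c, y, x)).2.1, (psiFun (c, y, x)).2.2)

/-- The substitution in a window, applied to the left cell. -/
def winLeft (c : Ctl) (u z y x : Fin 3) : Win :=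
  ((psiFun (c, u, x)).1, if (psiFun (c, u, x)).1.2.2 then 0 else 1,
    (psiFun (c, u, x)).2.1, (psiFun (c, u, x)).2.2, z, y)

/-- The substitution after one step from the middle cell. -/
def winNext (c : Ctl) (u z y x : Fin 3) : Win :=
  if (stepFun (c, z)).1.2.1 = 0 then
    if (stepFun (c, z)).1.2.2 then winLeft (stepFun (c, z)).1 u (stepFun (c, z)).2 y x
    else winRight (stepFun (c, z)).1 u (stepFun (c, z)).2 y x
  else winMid (stepFun (c, z)).1 u (stepFun (c, z)).2 y x

set_option synthInstance.maxHeartbeats 200000 in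
set_option synthInstance.maxSize 1000 in
lemma winRun_three (c : Ctl) (u z y x : Fin 3) :
    (((winRun (winMid c u z y x)).bind winRun).bind winRun) = some (winNext c u z y x) := by
  revert c u z y x
  decide +kernel

/-- The machine on short cyclic tapes. -/
def stepList (x : Ctl × ℤ × List (Fin 3)) : Ctl × ℤ × List (Fin 3) :=
  match x with
  | (c, o, []) => (c, o, [])
  | (c, o, z :: t) =>
    let r := stepFun (c, z)
    if r.1.2.1 = 0 then
      if r.1.2.2 then (r.1, o - 1, (r.2 :: t).rotate t.length)
      else (r.1, o + 1, t ++ [r.2])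
    else (r.1, o, r.2 :: t)

/-- The substitution on short cyclic tapes. -/
def phiList (x : Fin 3) (a : Ctl × ℤ × List (Fin 3)) : Ctl × ℤ × List (Fin 3) :=
  match a with
  | (c, o, []) => (c, o, [])
  | (c, o, z :: t) =>
    let r := psiFun (c, z, x)
    if r.1.2.2 then (r.1, o, r.2.1 :: r.2.2 :: t)
    else (r.1, o + 1, r.2.2 :: (t ++ [r.2.1]))

lemma stepList_three (c : Ctl) (z y x : Fin 3) :
    stepList^[3] (phiList x (c, 0, [z, y])) = phiList x (stepList (c, 0, [z, y])) := by
  revert c z y x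
  decide +kernel

lemma stepList_period (c : Ctl) (z y : Fin 3) :
    ((stepList^[18] (c, 0, [z, y])).1, (stepList^[18] (c, 0, [z, y])).2.2) = (c, [z, y]) := by
  revert c z y
  decide +kernel

end Conveyor

namespace Conveyor

variable {n : ℕ}

/-- The state with given control, sheet and buffer. -/
def mkState (c : Ctl) (b β : Fin 3) : State := ((c.1, c.2.1, c.2.2, b), β)

lemma exists_mkState (s : State) : ∃ c b β, s = mkState c b β :=
  ⟨(s.1.1, s.1.2.1, s.1.2.2.1), s.1.2.2.2, s.2, rfl⟩

/-- The stationary part of a step, as a permutation acting on the sheet `0`. -/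
noncomputable def stepPerm : Equiv.Perm (State × Fin 3) :=
  Equiv.ofBijective
    (fun x => if x.1.1.2.2.2 = 0 then
      (mkState (stepFun ((x.1.1.1, x.1.1.2.1, x.1.1.2.2.1), x.2)).1 0 x.1.2,
        (stepFun ((x.1.1.1, x.1.1.2.1, x.1.1.2.2.1), x.2)).2) else x)
    (Finite.injective_iff_bijective.1 (by
      rintro ⟨⟨⟨q, i, d, b⟩, β⟩, z⟩ ⟨⟨⟨q', i', d', b'⟩, β'⟩, z'⟩ h
      by_cases hb : b = 0 <;> by_cases hb' : b' = 0 <;>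
        simp only [hb, hb', if_true, if_false, mkState, Prod.mk.injEq] at h
      · have : stepFun ((q, i, d), z) = stepFun ((q', i', d'), z') := by
          ext1 <;> grind
        have := stepFun_injective this
        grind
      · grind
      · grind
      · grind))

lemma stepPerm_mkState (c : Ctl) (β z : Fin 3) :
    stepPerm (mkState c 0 β, z) = (mkState (stepFun (c, z)).1 0 β, (stepFun (c, z)).2) := by
  simp [stepPerm, mkState]

lemma stepPerm_mkState_of_ne (c : Ctl) {b : Fin 3} (hb : b ≠ 0) (β z : Fin 3) :
    stepPerm (mkState c b β, z) = (mkState c b β, z) := by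
  simp [stepPerm, mkState, hb]

/-- One step of the machine on the sheet `0`. -/
noncomputable def f0 : FreeGroup Gate :=
  gM (fun c => c.2.1 = 0 ∧ c.2.2.1 = false ∧ c.2.2.2 = 0) *
    (gM (fun c => c.2.1 = 0 ∧ c.2.2.1 = true ∧ c.2.2.2 = 0))⁻¹ * gP stepPerm

lemma eval_f0_of_ne (c : Ctl) {b : Fin 3} (hb : b ≠ 0) (β : Fin 3) (o : ZMod n)
    (w : List (Fin 3)) (hw : w ≠ []) :
    eval n f0 (mkState c b β, o, w) = (mkState c b β, o, w) := by
  obtain ⟨z, t, rfl⟩ := List.exists_cons_of_ne_nil hw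
  rw [f0, eval_mul, eval_mul, eval_gP_cons, stepPerm_mkState_of_ne _ hb, eval_gM_inv]
  simp [mkState, hb, eval_gM]

lemma eval_f0 (c : Ctl) (β z : Fin 3) (o : ZMod n) (t : List (Fin 3)) :
    eval n f0 (mkState c 0 β, o, z :: t) =
      if (stepFun (c, z)).1.2.1 = 0 then
        if (stepFun (c, z)).1.2.2 then
          (mkState (stepFun (c, z)).1 0 β, o - 1, ((stepFun (c, z)).2 :: t).rotate t.length)
        else (mkState (stepFun (c, z)).1 0 β, o + 1, t ++ [(stepFun (c, z)).2])
      else (mkState (stepFun (c, z)).1 0 β, o, (stepFun (c, z)).2 :: t) := by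
  rw [f0, eval_mul, eval_mul, eval_gP_cons, stepPerm_mkState, eval_gM_inv]
  generalize stepFun (c, z) = r
  obtain ⟨⟨q, i, d⟩, z'⟩ := r
  by_cases hi : i = 0 <;> cases d <;> simp [mkState, hi, eval_gM]

/-- The permutation of the state and the scanned symbol implementing a permutation of the core,
the scanned symbol and the buffer. -/
def gammaPerm (ψ : Equiv.Perm (Core × Fin 3 × Fin 3)) : Equiv.Perm (State × Fin 3) :=
  let e : State × Fin 3 ≃ Core × Fin 3 × Fin 3 :=
    ⟨fun x => (x.1.1, x.2, x.1.2), fun y => ((y.1, y.2.2), y.2.1), fun _ => rfl, fun _ => rfl⟩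
  (e.trans ψ).trans e.symm

/-- Apply a permutation to the core, the scanned symbol and the next symbol. -/
def gamma (ψ : Equiv.Perm (Core × Fin 3 × Fin 3)) : FreeGroup Gate :=
  mv⁻¹ * sw (fun _ => true) * mv * gP (gammaPerm ψ) * mv⁻¹ * sw (fun _ => true) * mv

lemma eval_gamma (ψ : Equiv.Perm (Core × Fin 3 × Fin 3)) (c : Core) (β : Fin 3) (o : ZMod n)
    (z x : Fin 3) (t : List (Fin 3)) :
    eval n (gamma ψ) ((c, β), o, z :: x :: t) =
      (((ψ (c, z, x)).1, β), o, (ψ (c, z, x)).2.1 :: (ψ (c, z, x)).2.2 :: t) := by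
  simp [gamma, eval_mul, sw, gammaPerm, -map_mul, -map_inv]

/-- The substitution, as a permutation acting on all sheets. -/
noncomputable def psiPerm : Equiv.Perm (Core × Fin 3 × Fin 3) :=
  Equiv.ofBijective
    (fun x => ((mkState (psiFun ((x.1.1, x.1.2.1, x.1.2.2.1), x.2)).1 x.1.2.2.2 0).1,
        (psiFun ((x.1.1, x.1.2.1, x.1.2.2.1), x.2)).2))
    (Finite.injective_iff_bijective.1 (by
      rintro ⟨⟨q, i, d, b⟩, z⟩ ⟨⟨q', i', d', b'⟩, z'⟩ h
      simp only [mkState, Prod.mk.injEq] at h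
      have : psiFun ((q, i, d), z) = psiFun ((q', i', d'), z') := by
        ext1 <;> grind
      have := psiFun_injective this
      grind))

/-- The word implementing the substitution, next to a passive cell. -/
noncomputable def Psi : FreeGroup Gate :=
  gM (fun c => c.2.2.1 = false) * gamma psiPerm * (mv⁻¹ * tau (fun _ => true) * mv)

/-- The substitution inserting the symbol `x`. -/
noncomputable def phi (x : Fin 3) (c : Cfg n) : Cfg n := eval n Psi (emb [x] c)

lemma phi_mk (x : Fin 3) (c : Ctl) (b β : Fin 3) (o : ZMod n) (z y : Fin 3) (t : List (Fin 3)) :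
    phi x (mkState c b β, o, z :: y :: t) =
      if (psiFun (c, z, x)).1.2.2 then (mkState (psiFun (c, z, x)).1 b β, o,
        (psiFun (c, z, x)).2.1 :: (psiFun (c, z, x)).2.2 :: y :: t)
      else (mkState (psiFun (c, z, x)).1 b β, o + 1,
        (psiFun (c, z, x)).2.2 :: ((y :: t) ++ [(psiFun (c, z, x)).2.1])) := by
  rw [phi, emb_mk, Psi, eval_mul, eval_mul, eval_mul, eval_mul, eval_mv_cons, List.cons_append,
    List.cons_append, List.nil_append, List.cons_append, eval_tau]
  simp only [if_true]
  rw [← List.cons_append, eval_mv_inv_cons_append, mkState, eval_gamma]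
  simp only [psiPerm, Equiv.ofBijective_apply]
  generalize psiFun ((c.1, c.2.1, c.2.2), z, x) = r
  obtain ⟨⟨q, i, d⟩, z'⟩ := r
  cases d <;> simp [mkState]

/-- The cyclic configuration containing a window. -/
def place (β : Fin 3) (o : ZMod n) (t : List (Fin 3)) : Win → Cfg n
  | (c, 0, u, l, r, y) => (mkState c 0 β, o - 1, u :: l :: r :: y :: t)
  | (c, 1, u, l, r, y) => (mkState c 0 β, o, l :: r :: y :: (t ++ [u]))
  | (c, 2, u, l, r, y) => (mkState c 0 β, o + 1, r :: y :: (t ++ [u, l]))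
  | (c, 3, u, l, r, y) => (mkState c 0 β, o + 2, y :: (t ++ [u, l, r]))

set_option linter.unusedSimpArgs false in
lemma eval_f0_place (β : Fin 3) (o : ZMod n) (t : List (Fin 3)) {v v' : Win}
    (h : winRun v = some v') : eval n f0 (place β o t v) = place β o t v' := by
  obtain ⟨c, p, u, l, r, y⟩ := v
  fin_cases p <;>
    simp only [winRun, winMove, Fin.zero_eta, Fin.mk_one, Fin.reduceFinMk] at h <;>
    simp only [place, Fin.zero_eta, Fin.mk_one, Fin.reduceFinMk, eval_f0] <;>
    split_ifs at h ⊢ <;> simp_all <;> subst h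
  all_goals (try simp [place])
  · have := List.rotate_append_length_eq (t ++ [u]) [l, (stepFun (c, r)).2, y]
    simpa using this
  · ring
  · have := List.rotate_append_length_eq (t ++ [u, l]) [r, (stepFun (c, y)).2]
    exact ⟨by ring, by simpa using this⟩

lemma phi_place (β : Fin 3) (o : ZMod n) (t : List (Fin 3)) (c : Ctl) (u z y x : Fin 3) :
    phi x (mkState c 0 β, o, z :: y :: (t ++ [u])) = place β o t (winMid c u z y x) := by
  rw [phi_mk, winMid]
  split_ifs with h <;> simp [place]

lemma phi_eval_f0_place (β : Fin 3) (o : ZMod n) (t : List (Fin 3)) (c : Ctl) (u z y x : Fin 3) :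
    phi x (eval n f0 (mkState c 0 β, o, z :: y :: (t ++ [u]))) =
      place β o t (winNext c u z y x) := by
  rw [eval_f0, winNext]
  generalize stepFun (c, z) = r
  obtain ⟨⟨q, i, d⟩, z'⟩ := r
  by_cases hi : i = 0
  · cases d
    · obtain ⟨v, t', ht⟩ : ∃ v t', t ++ [u, z'] = v :: t' := by
        rcases t with _ | ⟨v, t⟩
        · exact ⟨u, [z'], rfl⟩
        · exact ⟨v, t ++ [u, z'], rfl⟩
      have ht2 : y :: (t ++ [u]) ++ [z'] = y :: v :: t' := by simp [← ht]
      simp only [hi, if_true, Bool.false_eq_true, if_false, ht2, winRight, phi_mk]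
      have ht3 (l : Fin 3) : t ++ [u, z', l] = v :: (t' ++ [l]) := by
        rw [← List.cons_append, ← ht]; simp
      split_ifs <;> simp [place, ht, ht3]
      ring
    · have : (z' :: y :: (t ++ [u])).rotate (y :: (t ++ [u])).length = u :: z' :: y :: t := by
        simp
      simp only [hi, if_true, this, winLeft, phi_mk]
      split_ifs <;> simp [place]
  · simp only [hi, if_false, phi_place]

/-- The control data of a configuration on sheet `0`. -/
def ofList (n : ℕ) (β : Fin 3) (o : ZMod n) (a : Ctl × ℤ × List (Fin 3)) : Cfg n :=
  (mkState a.1 0 β, o + a.2.1, a.2.2)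

lemma eval_f0_ofList (β : Fin 3) (o : ZMod n) (a : Ctl × ℤ × List (Fin 3)) (ha : a.2.2 ≠ []) :
    eval n f0 (ofList n β o a) = ofList n β o (stepList a) := by
  obtain ⟨c, k, w⟩ := a
  obtain ⟨z, t, rfl⟩ := List.exists_cons_of_ne_nil ha
  simp only [ofList, eval_f0, stepList]
  split_ifs <;> simp <;> ring

lemma length_stepList (a : Ctl × ℤ × List (Fin 3)) :
    (stepList a).2.2.length = a.2.2.length := by
  obtain ⟨c, k, _ | ⟨z, t⟩⟩ := a
  · rfl
  · simp only [stepList]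
    split_ifs <;> simp

lemma eval_f0_pow_ofList (β : Fin 3) (o : ZMod n) (k : ℕ) (a : Ctl × ℤ × List (Fin 3))
    (ha : a.2.2 ≠ []) :
    eval n (f0 ^ k) (ofList n β o a) = ofList n β o (stepList^[k] a) := by
  induction k generalizing a with
  | zero => simp
  | succ k ih =>
    rw [pow_succ, eval_mul, eval_f0_ofList _ _ _ ha, ih _ _, Function.iterate_succ_apply]
    rw [← List.length_pos_iff] at ha ⊢
    rwa [length_stepList]

lemma phi_ofList (β : Fin 3) (o : ZMod n) (x : Fin 3) (a : Ctl × ℤ × List (Fin 3))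
    (ha : 2 ≤ a.2.2.length) :
    phi x (ofList n β o a) = ofList n β o (phiList x a) := by
  obtain ⟨c, k, w⟩ := a
  obtain ⟨z, y, t, rfl⟩ := exists_cons_cons ha
  simp only [ofList, phi_mk, phiList]
  split_ifs <;> simp; ring

/-- Self-similarity of the machine: the substitution turns one step into three steps. -/
lemma eval_f0_pow_three_phi (x : Fin 3) (a : Cfg n) (ha : 2 ≤ a.2.2.length) :
    eval n (f0 ^ 3) (phi x a) = phi x (eval n f0 a) := by
  obtain ⟨s, o, w⟩ := a
  obtain ⟨z, y, t, rfl⟩ := exists_cons_cons ha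
  obtain ⟨c, b, β, rfl⟩ := exists_mkState s
  by_cases hb : b = 0
  · subst hb
    rcases List.eq_nil_or_concat t with rfl | ⟨t, u, rfl⟩
    · have h1 : ((mkState c 0 β, o, [z, y]) : Cfg n) = ofList n β o (c, 0, [z, y]) := by
        simp [ofList]
      rw [h1, phi_ofList _ _ _ _ (by simp), eval_f0_pow_ofList, stepList_three, eval_f0_ofList,
        phi_ofList]
      · simp [length_stepList]
      · simp
      · simp only [phiList]
        split_ifs <;> simp
    · obtain ⟨v1, h1, h2⟩ := Option.bind_eq_some_iff.1 (winRun_three c u z y x)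
      obtain ⟨v0, h0, h1⟩ := Option.bind_eq_some_iff.1 h1
      rw [List.concat_eq_append, phi_eval_f0_place, phi_place, pow_three, eval_mul, eval_mul,
        eval_f0_place _ _ _ h0, eval_f0_place _ _ _ h1, eval_f0_place _ _ _ h2]
  · rw [eval_f0_of_ne _ hb _ _ _ (by simp), pow_three, eval_mul, eval_mul]
    simp only [phi_mk]
    split_ifs <;> simp only [eval_f0_of_ne _ hb _ _ _ (List.cons_ne_nil _ _)]

end Conveyor

namespace Conveyor

variable {n : ℕ}

/-- Composition of the substitutions past `0, …, k - 1` passive cells. -/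
noncomputable def nest : ℕ → FreeGroup Gate
  | 0 => 1
  | k + 1 => nest k * skip k Psi

/-- The iterated substitution inserting the symbols of `m`. -/
noncomputable def Phi (m : List (Fin 3)) (c : Cfg n) : Cfg n := eval n (nest m.length) (emb m c)

lemma length_emb (m : List (Fin 3)) (c : Cfg n) (hc : 2 ≤ c.2.2.length) :
    (emb m c).2.2.length = c.2.2.length + m.length := by
  simp [emb]; omega

lemma length_phi (x : Fin 3) (c : Cfg n) (hc : 2 ≤ c.2.2.length) :
    (phi x c).2.2.length = c.2.2.length + 1 := by
  rw [phi, length_eval, length_emb _ _ hc]; rfl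

lemma Phi_append_singleton (m : List (Fin 3)) (x : Fin 3) (c : Cfg n) (hc : 2 ≤ c.2.2.length) :
    Phi (m ++ [x]) c = Phi m (phi x c) := by
  have h : emb (m ++ [x]) c = emb m (emb [x] c) := by
    obtain ⟨s, o, w⟩ := c
    obtain ⟨z, y, t, rfl⟩ := exists_cons_cons hc
    simp
  rw [Phi, Phi, phi, h, List.length_append, List.length_singleton, nest, eval_mul, eval_skip_emb]
  rw [length_emb _ _ hc]; omega

lemma eval_f0_pow_Phi (m : List (Fin 3)) (r : ℕ) (c : Cfg n) (hc : 2 ≤ c.2.2.length) :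
    eval n (f0 ^ (3 ^ m.length * r)) (Phi m c) = Phi m (eval n (f0 ^ r) c) := by
  have key (m : List (Fin 3)) (c : Cfg n) (hc : 2 ≤ c.2.2.length) :
      eval n (f0 ^ 3 ^ m.length) (Phi m c) = Phi m (eval n f0 c) := by
    induction m using List.reverseRecOn generalizing c with
    | nil =>
      obtain ⟨s, o, w⟩ := c
      simp [Phi, nest, emb]
    | append_singleton m x ih =>
      have hp := length_phi x c hc
      rw [Phi_append_singleton _ _ _ hc, Phi_append_singleton _ _ _ (by rwa [length_eval]),
        ← eval_f0_pow_three_phi _ _ hc, List.length_append, List.length_singleton, pow_succ 3,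
        pow_mul, pow_three, pow_three, eval_mul, eval_mul, eval_mul, eval_mul,
        ih _ (by omega), ih _ (by rw [length_eval]; omega),
        ih _ (by rw [length_eval, length_eval]; omega)]
  induction r generalizing c with
  | zero => simp
  | succ r ih =>
    rw [mul_add, mul_one, pow_add, eval_mul, key _ _ hc, ih _ (by rwa [length_eval]), pow_succ,
      eval_mul]

lemma exists_Phi (k : ℕ) (a : Cfg n) (ha : k + 2 ≤ a.2.2.length) :
    ∃ (m : List (Fin 3)) (c : Cfg n), m.length = k ∧ c.2.2.length = a.2.2.length - k ∧
      Phi m c = a := by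
  set a' := eval n (nest k)⁻¹ a with ha'
  have hl : a'.2.2.length = a.2.2.length := length_eval _ _
  obtain ⟨s, o, w⟩ := a'
  obtain ⟨z, y, t, rfl⟩ := exists_cons_cons (w := w) (by simp only at hl; omega)
  simp only [List.length_cons] at hl
  refine ⟨t.take k, (s, o, z :: y :: t.drop k), by simp; omega, by simp; omega, ?_⟩
  rw [Phi, emb_mk, List.take_append_drop, ha']
  have : (t.take k).length = k := by simp; omega
  rw [this]; simp

lemma Phi_injective (m : List (Fin 3)) (c d : Cfg n) (hc : 2 ≤ c.2.2.length)
    (hd : 2 ≤ d.2.2.length) (h : Phi m c = Phi m d) : c = d := by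
  have := (eval n (nest m.length)).injective h
  obtain ⟨s, o, w⟩ := c
  obtain ⟨s', o', w'⟩ := d
  obtain ⟨z, y, t, rfl⟩ := exists_cons_cons hc
  obtain ⟨z', y', t', rfl⟩ := exists_cons_cons hd
  simpa using this

/-- A short word acting as the `3 ^ k`-th power of `f0` on long tapes. -/
noncomputable def fastPow (k : ℕ) : FreeGroup Gate := nest k * skip k f0 * (nest k)⁻¹

lemma eval_fastPow (k : ℕ) (a : Cfg n) (ha : k + 2 ≤ a.2.2.length) :
    eval n (fastPow k) a = eval n (f0 ^ 3 ^ k) a := by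
  obtain ⟨m, c, rfl, hc, rfl⟩ := exists_Phi k a ha
  have hc2 : 2 ≤ c.2.2.length := by omega
  have h := eval_f0_pow_Phi m 1 c hc2
  rw [mul_one, pow_one] at h
  have h2 : eval n (nest m.length)⁻¹ (Phi m c) = emb m c := by simp [Phi]
  rw [h, fastPow, eval_mul, eval_mul, h2, eval_skip_emb _ _ _ hc2, Phi]

lemma stepList_add (a : Ctl × ℤ × List (Fin 3)) (d : ℤ) :
    stepList (a.1, a.2.1 + d, a.2.2) =
      ((stepList a).1, (stepList a).2.1 + d, (stepList a).2.2) := by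
  obtain ⟨c, o, _ | ⟨z, t⟩⟩ := a
  · rfl
  · simp only [stepList]
    split_ifs <;> simp <;> ring

lemma stepList_iterate_add (k : ℕ) (a : Ctl × ℤ × List (Fin 3)) (d : ℤ) :
    stepList^[k] (a.1, a.2.1 + d, a.2.2) =
      ((stepList^[k] a).1, (stepList^[k] a).2.1 + d, (stepList^[k] a).2.2) := by
  induction k generalizing a with
  | zero => rfl
  | succ k ih => rw [Function.iterate_succ_apply, stepList_add, ih, Function.iterate_succ_apply]

lemma exists_stepList_iterate (c : Ctl) (z y : Fin 3) : ∃ D : ℤ, ∀ j : ℕ,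
    stepList^[18 * j] (c, 0, [z, y]) = (c, D * j, [z, y]) := by
  have h := stepList_period c z y
  refine ⟨(stepList^[18] (c, 0, [z, y])).2.1, fun j => ?_⟩
  induction j with
  | zero => simp
  | succ j ih =>
    have h2 := stepList_iterate_add 18 (c, 0, [z, y])
      ((stepList^[18] (c, 0, [z, y])).2.1 * j)
    rw [zero_add] at h2
    rw [mul_add, mul_one, add_comm, Function.iterate_add_apply, ih, h2]
    simp only [Prod.mk.injEq] at h
    rw [h.1, h.2]
    push_cast
    ring_nf

lemma eval_f0_pow_of_ne (c : Ctl) {b : Fin 3} (hb : b ≠ 0) (β : Fin 3) (o : ZMod n)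
    (w : List (Fin 3)) (hw : w ≠ []) (k : ℕ) :
    eval n (f0 ^ k) (mkState c b β, o, w) = (mkState c b β, o, w) := by
  induction k with
  | zero => simp
  | succ k ih => rw [pow_succ, eval_mul, eval_f0_of_ne _ hb _ _ _ hw, ih]

lemma eval_f0_pow_period (c : Cfg n) (hc : 2 ≤ c.2.2.length) :
    eval n (f0 ^ (3 ^ (c.2.2.length - 2) * (18 * n))) c = c := by
  obtain ⟨m, a, hm, ha, rfl⟩ := exists_Phi (c.2.2.length - 2) c (by omega)
  have ha2 : a.2.2.length = 2 := by omega
  rw [← hm, eval_f0_pow_Phi _ _ _ ha2.ge]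
  congr 1
  obtain ⟨s, o, w⟩ := a
  obtain ⟨z, y, rfl⟩ := List.length_eq_two.1 ha2
  obtain ⟨c, b, β, rfl⟩ := exists_mkState s
  by_cases hb : b = 0
  · subst hb
    obtain ⟨D, hD⟩ := exists_stepList_iterate c z y
    have h1 : ((mkState c 0 β, o, [z, y]) : Cfg n) = ofList n β o (c, 0, [z, y]) := by
      simp [ofList]
    rw [h1, eval_f0_pow_ofList _ _ _ _ (by simp), hD]
    simp [ofList]
  · exact eval_f0_pow_of_ne _ hb _ _ _ (by simp) _

set_option maxRecDepth 10000 in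
lemma stepList_iterate_ne (j : ℕ) (hj : j < 18) (h0 : j ≠ 0) :
    ((stepList^[j] ((false, 0, false), 0, [0, 0])).1,
      (stepList^[j] ((false, 0, false), 0, [0, 0])).2.2) ≠ ((false, 0, false), [0, 0]) := by
  revert j
  decide +kernel

lemma exists_eval_f0_pow_ne (r a : ℕ) (hr : ¬ 3 ∣ r) :
    ∃ c : Cfg n, c.2.2.length = a + 2 ∧ eval n (f0 ^ (3 ^ a * r)) c ≠ c := by
  set d : Cfg n := ofList n 0 0 ((false, 0, false), 0, [0, 0]) with hd
  have hd2 : d.2.2.length = 2 := rfl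
  have hne : eval n (f0 ^ r) d ≠ d := by
    intro h
    rw [hd, eval_f0_pow_ofList _ _ _ _ (by simp)] at h
    obtain ⟨D, hD⟩ := exists_stepList_iterate (false, 0, false) 0 0
    have h2 := stepList_iterate_add (r % 18) ((false, 0, false), 0, [0, 0])
      (D * ((r / 18 : ℕ) : ℤ))
    rw [zero_add, ← hD, ← Function.iterate_add_apply, Nat.mod_add_div] at h2
    refine stepList_iterate_ne (r % 18) (Nat.mod_lt _ (by norm_num)) (by omega) ?_
    rw [h2] at h
    simp only [ofList, mkState, Prod.mk.injEq] at h
    simp only [Prod.ext_iff]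
    tauto
  refine ⟨Phi (List.replicate a 0) d, ?_, fun h => hne ?_⟩
  · rw [Phi, length_eval, length_emb _ _ hd2.ge, hd2, List.length_replicate, add_comm]
  · have h3 := eval_f0_pow_Phi (List.replicate a 0) r d hd2.ge
    rw [List.length_replicate, h] at h3
    exact Phi_injective _ _ _ (by rw [length_eval, hd2]) hd2.ge h3.symm

/-- Configurations with tape length `L`. -/
abbrev CfgAt (n L : ℕ) := {c : Cfg n // c.2.2.length = L}

/-- Action of words on the configurations with a given tape length. -/
def evalAt (n L : ℕ) : FreeGroup Gate →* Equiv.Perm (CfgAt n L) where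
  toFun u := (eval n u).subtypePerm fun c => by rw [length_eval]
  map_one' := by ext1 c; simp
  map_mul' u v := by ext1 c; exact Subtype.ext (eval_mul u v c.1)

lemma coe_evalAt (n L : ℕ) (u : FreeGroup Gate) (c : CfgAt n L) :
    (evalAt n L u c : Cfg n) = eval n u c := rfl

lemma evalAt_ext {L : ℕ} {u v : FreeGroup Gate}
    (h : ∀ c : Cfg n, c.2.2.length = L → eval n u c = eval n v c) :
    evalAt n L u = evalAt n L v := by
  ext1 c
  exact Subtype.ext (h c c.2)

lemma evalAt_fastPow {k L : ℕ} (h : k + 2 ≤ L) :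
    evalAt n L (fastPow k) = evalAt n L f0 ^ 3 ^ k := by
  rw [← map_pow]
  exact evalAt_ext fun c hc => eval_fastPow k c (by omega)

lemma evalAt_f0_pow_period (k : ℕ) :
    evalAt n (k + 2) f0 ^ (3 ^ k * (18 * n)) = 1 := by
  rw [← map_pow, ← map_one (evalAt n (k + 2))]
  refine evalAt_ext fun c hc => ?_
  have h := eval_f0_pow_period c (by omega)
  rw [hc, Nat.add_sub_cancel] at h
  rw [h]; simp

/-- Add `t` to the sheet. -/
def sheetPerm (t : Fin 3) : Equiv.Perm (State × Fin 3) where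
  toFun x := (((x.1.1.1, x.1.1.2.1, x.1.1.2.2.1, x.1.1.2.2.2 + t), x.1.2), x.2)
  invFun x := (((x.1.1.1, x.1.1.2.1, x.1.1.2.2.1, x.1.1.2.2.2 - t), x.1.2), x.2)
  left_inv x := by simp
  right_inv x := by simp

/-- Add `t` to the sheet. -/
def sigma (t : Fin 3) : FreeGroup Gate := gP (sheetPerm t)

lemma eval_sigma (c : Ctl) (b β t : Fin 3) (o : ZMod n) {w : List (Fin 3)} (hw : w ≠ []) :
    eval n (sigma t) (mkState c b β, o, w) = (mkState c (b + t) β, o, w) := by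
  obtain ⟨z, w, rfl⟩ := List.exists_cons_of_ne_nil hw
  simp [sigma, sheetPerm, mkState]

lemma eval_sigma_inv (c : Ctl) (b β t : Fin 3) (o : ZMod n) {w : List (Fin 3)} (hw : w ≠ []) :
    eval n (sigma t)⁻¹ (mkState c b β, o, w) = (mkState c (b - t) β, o, w) := by
  rw [eval_inv_eq_iff, eval_sigma _ _ _ _ _ hw, sub_add_cancel]

lemma evalAt_sigma_add {L : ℕ} (hL : 1 ≤ L) (s t : Fin 3) :
    evalAt n L (sigma s * sigma t) = evalAt n L (sigma (s + t)) := by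
  refine evalAt_ext ?_
  rintro ⟨s, o, w⟩ hc
  have hw : w ≠ [] := by rintro rfl; simp at hc; omega
  obtain ⟨c, b, β, rfl⟩ := exists_mkState s
  rw [eval_mul, eval_sigma _ _ _ _ _ hw, eval_sigma _ _ _ _ _ hw, eval_sigma _ _ _ _ _ hw,
    add_assoc, add_comm t]

lemma evalAt_sigma_zero {L : ℕ} (hL : 1 ≤ L) : evalAt n L (sigma 0) = 1 := by
  have := evalAt_sigma_add (n := n) hL 0 0
  simpa using this

/-- Add the scanned symbol to the sheet. -/
def readPerm : Equiv.Perm (State × Fin 3) where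
  toFun x := (((x.1.1.1, x.1.1.2.1, x.1.1.2.2.1, x.1.1.2.2.2 + x.2), x.1.2), x.2)
  invFun x := (((x.1.1.1, x.1.1.2.1, x.1.1.2.2.1, x.1.1.2.2.2 - x.2), x.1.2), x.2)
  left_inv x := by simp
  right_inv x := by simp

/-- Add the symbol at distance `j` to the sheet. -/
def readAt (j : ℕ) : FreeGroup Gate := (mv ^ j)⁻¹ * gP readPerm * mv ^ j

/-- Add `e` to the scanned symbol. -/
def symPerm (e : Fin 3) : Equiv.Perm (State × Fin 3) where
  toFun x := (x.1, x.2 + e)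
  invFun x := (x.1, x.2 - e)
  left_inv x := by simp
  right_inv x := by simp

lemma eval_mv_pow (j : ℕ) (s : State) (o : ZMod n) (w : List (Fin 3)) :
    eval n (mv ^ j) (s, o, w) = (s, o + j, w.rotate j) := by
  induction j generalizing o w with
  | zero => simp
  | succ j ih =>
    rw [pow_succ, eval_mul, mv, eval_gM, if_pos rfl]
    rw [mv] at ih
    rw [ih, List.rotate_rotate, add_comm 1 j]
    push_cast
    ring_nf

lemma eval_readAt (j : ℕ) (c : Ctl) (b β : Fin 3) (o : ZMod n) (w : List (Fin 3))
    (hw : w ≠ []) : eval n (readAt j) (mkState c b β, o, w) =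
      (mkState c (b + w[j % w.length]'(Nat.mod_lt _ (List.length_pos_iff.2 hw))) β, o, w) := by
  rw [readAt, eval_mul, eval_mul, eval_mv_pow, eval_inv_eq_iff, eval_mv_pow]
  obtain ⟨z, t, h⟩ := List.exists_cons_of_ne_nil (l := w.rotate j) (by simpa using hw)
  have h2 : w[j % w.length]'(Nat.mod_lt _ (List.length_pos_iff.2 hw)) = z := by
    have h3 : (w.rotate j)[0]'(by simp [h]) = z := by simp [h]
    rw [← h3, List.getElem_rotate]
    simp
  rw [h2, h]
  simp [readPerm, mkState]

/-- Change the sheet by `-e` if the tape length divides `j`. -/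
def divTest (e : Fin 3) (j : ℕ) : FreeGroup Gate :=
  gP (symPerm e) * readAt j * (gP (symPerm e))⁻¹ * (readAt j)⁻¹

lemma evalAt_divTest (e : Fin 3) (j : ℕ) {L : ℕ} (hL : 1 ≤ L) :
    evalAt n L (divTest e j) = evalAt n L (sigma (if L ∣ j then -e else 0)) := by
  have key : evalAt n L (gP (symPerm e) * readAt j) =
      evalAt n L (sigma (if L ∣ j then -e else 0) * (readAt j * gP (symPerm e))) := by
    refine evalAt_ext ?_
    rintro ⟨s, o, w⟩ hc
    obtain ⟨c, b, β, rfl⟩ := exists_mkState s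
    obtain ⟨z, t, rfl⟩ := List.exists_cons_of_ne_nil (l := w) (by rintro rfl; simp at hc; omega)
    have hp (b) : eval n (gP (symPerm e)) (mkState c b β, o, z :: t) =
      (mkState c b β, o, (z + e) :: t) := by simp [symPerm]
    rw [eval_mul, eval_mul, eval_mul, eval_readAt _ _ _ _ _ _ (by simp), hp, hp,
      eval_readAt _ _ _ _ _ _ (by simp), eval_sigma _ _ _ _ _ (by simp)]
    simp only at hc
    have hl : ((z + e) :: t).length = L := by simpa using hc
    congr 2
    simp only [hl, hc]
    by_cases hd : L ∣ j
    · simp [hd, Nat.mod_eq_zero_of_dvd hd, add_assoc]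
    · obtain ⟨i, hi⟩ := Nat.exists_eq_succ_of_ne_zero (fun h => hd (Nat.dvd_of_mod_eq_zero h))
      simp [hd, hi]
  rw [divTest, map_mul, map_mul, key]
  simp [mul_assoc]

/-- The length of the reduced form of a word. -/
noncomputable def len {α : Type*} (u : FreeGroup α) : ℕ :=
  letI := Classical.decEq α
  u.norm

section len

variable {α : Type*} (u v : FreeGroup α)

lemma len_mul_le : len (u * v) ≤ len u + len v := by
  classical exact FreeGroup.norm_mul_le u v

@[simp] lemma len_inv : len u⁻¹ = len u := by
  classical exact FreeGroup.norm_inv_eq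

@[simp] lemma len_one : len (1 : FreeGroup α) = 0 := by
  classical exact FreeGroup.norm_one

@[simp] lemma len_of (a : α) : len (FreeGroup.of a) = 1 := by
  classical exact FreeGroup.norm_of a

lemma len_pow_le (k : ℕ) : len (u ^ k) ≤ k * len u := by
  induction k with
  | zero => simp
  | succ k ih =>
    rw [pow_succ, add_mul, one_mul]
    exact (len_mul_le _ _).trans (Nat.add_le_add_right ih _)

/-- The commutator of two words is at most twice as long as the words together. -/
lemma len_commutator_le : len (u * v * u⁻¹ * v⁻¹) ≤ 2 * len u + 2 * len v := by
  have h1 := len_mul_le (u * v * u⁻¹) v⁻¹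
  have h2 := len_mul_le (u * v) u⁻¹
  have h3 := len_mul_le u v
  simp only [len_inv] at *
  omega

lemma exists_prod_eq (u : FreeGroup α) : ∃ l : List (α × Bool), l.length = len u ∧
    (l.map fun x => cond x.2 (FreeGroup.of x.1) (FreeGroup.of x.1)⁻¹).prod = u := by
  classical
  refine ⟨u.toWord, rfl, ?_⟩
  rw [← FreeGroup.lift_mk, FreeGroup.mk_toWord, FreeGroup.lift_of_apply]

lemma len_map_le {β : Type*} (F : FreeGroup α →* FreeGroup β) {B : ℕ}
    (h : ∀ a, len (F (FreeGroup.of a)) ≤ B) : len (F u) ≤ len u * B := by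
  obtain ⟨l, hl, rfl⟩ := exists_prod_eq u
  rw [← hl]
  clear hl
  induction l with
  | nil => simp
  | cons a l ih =>
    simp only [List.map_cons, List.prod_cons, map_mul, List.length_cons, add_mul, one_mul]
    have h1 := len_mul_le (F (cond a.2 (FreeGroup.of a.1) (FreeGroup.of a.1)⁻¹))
      (F (l.map fun x => cond x.2 (FreeGroup.of x.1) (FreeGroup.of x.1)⁻¹).prod)
    have h2 : len (F (cond a.2 (FreeGroup.of a.1) (FreeGroup.of a.1)⁻¹)) ≤ B := by
      cases a.2 <;> simp [h]
    omega

end len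

lemma len_readAt_le (j : ℕ) : len (readAt j) ≤ 2 * j + 1 := by
  have h1 := len_mul_le ((mv ^ j)⁻¹ * gP readPerm) (mv ^ j)
  have h2 := len_mul_le (mv ^ j)⁻¹ (gP readPerm)
  have h3 := len_pow_le mv j
  rw [len_inv] at h2
  simp only [mv, gM, gP, len_of] at *
  rw [readAt]
  simp only [mv, gM, gP]
  omega

lemma len_divTest_le (e : Fin 3) (j : ℕ) : len (divTest e j) ≤ 4 * j + 4 := by
  have h1 := len_commutator_le (gP (symPerm e)) (readAt j)
  have h2 := len_readAt_le j
  have h3 : len (gP (symPerm e)) = 1 := len_of _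
  rw [divTest]
  omega

/-- Words adding to the sheet a given function of the tape length. -/
lemma exists_lengthTest (K : ℕ) (T : ℕ → Fin 3) (hT : ∀ L, K < L → T L = 0) :
    ∃ u : FreeGroup Gate, len u ≤ K * (4 * K + 4) ∧
      ∀ n L, 1 ≤ L → evalAt n L u = evalAt n L (sigma (T L)) := by
  induction K generalizing T with
  | zero => exact ⟨1, by simp, fun n L hL => by rw [hT L hL, evalAt_sigma_zero hL, map_one]⟩
  | succ K ih =>
    obtain ⟨u, hu, hu'⟩ := ih (fun L => T L - if L ∣ K + 1 then T (K + 1) else 0) (by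
      intro L hL
      rcases Nat.lt_or_eq_of_le (Nat.succ_le_of_lt hL) with h | rfl
      · have : ¬ L ∣ K + 1 := fun h' => by have := Nat.le_of_dvd (by omega) h'; omega
        simp [this, hT L h]
      · simp)
    refine ⟨divTest (-T (K + 1)) (K + 1) * u, ?_, fun n L hL => ?_⟩
    · have h1 := len_mul_le (divTest (-T (K + 1)) (K + 1)) u
      have h2 := len_divTest_le (-T (K + 1)) (K + 1)
      nlinarith
    · rw [map_mul, hu' n L hL, evalAt_divTest _ _ hL, ← map_mul, evalAt_sigma_add hL]
      by_cases h : L ∣ K + 1 <;> simp [h]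

end Conveyor

namespace Conveyor

variable {n : ℕ}

lemma len_tau_le (U : Core → Bool) : len (tau U) ≤ 5 := by
  have h1 := len_mul_le (sw U * mv⁻¹ * sw U * mv) (sw U)
  have h2 := len_mul_le (sw U * mv⁻¹ * sw U) mv
  have h3 := len_mul_le (sw U * mv⁻¹) (sw U)
  have h4 := len_mul_le (sw U) mv⁻¹
  have h5 : len (sw U) = 1 := len_of _
  have h6 : len mv = 1 := len_of _
  rw [len_inv] at h4
  rw [tau]
  omega

lemma len_carry_le (U : Core → Bool) (j : ℕ) : len (carry U j) ≤ 7 * j := by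
  induction j with
  | zero => simp [carry]
  | succ j ih =>
    have h1 := len_mul_le (tau U * mv⁻¹ * carry U j) mv
    have h2 := len_mul_le (tau U * mv⁻¹) (carry U j)
    have h3 := len_mul_le (tau U) mv⁻¹
    have h4 := len_tau_le U
    have h6 : len mv = 1 := len_of _
    rw [len_inv] at h3
    rw [carry]
    omega

lemma len_skip_le (j : ℕ) (u : FreeGroup Gate) : len (skip j u) ≤ len u * (7 * j + 3) := by
  refine len_map_le _ _ fun g => ?_
  rcases g with π | U
  · change len (skip j (gP π)) ≤ _
    rw [skip_gP, gP, len_of]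
    omega
  · change len (skip j (gM U)) ≤ _
    rw [skip_gM]
    have h1 := len_mul_le (mv⁻¹ * carry U j * mv) (gM U)
    have h2 := len_mul_le (mv⁻¹ * carry U j) mv
    have h3 := len_mul_le mv⁻¹ (carry U j)
    have h4 := len_carry_le U j
    have h6 : len mv = 1 := len_of _
    have h7 : len (gM U) = 1 := len_of _
    rw [len_inv] at h3
    omega

lemma len_nest_le (k : ℕ) : len (nest k) ≤ k * (len Psi * (7 * k + 3)) := by
  induction k with
  | zero => simp [nest]
  | succ k ih =>
    have h1 := len_mul_le (nest k) (skip k Psi)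
    have h2 := len_skip_le k Psi
    rw [nest]
    calc len (nest k * skip k Psi) ≤ k * (len Psi * (7 * k + 3)) + len Psi * (7 * k + 3) := by
          omega
      _ = (k + 1) * (len Psi * (7 * k + 3)) := by ring
      _ ≤ _ := by gcongr <;> omega

lemma exists_len_fastPow_le : ∃ C, ∀ k, len (fastPow k) ≤ C * (k + 1) ^ 2 := by
  refine ⟨14 * len Psi + 7 * len f0, fun k => ?_⟩
  have h1 := len_mul_le (nest k * skip k f0) (nest k)⁻¹
  have h2 := len_mul_le (nest k) (skip k f0)
  have h3 := len_nest_le k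
  have h4 := len_skip_le k f0
  rw [len_inv] at h1
  rw [fastPow]
  calc _ ≤ 2 * (k * (len Psi * (7 * k + 3))) + len f0 * (7 * k + 3) := by omega
    _ ≤ 2 * ((k + 1) * (len Psi * (7 * (k + 1)))) + len f0 * (7 * (k + 1) * (k + 1)) := by
        gcongr
        · omega
        · omega
        · nlinarith
    _ = _ := by ring

lemma mkState_sheet_eval_f0 (c : Ctl) (β : Fin 3) (o : ZMod n) (w : List (Fin 3)) (hw : w ≠ []) :
    ∃ c' o' w', w' ≠ [] ∧ eval n f0 (mkState c 0 β, o, w) = (mkState c' 0 β, o', w') := by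
  obtain ⟨z, t, rfl⟩ := List.exists_cons_of_ne_nil hw
  rw [eval_f0]
  split_ifs
  · exact ⟨_, _, _, by simp, rfl⟩
  · exact ⟨_, _, _, by simp, rfl⟩
  · exact ⟨_, _, _, by simp, rfl⟩

lemma eval_f0_inv_of_ne (c : Ctl) {b : Fin 3} (hb : b ≠ 0) (β : Fin 3) (o : ZMod n)
    (w : List (Fin 3)) (hw : w ≠ []) :
    eval n f0⁻¹ (mkState c b β, o, w) = (mkState c b β, o, w) := by
  rw [eval_inv_eq_iff, eval_f0_of_ne _ hb _ _ _ hw]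

/-- The machine running forwards on sheet `0` and backwards on sheet `1`. -/
noncomputable def distortionWord : FreeGroup Gate := f0 * (sigma 1 * f0⁻¹ * (sigma 1)⁻¹)

lemma eval_conj_of_ne (c : Ctl) {b : Fin 3} (hb : b ≠ 1) (β : Fin 3) (o : ZMod n)
    (w : List (Fin 3)) (hw : w ≠ []) :
    eval n (sigma 1 * f0⁻¹ * (sigma 1)⁻¹) (mkState c b β, o, w) = (mkState c b β, o, w) := by
  rw [eval_mul, eval_mul, eval_sigma_inv _ _ _ _ _ hw, eval_f0_inv_of_ne _ _ _ _ _ hw,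
    eval_sigma _ _ _ _ _ hw, sub_add_cancel]
  rwa [sub_ne_zero]

lemma commute_evalAt {L : ℕ} (hL : 1 ≤ L) :
    Commute (evalAt n L f0) (evalAt n L (sigma 1 * f0⁻¹ * (sigma 1)⁻¹)) := by
  rw [Commute, SemiconjBy, ← map_mul, ← map_mul]
  refine evalAt_ext ?_
  rintro ⟨s, o, w⟩ hc
  have hw : w ≠ [] := by rintro rfl; simp at hc; omega
  obtain ⟨c, b, β, rfl⟩ := exists_mkState s
  rw [eval_mul f0, eval_mul _ f0]
  by_cases hb : b = 0
  · subst hb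
    obtain ⟨c', o', w', hw', h⟩ := mkState_sheet_eval_f0 c β o w hw
    rw [eval_conj_of_ne _ (b := 0) (by decide) _ _ _ hw, h,
      eval_conj_of_ne _ (b := 0) (by decide) _ _ _ hw']
  · rw [eval_f0_of_ne _ hb _ _ _ hw]
    by_cases hb1 : b = 1
    · subst hb1
      set d := eval n (sigma 1 * f0⁻¹ * (sigma 1)⁻¹) (mkState c 1 β, o, w) with hd
      suffices h : ∃ c' o' w', w' ≠ [] ∧ d = (mkState c' 1 β, o', w') by
        obtain ⟨c', o', w', hw', h⟩ := h
        rw [h, eval_f0_of_ne _ hb _ _ _ hw']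
      rw [eval_mul, eval_mul, eval_sigma_inv _ _ _ _ _ hw, sub_self] at hd
      set e := eval n f0⁻¹ (mkState c 0 β, o, w) with he
      have hle : e.2.2.length = w.length := length_eval _ _
      have he2 : eval n f0 e = (mkState c 0 β, o, w) := ((eval_inv_eq_iff _ _ _).1 he.symm).symm
      obtain ⟨s, o3, w3⟩ := e
      have hw3 : w3 ≠ [] := by
        rintro rfl
        exact hw (List.length_eq_zero_iff.1 hle.symm)
      obtain ⟨c3, b3, β3, rfl⟩ := exists_mkState s
      by_cases hb3 : b3 = 0
      · subst hb3
        obtain ⟨c', o', w', hw', h⟩ := mkState_sheet_eval_f0 c3 β3 o3 w3 hw3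
        rw [he2] at h
        have : β3 = β := (congrArg (fun x : Cfg n => x.1.2) h).symm
        subst this
        exact ⟨c3, o3, w3, hw3, by rw [hd, eval_sigma _ _ _ _ _ hw3, zero_add]⟩
      · rw [eval_f0_of_ne _ hb3 _ _ _ hw3] at he2
        exact absurd (congrArg (fun x : Cfg n => x.1.1.2.2.2) he2) hb3
    · rw [eval_conj_of_ne _ hb1 _ _ _ hw, eval_f0_of_ne _ hb _ _ _ hw]

lemma evalAt_distortionWord_pow {L : ℕ} (hL : 1 ≤ L) (N : ℕ) :
    evalAt n L (distortionWord ^ N) = evalAt n L f0 ^ N * evalAt n L (sigma 1) *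
      (evalAt n L f0 ^ N)⁻¹ * (evalAt n L (sigma 1))⁻¹ := by
  rw [map_pow, distortionWord, map_mul, (commute_evalAt hL).mul_pow, map_mul, map_mul, map_inv,
    map_inv, conj_pow, inv_pow]
  simp only [mul_assoc]

lemma exists_evalAt_distortionWord_pow_ne (N : ℕ) (hN : 1 ≤ N) :
    ∃ m, 1 ≤ m ∧ evalAt (2 * m) (2 * m) (distortionWord ^ N) ≠ 1 := by
  obtain ⟨a, r, hr, rfl⟩ := Nat.exists_eq_pow_mul_and_not_dvd (n := N) (by omega) 3 (by norm_num)
  have key (n a : ℕ) : evalAt n (a + 2) (distortionWord ^ (3 ^ a * r)) ≠ 1 := by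
    intro h
    obtain ⟨c, hc, hne⟩ := exists_eval_f0_pow_ne (n := n) r a hr
    apply hne
    have h2 := congrArg (fun e => ((e ⟨c, hc⟩ : CfgAt n (a + 2)) : Cfg n)) h
    simp only [coe_evalAt, Equiv.Perm.coe_one, id] at h2
    obtain ⟨s, o, w⟩ := c
    have hw : w ≠ [] := by rintro rfl; simp at hc
    obtain ⟨c, b, β, rfl⟩ := exists_mkState s
    by_cases hb : b = 0
    · subst hb
      have h3 : evalAt n (a + 2) (distortionWord ^ (3 ^ a * r)) =
          evalAt n (a + 2) (f0 ^ (3 ^ a * r) * (sigma 1 * (f0⁻¹) * (sigma 1)⁻¹) ^ (3 ^ a * r)) := by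
        rw [map_pow, distortionWord, map_mul _ f0 _, (commute_evalAt (by omega)).mul_pow,
          ← map_pow, ← map_pow, ← map_mul]
      have h4 := congrArg (fun e => ((e ⟨(mkState c 0 β, o, w), hc⟩ : CfgAt n (a + 2)) : Cfg n)) h3
      simp only [coe_evalAt] at h4
      rw [h2, eval_mul] at h4
      have h5 (j : ℕ) : eval n ((sigma 1 * (f0⁻¹) * (sigma 1)⁻¹) ^ j) (mkState c 0 β, o, w) =
          (mkState c 0 β, o, w) := by
        induction j with
        | zero => simp
        | succ j ih => rw [pow_succ, eval_mul, eval_conj_of_ne _ (by decide) _ _ _ hw, ih]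
      rw [h5] at h4
      exact h4.symm
    · exact eval_f0_pow_of_ne _ hb _ _ _ hw _
  rcases Nat.even_or_odd' a with ⟨i, rfl | rfl⟩
  · exact ⟨i + 1, by omega, key _ (2 * i)⟩
  · refine ⟨i + 2, by omega, fun h => key (2 * (i + 2)) (2 * i + 2) ?_⟩
    have h2 : 3 ^ (2 * i + 2) * r = 3 ^ (2 * i + 1) * r * 3 := by ring
    rw [h2, pow_mul, map_pow]
    exact (congrArg (· ^ 3) h).trans (one_pow 3)

/-- The product of the commutators treating the tapes of length less than `m + 2`. -/
noncomputable def shortWord (V K : ℕ → FreeGroup Gate) : ℕ → FreeGroup Gate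
  | 0 => 1
  | m + 1 => shortWord V K m * (V m * K m * (V m)⁻¹ * (K m)⁻¹)

lemma len_shortWord_le (V K : ℕ → FreeGroup Gate) (m B : ℕ) (hV : ∀ i < m, len (V i) ≤ B)
    (hK : ∀ i < m, len (K i) ≤ B) : len (shortWord V K m) ≤ m * (4 * B) := by
  induction m with
  | zero => simp [shortWord]
  | succ m ih =>
    have h1 := ih (fun i hi => hV i (by omega)) (fun i hi => hK i (by omega))
    have h2 := len_mul_le (shortWord V K m) (V m * K m * (V m)⁻¹ * (K m)⁻¹)
    have h3 := len_commutator_le (V m) (K m)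
    have h4 := hV m (by omega)
    have h5 := hK m (by omega)
    rw [shortWord]
    linarith

lemma evalAt_shortWord (V K : ℕ → FreeGroup Gate) (m : ℕ) {L : ℕ} (hL : 2 ≤ L)
    (x : Equiv.Perm (CfgAt n L))
    (hV : ∀ i < m, L = i + 2 → evalAt n L (V i * K i * (V i)⁻¹ * (K i)⁻¹) = x)
    (hK : ∀ i < m, L ≠ i + 2 → evalAt n L (K i) = 1) :
    evalAt n L (shortWord V K m) = if L < m + 2 then x else 1 := by
  induction m with
  | zero => rw [shortWord, map_one, if_neg (by omega)]
  | succ m ih =>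
    rw [shortWord, map_mul, ih (fun i hi => hV i (by omega)) (fun i hi => hK i (by omega))]
    rcases lt_trichotomy L (m + 2) with h | h | h
    · have h1 : evalAt n L (V m * K m * (V m)⁻¹ * (K m)⁻¹) = 1 := by
        simp [map_mul, map_inv, hK m (by omega) (by omega)]
      rw [h1, if_pos h, if_pos (by omega), mul_one]
    · rw [if_neg (by omega), if_pos (by omega), hV m (by omega) h, one_mul]
    · have h1 : evalAt n L (V m * K m * (V m)⁻¹ * (K m)⁻¹) = 1 := by
        simp [map_mul, map_inv, hK m (by omega) (by omega)]
      rw [h1, if_neg (by omega), if_neg (by omega), mul_one]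

lemma exists_short_word : ∃ C, ∀ k, ∃ u : FreeGroup Gate, len u ≤ C * (k + 2) ^ 4 ∧
    ∀ L, 2 ≤ L → evalAt L L u = evalAt L L (distortionWord ^ 3 ^ k) := by
  obtain ⟨C, hC⟩ := exists_len_fastPow_le
  refine ⟨72 * C + 50, fun k => ?_⟩
  obtain ⟨K₀, hK₀, hK₀'⟩ := exists_lengthTest (k + 1) (fun L => if L < k + 2 then -1 else 0)
    (fun L hL => if_neg (by omega))
  have hex (i : ℕ) := exists_lengthTest (i + 2) (fun L => if L = i + 2 then 1 else 0)
    (fun L hL => if_neg (by omega))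
  choose K hK hK' using hex
  set e : ℕ → ℕ := fun i => 3 ^ (k - i) % (18 * (i + 2)) with he
  set V : ℕ → FreeGroup Gate := fun i => fastPow i ^ e i with hV
  have hsl : len (sigma 1 * K₀) ≤ 1 + (k + 1) * (4 * (k + 1) + 4) := by
    have h1 := len_mul_le (sigma 1) K₀
    have h2 : len (sigma 1) = 1 := len_of _
    omega
  refine ⟨(fastPow k * (sigma 1 * K₀) * (fastPow k)⁻¹ * (sigma 1 * K₀)⁻¹) * shortWord V K k,
    ?_, fun L hL => ?_⟩
  · have h1 := len_mul_le (fastPow k * (sigma 1 * K₀) * (fastPow k)⁻¹ * (sigma 1 * K₀)⁻¹)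
      (shortWord V K k)
    have h2 := len_commutator_le (fastPow k) (sigma 1 * K₀)
    have h3 := hC k
    have h4 := len_shortWord_le V K k ((18 * C + 8) * (k + 2) ^ 3) (fun i hi => by
      calc len (V i) ≤ e i * len (fastPow i) := len_pow_le _ _
        _ ≤ (18 * (i + 2)) * (C * (i + 1) ^ 2) := by
          gcongr
          · exact (Nat.mod_lt _ (by omega)).le
          · exact hC i
        _ ≤ (18 * (k + 2)) * (C * (k + 2) ^ 2) := by gcongr <;> omega
        _ ≤ _ := by ring_nf; nlinarith [Nat.zero_le (k ^ 3), Nat.zero_le (k ^ 2)]) (fun i hi => by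
      calc len (K i) ≤ (i + 2) * (4 * (i + 2) + 4) := hK i
        _ ≤ (k + 2) * (4 * (k + 2) + 4 * (k + 2)) := by gcongr <;> omega
        _ = 8 * (k + 2) ^ 2 * 1 := by ring
        _ ≤ (18 * C + 8) * (k + 2) ^ 2 * (k + 2) := by gcongr <;> omega
        _ = _ := by ring)
    have h5 : C * (k + 1) ^ 2 ≤ C * (k + 2) ^ 3 := by
      calc C * (k + 1) ^ 2 ≤ C * ((k + 2) ^ 2 * (k + 2)) := by
            gcongr
            nlinarith [sq_nonneg k]
        _ = _ := by ring
    have h6 : 1 + (k + 1) * (4 * (k + 1) + 4) ≤ 4 * (k + 2) ^ 3 := by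
      ring_nf; nlinarith [Nat.zero_le (k ^ 3), Nat.zero_le (k ^ 2)]
    calc _ ≤ 2 * (C * (k + 2) ^ 3) + 2 * (4 * (k + 2) ^ 3) +
          k * (4 * ((18 * C + 8) * (k + 2) ^ 3)) := by omega
      _ = (2 * C + 8 + k * (72 * C + 32)) * (k + 2) ^ 3 := by ring
      _ ≤ ((72 * C + 50) * (k + 2)) * (k + 2) ^ 3 := by
        gcongr
        ring_nf
        nlinarith [Nat.zero_le (C * k)]
      _ = _ := by ring
  · have hdis := evalAt_distortionWord_pow (n := L) (L := L) (by omega) (3 ^ k)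
    rw [map_mul, evalAt_shortWord V K k hL (evalAt L L (distortionWord ^ 3 ^ k))
      (fun i hi hLi => ?_) (fun i hi hLi => ?_)]
    · by_cases h : L < k + 2
      · have hs : evalAt L L (sigma 1 * K₀) = 1 := by
          rw [map_mul, hK₀' L L (by omega), if_pos h, ← map_mul, evalAt_sigma_add (by omega),
            add_neg_cancel, evalAt_sigma_zero (by omega)]
        rw [if_pos h, map_mul, map_mul, map_mul, map_inv, map_inv, hs]
        simp
      · have hs : evalAt L L (sigma 1 * K₀) = evalAt L L (sigma 1) := by
          rw [map_mul, hK₀' L L (by omega), if_neg h, evalAt_sigma_zero (by omega), mul_one]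
        rw [if_neg h, map_mul, map_mul, map_mul, map_inv, map_inv, hs, hdis,
          evalAt_fastPow (by omega), mul_one]
    · subst hLi
      have hVi : evalAt (i + 2) (i + 2) (V i) = evalAt (i + 2) (i + 2) f0 ^ 3 ^ k := by
        have hp := evalAt_f0_pow_period (n := i + 2) i
        have h3 : 3 ^ k =
            3 ^ i * e i + 3 ^ i * (18 * (i + 2)) * (3 ^ (k - i) / (18 * (i + 2))) := by
          rw [mul_assoc (3 ^ i), ← mul_add, he, Nat.mod_add_div, ← pow_add,
            Nat.add_sub_cancel' hi.le]
        rw [hV, map_pow, evalAt_fastPow le_rfl, ← pow_mul, h3, pow_add, pow_mul _ (3 ^ i * _), hp,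
          one_pow, mul_one]
      rw [map_mul, map_mul, map_mul, map_inv, map_inv, hK' i _ _ (by omega), if_pos rfl, hVi, hdis]
    · rw [hK' i _ _ (by omega), if_neg hLi, evalAt_sigma_zero (by omega)]

end Conveyor

namespace Conveyor

/-- Labels of cells: left of a head, right of a head, or carrying a head in the given state, which
reads the bottom slot if the flag is `true` and the top slot otherwise. -/
inductive Lab
  | l
  | r
  | h (s : State) (f : Bool)

/-- Cells of conveyor belts: a top slot, a bottom slot, and a label. -/
abbrev Cell := (Fin 3 × Fin 3) × Lab

instance : Finite Lab :=
  Finite.of_injective (β := Option (Option (State × Bool)))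
    (fun a => match a with
      | .l => none
      | .r => some none
      | .h s f => some (some (s, f)))
    (by rintro (_ | _ | _) (_ | _ | _) <;> simp)

/-- The label of a cell, if any. -/
def lab (x : Option Cell) : Option Lab := x.map Prod.snd

@[simp] lemma lab_none : lab none = none := rfl

@[simp] lemma lab_some (b : Cell) : lab (some b) = some b.2 := rfl

/-- Apply a permutation to the state and the slot scanned by the head. -/
def headFun (π : Equiv.Perm (State × Fin 3)) : Cell → Cell
  | ((y, z), .h s false) => (((π (s, y)).2, z), .h (π (s, y)).1 false)
  | ((y, z), .h s true) => ((y, (π (s, z)).2), .h (π (s, z)).1 true)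
  | c => c

/-- Apply a permutation to the state and the slot scanned by the head. -/
def headPerm (π : Equiv.Perm (State × Fin 3)) : Equiv.Perm Cell where
  toFun := headFun π
  invFun := headFun π.symm
  left_inv := by rintro ⟨⟨y, z⟩, _ | _ | ⟨s, _ | _⟩⟩ <;> simp [headFun]
  right_inv := by rintro ⟨⟨y, z⟩, _ | _ | ⟨s, _ | _⟩⟩ <;> simp [headFun]

/-- Flip the flag of the head if `U` holds. -/
def flipFun (U : Core → Bool) : Cell → Cell
  | (d, .h s f) => (d, .h s (f ^^ U s.1))
  | c => c

/-- Flip the flag of the head if `U` holds. -/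
def flipPerm (U : Core → Bool) : Equiv.Perm Cell :=
  Function.Involutive.toPerm (flipFun U) (by rintro ⟨d, _ | _ | ⟨s, f⟩⟩ <;> simp [flipFun])

lemma flipPerm_apply (U : Core → Bool) (b : Cell) : flipPerm U b = flipFun U b := rfl

/-- Apply a permutation of the cells everywhere. -/
def cellwise (e : Equiv.Perm Cell) : Equiv.Perm (ℤ → Option Cell) :=
  Equiv.piCongrRight fun _ => Equiv.optionCongr e

@[simp] lemma cellwise_apply (e : Equiv.Perm Cell) (x : ℤ → Option Cell) (p : ℤ) :
    cellwise e x p = (x p).map e := rfl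

/-- The new label of a cell under the involution exchanging `h s false, r` and `l, h s true` on
adjacent cells, for all `s` satisfying `U`. -/
def swapLab (U : Core → Bool) : Option Lab → Lab → Option Lab → Lab
  | _, .l, some (.h s true) => if U s.1 then .h s false else .l
  | _, .h s false, some .r => if U s.1 then .l else .h s false
  | some (.h s false), .r, _ => if U s.1 then .h s true else .r
  | some .l, .h s true, _ => if U s.1 then .r else .h s true
  | _, a, _ => a

lemma swapLab_swapLab (U : Core → Bool) (a b : Option Lab) (c : Lab) (d e : Option Lab) :
    swapLab U (b.map (swapLab U a · (some c))) (swapLab U b c d)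
      (d.map (swapLab U (some c) · e)) = c := by
  rcases c with _ | _ | ⟨s, _ | _⟩
  · rcases d with _ | _ | _ | ⟨t, _ | _⟩
    · simp [swapLab]
    · rcases e with _ | _ | _ | ⟨v, _ | _⟩ <;>
        simp only [swapLab, Option.map] <;> split_ifs <;> rfl
    · simp [swapLab]
    · rcases e with _ | _ | _ | ⟨v, _ | _⟩ <;>
        simp only [swapLab, Option.map] <;> split_ifs <;> rfl
    · simp only [swapLab, Option.map]; split_ifs with h <;> simp [h]
  · rcases b with _ | _ | _ | ⟨t, _ | _⟩
    · simp [swapLab]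
    · simp [swapLab]
    · rcases a with _ | _ | _ | ⟨v, _ | _⟩ <;>
        simp only [swapLab, Option.map] <;> split_ifs <;> rfl
    · simp only [swapLab, Option.map]; split_ifs with h <;> simp [h]
    · rcases a with _ | _ | _ | ⟨v, _ | _⟩ <;>
        simp only [swapLab, Option.map] <;> split_ifs <;> rfl
  · rcases d with _ | _ | _ | ⟨t, _ | _⟩
    · simp [swapLab]
    · rcases e with _ | _ | _ | ⟨v, _ | _⟩ <;>
        simp only [swapLab, Option.map] <;> split_ifs <;> rfl
    · simp only [swapLab, Option.map]; split_ifs with h <;> simp [h]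
    · rcases e with _ | _ | _ | ⟨v, _ | _⟩ <;>
        simp only [swapLab, Option.map] <;> split_ifs <;> rfl
    · rcases e with _ | _ | _ | ⟨v, _ | _⟩ <;> simp only [swapLab, Option.map]
  · rcases b with _ | _ | _ | ⟨t, _ | _⟩
    · simp [swapLab]
    · simp only [swapLab, Option.map]; split_ifs with h <;> simp [h]
    · rcases a with _ | _ | _ | ⟨v, _ | _⟩ <;>
        simp only [swapLab, Option.map] <;> split_ifs <;> rfl
    · rcases a with _ | _ | _ | ⟨v, _ | _⟩ <;> simp only [swapLab, Option.map]
    · rcases a with _ | _ | _ | ⟨v, _ | _⟩ <;>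
        simp only [swapLab, Option.map] <;> split_ifs <;> rfl

/-- Exchange `h s false, r` and `l, h s true` on adjacent cells, for all `s` satisfying `U`. -/
def swapFun (U : Core → Bool) (x : ℤ → Option Cell) (p : ℤ) : Option Cell :=
  (x p).map fun b => (b.1, swapLab U (lab (x (p - 1))) b.2 (lab (x (p + 1))))

lemma lab_swapFun (U : Core → Bool) (x : ℤ → Option Cell) (p : ℤ) :
    lab (swapFun U x p) =
      (lab (x p)).map (swapLab U (lab (x (p - 1))) · (lab (x (p + 1)))) := by
  simp only [lab, swapFun, Option.map_map]
  rfl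

/-- The involution exchanging `h s false, r` and `l, h s true` on adjacent cells, for all `s`
satisfying `U`. -/
def swapPermCA (U : Core → Bool) : Equiv.Perm (ℤ → Option Cell) :=
  Function.Involutive.toPerm (swapFun U) (by
    intro x
    funext p
    rcases hx : x p with _ | b
    · simp [swapFun, hx]
    · rw [swapFun, lab_swapFun, lab_swapFun, swapFun, hx]
      simp only [Option.map_some, sub_add_cancel, add_sub_cancel_right, hx, lab_some]
      rw [swapLab_swapLab])

lemma swapPermCA_apply (U : Core → Bool) (x : ℤ → Option Cell) (p : ℤ) :
    swapPermCA U x p =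
      (x p).map fun b => (b.1, swapLab U (lab (x (p - 1))) b.2 (lab (x (p + 1)))) := rfl

/-- Action of words in the gates on bi-infinite configurations. -/
def evalCA : FreeGroup Gate →* Equiv.Perm (ℤ → Option Cell) :=
  FreeGroup.lift (Sum.elim (fun π => cellwise (headPerm π))
    fun U => cellwise (flipPerm U) * swapPermCA U)

/-- Configurations of the machine on a cyclic tape with numbered cells. -/
abbrev Ring (n : ℕ) := State × ZMod n × (ZMod n → Fin 3)

/-- Apply a permutation to the state and the scanned symbol. -/
def headRing (n : ℕ) (π : Equiv.Perm (State × Fin 3)) : Equiv.Perm (Ring n) where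
  toFun c := ((π (c.1, c.2.2 c.2.1)).1, c.2.1,
    Function.update c.2.2 c.2.1 (π (c.1, c.2.2 c.2.1)).2)
  invFun c := ((π.symm (c.1, c.2.2 c.2.1)).1, c.2.1,
    Function.update c.2.2 c.2.1 (π.symm (c.1, c.2.2 c.2.1)).2)
  left_inv c := by simp
  right_inv c := by simp

/-- Reflect the position of the head by `o ↦ j - o` if `U` holds. -/
def reflRing (n : ℕ) (j : ZMod n) (U : Core → Bool) : Equiv.Perm (Ring n) :=
  Function.Involutive.toPerm (fun c => if U c.1.1 then (c.1, j - c.2.1, c.2.2) else c) (by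
    rintro ⟨s, o, W⟩
    by_cases h : U s.1 <;> simp [h])

lemma reflRing_apply {n : ℕ} (j : ZMod n) (U : Core → Bool) (s : State) (o : ZMod n)
    (W : ZMod n → Fin 3) :
    reflRing n j U (s, o, W) = if U s.1 then (s, j - o, W) else (s, o, W) := rfl

/-- Action of words in the gates on cyclic tapes with numbered cells. -/
def evalRing (n : ℕ) : FreeGroup Gate →* Equiv.Perm (Ring n) :=
  FreeGroup.lift (Sum.elim (headRing n) fun U => reflRing n (-1) U * reflRing n (-2) U)

/-- To prove a property of the simultaneous actions of all words in the gates on bi-infinite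
configurations and cyclic tapes, it suffices to consider elementary operations. -/
lemma evalCA_evalRing_induction {n : ℕ}
    {P : Equiv.Perm (ℤ → Option Cell) → Equiv.Perm (Ring n) → Prop}
    (hone : P 1 1) (hmul : ∀ f f' g g', P f f' → P g g' → P (f * g) (f' * g'))
    (hhead : ∀ π, P (cellwise (headPerm π)) (headRing n π))
    (hflip : ∀ U, P (cellwise (flipPerm U)) (reflRing n (-1) U))
    (hswap : ∀ U, P (swapPermCA U) (reflRing n (-2) U))
    (u : FreeGroup Gate) : P (evalCA u) (evalRing n u) := by
  induction u using FreeGroup.induction_on with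
  | C1 => rwa [map_one, map_one]
  | of g =>
    rcases g with π | U
    · simpa [evalCA, evalRing] using hhead π
    · simpa [evalCA, evalRing] using hmul _ _ _ _ (hflip U) (hswap U)
  | inv_of g _ =>
    rcases g with π | U
    · simp only [evalCA, evalRing, map_inv, FreeGroup.lift_apply_of, Sum.elim_inl]
      exact hhead π⁻¹
    · simp only [evalCA, evalRing, map_inv, FreeGroup.lift_apply_of, Sum.elim_inr, mul_inv_rev]
      exact hmul _ _ _ _ (hswap U) (hflip U)
  | mul x y hx hy => rw [map_mul, map_mul]; exact hmul _ _ _ _ hx hy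

/-- To prove that a set of permutations of configurations contains all words in the gates, it
suffices to consider elementary operations. -/
lemma evalCA_induction {P : Equiv.Perm (ℤ → Option Cell) → Prop}
    (hone : P 1) (hmul : ∀ f g, P f → P g → P (f * g)) (hhead : ∀ π, P (cellwise (headPerm π)))
    (hflip : ∀ U, P (cellwise (flipPerm U))) (hswap : ∀ U, P (swapPermCA U))
    (u : FreeGroup Gate) : P (evalCA u) :=
  evalCA_evalRing_induction (n := 0) (P := fun f _ => P f) hone (fun f _ g _ => hmul f g) hhead
    hflip hswap u

/-- Read a cyclic tape from the head onwards. -/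
def ringToCfg (n : ℕ) (c : Ring n) : CfgAt n n :=
  ⟨(c.1, c.2.1, List.ofFn fun i : Fin n => c.2.2 (c.2.1 + (i : ℕ))), by simp⟩

lemma ringToCfg_injective (n : ℕ) [NeZero n] : Function.Injective (ringToCfg n) := by
  rintro ⟨s, o, W⟩ ⟨s', o', W'⟩ h
  simp only [ringToCfg, Subtype.mk.injEq, Prod.mk.injEq, List.ofFn_inj] at h
  obtain ⟨rfl, rfl, h⟩ := h
  simp only [Prod.mk.injEq, true_and]
  funext j
  have := congrFun h ⟨(j - o).val, ZMod.val_lt _⟩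
  simpa using this

lemma ringToCfg_surjective (n : ℕ) [NeZero n] : Function.Surjective (ringToCfg n) := by
  rintro ⟨⟨s, o, w⟩, hw⟩
  change w.length = n at hw
  refine ⟨(s, o, fun j => w.get ⟨(j - o).val, by rw [hw]; exact ZMod.val_lt _⟩), ?_⟩
  simp only [ringToCfg, Subtype.mk.injEq, Prod.mk.injEq, true_and]
  refine List.ext_getElem (by simp [hw]) fun i h1 h2 => ?_
  simp [ZMod.val_natCast, Nat.mod_eq_of_lt (hw ▸ h2)]

lemma ringToCfg_evalRing (n : ℕ) [NeZero n] (u : FreeGroup Gate) (c : Ring n) :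
    ringToCfg n (evalRing n u c) = evalAt n n u (ringToCfg n c) := by
  induction u using FreeGroup.induction_on generalizing c with
  | C1 => simp
  | of g =>
    obtain ⟨k, rfl⟩ : ∃ k, n = k + 1 := ⟨n - 1, by have := NeZero.pos n; omega⟩
    obtain ⟨s, o, W⟩ := c
    apply Subtype.ext
    rw [coe_evalAt]
    rcases g with π | U
    · change _ = eval _ (gP π) _
      simp only [ringToCfg, List.ofFn_succ, eval_gP_cons]
      simp only [evalRing, FreeGroup.lift_apply_of, Sum.elim_inl, headRing, Equiv.coe_fn_mk]
      simp
      funext i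
      rw [Function.update_of_ne]
      rw [Ne, add_eq_left]
      have := (ZMod.natCast_eq_zero_iff (i + 1 : ℕ) (k + 1)).1.mt
        (Nat.not_dvd_of_pos_of_lt (by omega) (by omega))
      simpa using this
    · change _ = eval _ (gM U) _
      simp only [ringToCfg, List.ofFn_succ, eval_gM_cons]
      simp only [evalRing, FreeGroup.lift_apply_of, Sum.elim_inr, Equiv.Perm.mul_apply,
        reflRing_apply]
      by_cases h : U s.1
      · simp only [h, if_true, reflRing_apply]
        rw [show -1 - (-2 - o) = o + 1 by ring]
        refine Prod.ext rfl (Prod.ext rfl ?_)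
        change _ = (List.ofFn fun i : Fin k => W (o + ((i.succ : Fin (k + 1)) : ℕ))) ++
          [W (o + (0 : ℕ))]
        rw [← List.ofFn_succ (f := fun i : Fin (k + 1) => W (o + 1 + (i : ℕ))), List.ofFn_succ',
          List.concat_eq_append]
        refine congrArg₂ (· ++ ·) (congrArg List.ofFn ?_) (congrArg (fun z => [W z]) ?_)
        · funext i
          congr 1
          simp
          ring
        · have := ZMod.natCast_self (k + 1)
          push_cast at this
          simp [add_assoc, add_comm (1 : ZMod (k + 1)), this]
      · simp [h, reflRing_apply]
  | inv_of g ih =>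
    rw [map_inv, map_inv, Equiv.Perm.eq_inv_iff_eq, ← ih]
    simp
  | mul x y hx hy => rw [map_mul, Equiv.Perm.mul_apply, hx, hy, map_mul, Equiv.Perm.mul_apply]

lemma evalRing_eq_one_iff (n : ℕ) [NeZero n] (u : FreeGroup Gate) :
    evalRing n u = 1 ↔ evalAt n n u = 1 := by
  constructor
  · intro h
    ext1 c
    obtain ⟨c, rfl⟩ := ringToCfg_surjective n c
    rw [← ringToCfg_evalRing, h]
    rfl
  · intro h
    ext1 c
    apply ringToCfg_injective n
    rw [ringToCfg_evalRing, h]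
    rfl

end Conveyor

namespace Conveyor

section swapLab

variable {U : Core → Bool} {s : State} {a b : Option Lab}

lemma swapLab_l (h : ∀ s, U s.1 → b ≠ some (.h s true)) : swapLab U a .l b = .l := by
  rcases b with _ | _ | _ | ⟨t, _ | _⟩ <;> simp [swapLab]
  exact Bool.eq_false_iff.2 fun h' => h t h' rfl

lemma swapLab_l_h (h : U s.1) : swapLab U a .l (some (.h s true)) = .h s false := by
  simp [swapLab, h]

lemma swapLab_r (h : ∀ s, U s.1 → a ≠ some (.h s false)) : swapLab U a .r b = .r := by
  rcases a with _ | _ | _ | ⟨t, _ | _⟩ <;> simp [swapLab]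
  exact Bool.eq_false_iff.2 fun h' => h t h' rfl

lemma swapLab_h_r (h : U s.1) : swapLab U (some (.h s false)) .r b = .h s true := by
  simp [swapLab, h]

lemma swapLab_top (h : U s.1 → b ≠ some .r) : swapLab U a (.h s false) b = .h s false := by
  rcases b with _ | _ | _ | ⟨t, _ | _⟩ <;> simp [swapLab]
  exact Bool.eq_false_iff.2 fun h' => h h' rfl

lemma swapLab_top_r (h : U s.1) : swapLab U a (.h s false) (some .r) = .l := by
  simp [swapLab, h]

lemma swapLab_bot (h : U s.1 → a ≠ some .l) : swapLab U a (.h s true) b = .h s true := by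
  rcases a with _ | _ | _ | ⟨t, _ | _⟩ <;> simp [swapLab]
  exact Bool.eq_false_iff.2 fun h' => h h' rfl

lemma swapLab_l_bot (h : U s.1) : swapLab U (some .l) (.h s true) b = .r := by
  simp [swapLab, h]

lemma swapLab_ne_l {c : Lab} (hc : c ≠ .l) (hb : b ≠ some .r) : swapLab U a c b ≠ .l := by
  rcases c with _ | _ | ⟨s, _ | _⟩
  · exact absurd rfl hc
  · by_cases h : ∀ s, U s.1 → a ≠ some (.h s false)
    · simp [swapLab_r h]
    · push Not at h
      obtain ⟨s, h, rfl⟩ := h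
      simp [swapLab_h_r h]
  · simp [swapLab_top fun _ => hb]
  · by_cases h : U s.1 → a ≠ some .l
    · simp [swapLab_bot h]
    · push Not at h
      rw [h.2, swapLab_l_bot h.1]
      simp

lemma swapLab_ne_r {c : Lab} (hc : c ≠ .r) (ha : a ≠ some .l) : swapLab U a c b ≠ .r := by
  rcases c with _ | _ | ⟨s, _ | _⟩
  · by_cases h : ∀ s, U s.1 → b ≠ some (.h s true)
    · simp [swapLab_l h]
    · push Not at h
      obtain ⟨s, h, rfl⟩ := h
      simp [swapLab_l_h h]
  · exact absurd rfl hc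
  · by_cases h : U s.1 → b ≠ some .r
    · simp [swapLab_top h]
    · push Not at h
      rw [h.2, swapLab_top_r h.1]
      simp
  · simp [swapLab_bot fun _ => ha]

end swapLab

/-- Labels on a belt with the head at position `k`. -/
def beltLab (s : State) (k : ℕ) (f : Bool) (p : ℕ) : Lab :=
  if p < k then .l else if p = k then .h s f else .r

/-- Position on the cyclic tape of the slot of the `k`-th cell of a belt. -/
def slotPos (m k : ℕ) (f : Bool) : ZMod (2 * m) := if f then -1 - k else k

/-- The configuration `x` has at `[a, a + m)` a belt, containing the cyclic tape `c`, and not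
interacting with the cells around it. -/
def IsBelt (x : ℤ → Option Cell) (a : ℤ) (m : ℕ) (c : Ring (2 * m)) : Prop :=
  ∃ k < m, ∃ f, c.2.1 = slotPos m k f ∧
    (∀ p < m, x (a + p) = some ((c.2.2 (slotPos m p false), c.2.2 (slotPos m p true)),
      beltLab c.1 k f p)) ∧
    lab (x (a - 1)) ≠ some .l ∧ lab (x (a + m)) ≠ some .r

lemma slotPos_inj {m k j : ℕ} {f g : Bool} (hk : k < m) (hj : j < m)
    (h : slotPos m k f = slotPos m j g) : k = j ∧ f = g := by
  have key1 (h : (k : ZMod (2 * m)) = j) : k = j := by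
    rw [ZMod.natCast_eq_natCast_iff'] at h
    rwa [Nat.mod_eq_of_lt (by omega), Nat.mod_eq_of_lt (by omega)] at h
  have key2 (h : ((k + j + 1 : ℕ) : ZMod (2 * m)) = 0) : False := by
    rw [ZMod.natCast_eq_zero_iff] at h
    exact Nat.not_dvd_of_pos_of_lt (by omega) (by omega) h
  cases f <;> cases g <;> simp only [slotPos, if_true, Bool.false_eq_true, if_false] at h
  · exact ⟨key1 h, rfl⟩
  · exact (key2 (by push_cast; rw [h]; ring)).elim
  · exact (key2 (by push_cast; rw [← h]; ring)).elim
  · exact ⟨key1 (by linear_combination -h), rfl⟩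

lemma exists_slotPos {m : ℕ} (hm : 1 ≤ m) (o : ZMod (2 * m)) :
    ∃ k < m, ∃ f, o = slotPos m k f := by
  have : NeZero (2 * m) := ⟨by omega⟩
  have hlt := ZMod.val_lt o
  by_cases h : o.val < m
  · exact ⟨o.val, h, false, by simp [slotPos]⟩
  · refine ⟨2 * m - 1 - o.val, by omega, true, ?_⟩
    have h2 : ((o.val + (2 * m - 1 - o.val) + 1 : ℕ) : ZMod (2 * m)) = 0 := by
      rw [show o.val + (2 * m - 1 - o.val) + 1 = 2 * m by omega, ZMod.natCast_self]
    push_cast at h2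
    rw [ZMod.natCast_zmod_val] at h2
    simp only [slotPos, if_true]
    linear_combination h2

variable {x : ℤ → Option Cell} {a : ℤ} {m : ℕ} {c : Ring (2 * m)}

lemma IsBelt.head (h : IsBelt x a m c) (π : Equiv.Perm (State × Fin 3)) :
    IsBelt (cellwise (headPerm π) x) a m (headRing (2 * m) π c) := by
  obtain ⟨k, hk, f, hc, hx, hl, hr⟩ := h
  obtain ⟨s, o, W⟩ := c
  simp only at hc hx
  have hlab (b : Option Cell) (t : Lab) (ht : ∀ s f, t ≠ .h s f) :
      lab (b.map (headPerm π)) = some t ↔ lab b = some t := by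
    rcases b with _ | ⟨⟨y, z⟩, _ | _ | ⟨s, _ | _⟩⟩ <;> simp [headPerm, headFun, (ht _ _).symm]
  refine ⟨k, hk, f, hc, fun p hp => ?_, ?_, ?_⟩
  · simp only [cellwise_apply, hx p hp, Option.map_some, headRing, Equiv.coe_fn_mk]
    rcases lt_trichotomy p k with h | rfl | h
    · have h1 (g) : slotPos m p g ≠ o := fun h' => by
        have := (slotPos_inj hp hk (h'.trans hc)).1
        omega
      simp [beltLab, h, headPerm, headFun, Function.update_of_ne (h1 _)]
    · subst hc
      have h1 : slotPos m p true ≠ slotPos m p false := fun h' => by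
        simpa using (slotPos_inj hp hp h').2
      cases f <;> simp [beltLab, headPerm, headFun, Function.update_of_ne h1,
        Function.update_of_ne h1.symm]
    · have h1 (g) : slotPos m p g ≠ o := fun h' => by
        have := (slotPos_inj hp hk (h'.trans hc)).1
        omega
      have h2 : ¬ p < k := by omega
      have h3 : p ≠ k := by omega
      simp [beltLab, h2, h3, headPerm, headFun, Function.update_of_ne (h1 _)]
  · rwa [cellwise_apply, Ne, hlab _ _ (by simp)]
  · rwa [cellwise_apply, Ne, hlab _ _ (by simp)]

lemma IsBelt.flip (h : IsBelt x a m c) (U : Core → Bool) :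
    IsBelt (cellwise (flipPerm U) x) a m (reflRing (2 * m) (-1) U c) := by
  obtain ⟨k, hk, f, hc, hx, hl, hr⟩ := h
  obtain ⟨s, o, W⟩ := c
  simp only at hc hx
  have hlab (b : Option Cell) (t : Lab) (ht : ∀ s f, t ≠ .h s f) :
      lab (b.map (flipPerm U)) = some t ↔ lab b = some t := by
    rcases b with _ | ⟨⟨y, z⟩, _ | _ | ⟨s, _ | _⟩⟩ <;>
      simp [flipPerm_apply, flipFun, (ht _ _).symm]
  refine ⟨k, hk, f ^^ U s.1, ?_, fun p hp => ?_, ?_, ?_⟩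
  · rw [reflRing_apply]
    split_ifs with h
    · simp only [h, hc]
      cases f <;> simp [slotPos]
    · simp [h, hc]
  · rw [cellwise_apply, hx p hp, reflRing_apply]
    rcases lt_trichotomy p k with h | rfl | h
    · split_ifs <;> simp [beltLab, h, flipPerm_apply, flipFun]
    · split_ifs with hU <;> simp [beltLab, flipPerm_apply, flipFun, hU]
    · have h2 : ¬ p < k := by omega
      have h3 : p ≠ k := by omega
      split_ifs <;> simp [beltLab, h2, h3, flipPerm_apply, flipFun]
  · rwa [cellwise_apply, Ne, hlab _ _ (by simp)]
  · rwa [cellwise_apply, Ne, hlab _ _ (by simp)]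

/-- Behaviour of the exchange of labels on a belt. -/
lemma exists_swapLab_belt (U : Core → Bool) (s : State) {k : ℕ} (hk : k < m) (f : Bool)
    (b : ℤ → Option Lab) (hb : ∀ p < m, b (a + p) = some (beltLab s k f p))
    (hl : b (a - 1) ≠ some .l) (hr : b (a + m) ≠ some .r) :
    ∃ k' < m, ∃ f', slotPos m k' f' = (if U s.1 then -2 - slotPos m k f else slotPos m k f) ∧
      ∀ p < m, swapLab U (b (a + p - 1)) (beltLab s k f p) (b (a + p + 1)) = beltLab s k' f' p := by
  have hpred (p : ℕ) (hp : p + 1 < m) : b (a + (p + 1 : ℕ) - 1) = some (beltLab s k f p) := by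
    rw [← hb p (by omega)]; congr 1; push_cast; ring
  have hsucc (p : ℕ) (hp : p + 1 < m) : b (a + p + 1) = some (beltLab s k f (p + 1)) := by
    rw [← hb (p + 1) (by omega)]; congr 1; push_cast; ring
  have hl' : b (a + (0 : ℕ) - 1) ≠ some .l := by simpa using hl
  have hr' (p : ℕ) (hp : p + 1 = m) : b (a + p + 1) ≠ some .r := by
    rwa [show a + p + 1 = a + m by rw [← hp]; push_cast; ring]
  have e1 (s) (k : ℕ) (f p) (h : p < k) : beltLab s k f p = .l := by simp [beltLab, h]
  have e2 (s) (k : ℕ) (f) : beltLab s k f k = .h s f := by simp [beltLab]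
  have e3 (s) (k : ℕ) (f p) (h : k < p) : beltLab s k f p = .r := by
    simp [beltLab, show ¬ p < k by omega, show p ≠ k by omega]
  have far (p : ℕ) (hp : p < m) (hp1 : p + 1 ≠ k ∨ U s.1 = false ∨ f = false)
      (hp2 : p ≠ k + 1 ∨ U s.1 = false ∨ f = true) (hpk : p ≠ k) :
      swapLab U (b (a + p - 1)) (beltLab s k f p) (b (a + p + 1)) = beltLab s k f p := by
    rcases lt_or_gt_of_ne hpk with h | h
    · rw [e1 _ _ _ _ h, swapLab_l]
      intro t ht
      rw [hsucc p (by omega)]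
      by_cases h' : p + 1 = k
      · subst h'
        rw [e2]
        rintro ⟨⟩
        simp_all
      · rw [e1 _ _ _ _ (by omega)]
        simp
    · rw [e3 _ _ _ _ h, swapLab_r]
      intro t ht
      obtain ⟨p, rfl⟩ : ∃ q, p = q + 1 := ⟨p - 1, by omega⟩
      rw [hpred p (by omega)]
      by_cases h' : p = k
      · subst h'
        rw [e2]
        rintro ⟨⟩
        simp_all
      · rw [e3 _ _ _ _ (by omega)]
        simp
  by_cases hU : U s.1
  · have hm2 : ((2 * m : ℕ) : ZMod (2 * m)) = 0 := ZMod.natCast_self _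
    push_cast at hm2
    cases f with
    | false =>
      by_cases hkm : k + 1 = m
      · refine ⟨k, hk, false, ?_, fun p hp => ?_⟩
        · rw [if_pos hU]
          simp only [slotPos, Bool.false_eq_true, if_false]
          rw [← hkm] at hm2 ⊢
          push_cast at hm2 ⊢
          linear_combination hm2
        · by_cases hpk : p = k
          · subst hpk
            rw [e2, swapLab_top fun _ => hr' p hkm]
          · exact far p hp (by simp) (by omega) hpk
      · refine ⟨k + 1, by omega, true, ?_, fun p hp => ?_⟩
        · rw [if_pos hU]
          simp only [slotPos, Bool.false_eq_true, if_false, if_true]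
          push_cast
          ring
        · by_cases hpk : p = k
          · subst hpk
            rw [e2, hsucc p (by omega), e3 _ _ _ _ (by omega), swapLab_top_r hU,
              e1 _ _ _ _ (by omega)]
          · by_cases hpk' : p = k + 1
            · subst hpk'
              rw [e2, hpred k (by omega), e2, e3 _ _ _ _ (by omega), swapLab_h_r hU]
            · rw [far p hp (by simp) (by omega) hpk]
              rcases lt_or_gt_of_ne hpk with h | h
              · rw [e1 _ _ _ _ h, e1 _ _ _ _ (by omega)]
              · rw [e3 _ _ _ _ h, e3 _ _ _ _ (by omega)]
    | true =>
      rcases k with _ | k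
      · refine ⟨0, hk, true, ?_, fun p hp => ?_⟩
        · rw [if_pos hU]
          simp [slotPos]
          ring
        · by_cases hpk : p = 0
          · subst hpk
            rw [e2, swapLab_bot fun _ => hl']
          · exact far p hp (by omega) (by simp) hpk
      · refine ⟨k, by omega, false, ?_, fun p hp => ?_⟩
        · rw [if_pos hU]
          simp [slotPos]
          ring
        · by_cases hpk : p = k + 1
          · subst hpk
            rw [e2, hpred k (by omega), e1 _ _ _ _ (by omega), swapLab_l_bot hU,
              e3 _ _ _ _ (by omega)]
          · by_cases hpk' : p = k
            · subst hpk'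
              rw [e2, hsucc p (by omega), e2, e1 _ _ _ _ (by omega), swapLab_l_h hU]
            · rw [far p hp (by omega) (by simp) hpk]
              rcases lt_or_gt_of_ne hpk with h | h
              · rw [e1 _ _ _ _ h, e1 _ _ _ _ (by omega)]
              · rw [e3 _ _ _ _ h, e3 _ _ _ _ (by omega)]
  · refine ⟨k, hk, f, by rw [if_neg hU], fun p hp => ?_⟩
    by_cases hpk : p = k
    · subst hpk
      rw [e2]
      cases f
      · rw [swapLab_top fun h => absurd h hU]
      · rw [swapLab_bot fun h => absurd h hU]
    · exact far p hp (by simp [hU]) (by simp [hU]) hpk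

lemma IsBelt.swap (h : IsBelt x a m c) (U : Core → Bool) :
    IsBelt (swapPermCA U x) a m (reflRing (2 * m) (-2) U c) := by
  obtain ⟨k, hk, f, hc, hx, hl, hr⟩ := h
  obtain ⟨s, o, W⟩ := c
  simp only at hc hx
  subst hc
  obtain ⟨k', hk', f', ho, hsw⟩ := exists_swapLab_belt (a := a) U s hk f (fun i => lab (x i))
    (fun p hp => by rw [hx p hp, lab_some]) hl hr
  have hx0 := hx 0 (by omega)
  have hxm := hx (m - 1) (by omega)
  refine ⟨k', hk', f', ?_, fun p hp => ?_, ?_, ?_⟩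
  · rw [ho, reflRing_apply]
    split_ifs <;> rfl
  · rw [swapPermCA_apply, hx p hp, Option.map_some, hsw p hp, reflRing_apply]
    split_ifs <;> rfl
  · rw [swapPermCA_apply, sub_add_cancel]
    rcases hxa : x (a - 1) with _ | b
    · simp
    · simp only [Option.map_some, lab_some, Ne, Option.some.injEq]
      refine swapLab_ne_l (by simpa [hxa] using hl) ?_
      rw [Nat.cast_zero, add_zero] at hx0
      rw [hx0, lab_some, beltLab]
      split_ifs <;> simp
      omega
  · rw [swapPermCA_apply]
    rcases hxa : x (a + m) with _ | b
    · simp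
    · simp only [Option.map_some, lab_some, Ne, Option.some.injEq]
      refine swapLab_ne_r (by simpa [hxa] using hr) ?_
      rw [show a + m - 1 = a + (m - 1 : ℕ) by push_cast [show 1 ≤ m by omega]; ring, hxm, lab_some,
        beltLab, if_neg (by omega)]
      split_ifs <;> simp

lemma IsBelt.evalCA (h : IsBelt x a m c) (u : FreeGroup Gate) :
    IsBelt (evalCA u x) a m (evalRing (2 * m) u c) := by
  refine evalCA_evalRing_induction (n := 2 * m)
    (P := fun f g => ∀ x c, IsBelt x a m c → IsBelt (f x) a m (g c)) (fun _ _ h => h)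
    (fun f f' g g' hf hg x c h => hf _ _ (hg _ _ h)) (fun π x c h => h.head π)
    (fun U x c h => h.flip U) (fun U x c h => h.swap U) u x c h

lemma IsBelt.eq {c' : Ring (2 * m)} (h : IsBelt x a m c) (h' : IsBelt x a m c') : c = c' := by
  obtain ⟨k, hk, f, hc, hx, -⟩ := h
  obtain ⟨k', hk', f', hc', hx', -⟩ := h'
  obtain ⟨s, o, W⟩ := c
  obtain ⟨s', o', W'⟩ := c'
  simp only at hc hx hc' hx'
  have h1 (p) (hp : p < m) := (hx p hp).symm.trans (hx' p hp)
  simp only [Option.some.injEq, Prod.mk.injEq] at h1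
  have h2 := (h1 k hk).2
  have h3 : k = k' := by
    by_contra hne
    simp only [beltLab, lt_irrefl, if_false, if_true, if_neg hne] at h2
    split_ifs at h2
  subst h3
  simp [beltLab] at h2
  obtain ⟨rfl, rfl⟩ := h2
  refine Prod.ext rfl (Prod.ext (hc.trans hc'.symm) (funext fun j => ?_))
  obtain ⟨p, hp, g, rfl⟩ := exists_slotPos (by omega) j
  cases g
  · exact (h1 p hp).1.1
  · exact (h1 p hp).1.2

lemma exists_isBelt (hm : 1 ≤ m) (c : Ring (2 * m)) : ∃ x : ℤ → Option Cell,
    (∀ p, x p ≠ none ↔ 0 ≤ p ∧ p < m) ∧ IsBelt x 0 m c := by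
  obtain ⟨k, hk, f, hc⟩ := exists_slotPos hm c.2.1
  refine ⟨fun p => if 0 ≤ p ∧ p < m then some ((c.2.2 (slotPos m p.toNat false),
    c.2.2 (slotPos m p.toNat true)), beltLab c.1 k f p.toNat) else none, fun p => ?_,
    k, hk, f, hc, fun p hp => ?_, ?_, ?_⟩
  · simp
  · simp [hp]
  · simp
  · simp

lemma IsBelt.cell_eq {y : ℤ → Option Cell} (h : IsBelt x a m c) (h' : IsBelt y a m c) (p : ℕ)
    (hp : p < m) : x (a + p) = y (a + p) := by
  obtain ⟨k, hk, f, hc, hx, -⟩ := h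
  obtain ⟨k', hk', f', hc', hx', -⟩ := h'
  obtain ⟨rfl, rfl⟩ := slotPos_inj hk hk' (hc.symm.trans hc')
  rw [hx p hp, hx' p hp]

end Conveyor

namespace Conveyor

variable {x : ℤ → Option Cell}

/-- The cell `p` is on the left side of a belt without head. -/
def HeadlessLeft (x : ℤ → Option Cell) (p : ℤ) : Prop :=
  ∃ k : ℕ, (∀ j ≤ k, lab (x (p + j)) = some .l) ∧
    (lab (x (p + k + 1)) = none ∨ lab (x (p + k + 1)) = some .r)

/-- The cell `p` is on the right side of a belt without head. -/
def HeadlessRight (x : ℤ → Option Cell) (p : ℤ) : Prop :=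
  ∃ k : ℕ, (∀ j ≤ k, lab (x (p - j)) = some .r) ∧
    (lab (x (p - k - 1)) = none ∨ lab (x (p - k - 1)) = some .l)

lemma lab_eq_none {b : Option Cell} : lab b = none ↔ b = none := by
  cases b <;> simp

lemma exists_of_lab_eq_some {b : Option Cell} {t : Lab} (h : lab b = some t) :
    ∃ d, b = some (d, t) := by
  rcases b with _ | ⟨d, t'⟩
  · simp at h
  · exact ⟨d, by simp at h; rw [h]⟩

lemma headPerm_apply_of_ne (π : Equiv.Perm (State × Fin 3)) {b : Option Cell}
    (hb : ∀ s f, lab b ≠ some (.h s f)) : b.map (headPerm π) = b := by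
  rcases b with _ | ⟨⟨y, z⟩, _ | _ | ⟨s, f⟩⟩
  · rfl
  · rfl
  · rfl
  · exact absurd rfl (hb s f)

lemma flipPerm_apply_of_ne (U : Core → Bool) {b : Option Cell}
    (hb : ∀ s f, lab b ≠ some (.h s f)) : b.map (flipPerm U) = b := by
  rcases b with _ | ⟨⟨y, z⟩, _ | _ | ⟨s, f⟩⟩
  · rfl
  · rfl
  · rfl
  · exact absurd rfl (hb s f)

lemma HeadlessLeft.of_eq {y : ℤ → Option Cell} {p : ℤ} (h : HeadlessLeft x p)
    (hxy : ∀ q, (∀ s f, lab (x q) ≠ some (.h s f)) →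
      (lab (x q) = some .l → lab (x (q + 1)) = none ∨ lab (x (q + 1)) = some .l ∨
        lab (x (q + 1)) = some .r) →
      (lab (x q) = some .r → lab (x (q - 1)) = some .l) → y q = x q) :
    y p = x p ∧ HeadlessLeft y p := by
  obtain ⟨k, hk, hend⟩ := h
  have h1 (j : ℕ) (hj : j ≤ k) : y (p + j) = x (p + j) := by
    refine hxy _ (by simp [hk j hj]) (fun _ => ?_) (by simp [hk j hj])
    rcases hj.eq_or_lt with rfl | hj
    · tauto
    · have := hk (j + 1) hj
      push_cast at this
      rw [add_assoc, this]
      simp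
  have h2 : y (p + k + 1) = x (p + k + 1) := by
    refine hxy _ ?_ ?_ fun _ => ?_
    · rcases hend with h | h <;> simp [h]
    · rcases hend with h | h <;> simp [h]
    · rw [add_sub_cancel_right, hk k le_rfl]
  refine ⟨by simpa using h1 0 (by omega), k, fun j hj => ?_, ?_⟩
  · rw [h1 j hj, hk j hj]
  · rwa [h2]

lemma HeadlessRight.of_eq {y : ℤ → Option Cell} {p : ℤ} (h : HeadlessRight x p)
    (hxy : ∀ q, (∀ s f, lab (x q) ≠ some (.h s f)) →
      (lab (x q) = some .r → lab (x (q - 1)) = none ∨ lab (x (q - 1)) = some .l ∨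
        lab (x (q - 1)) = some .r) →
      (lab (x q) = some .l → lab (x (q + 1)) = some .r) → y q = x q) :
    y p = x p ∧ HeadlessRight y p := by
  obtain ⟨k, hk, hend⟩ := h
  have h1 (j : ℕ) (hj : j ≤ k) : y (p - j) = x (p - j) := by
    refine hxy _ (by simp [hk j hj]) (fun _ => ?_) (by simp [hk j hj])
    rcases hj.eq_or_lt with rfl | hj
    · tauto
    · have := hk (j + 1) hj
      push_cast at this
      rw [sub_sub, this]
      simp
  have h2 : y (p - k - 1) = x (p - k - 1) := by
    refine hxy _ ?_ ?_ fun _ => ?_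
    · rcases hend with h | h <;> simp [h]
    · rcases hend with h | h <;> simp [h]
    · rw [sub_add_cancel, hk k le_rfl]
  refine ⟨by simpa using h1 0 (by omega), k, fun j hj => ?_, ?_⟩
  · rw [h1 j hj, hk j hj]
  · rwa [h2]

lemma swapPermCA_apply_eq (U : Core → Bool) {q : ℤ} (h0 : ∀ s f, lab (x q) ≠ some (.h s f))
    (hl : lab (x q) = some .l → ∀ s f, lab (x (q + 1)) ≠ some (.h s f))
    (hr : lab (x q) = some .r → ∀ s f, lab (x (q - 1)) ≠ some (.h s f)) :
    swapPermCA U x q = x q := by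
  rw [swapPermCA_apply]
  rcases hq : x q with _ | ⟨d, _ | _ | ⟨s, f⟩⟩
  · rfl
  · simp [swapLab_l fun s _ => hl (by simp [hq]) s true]
  · simp [swapLab_r fun s _ => hr (by simp [hq]) s false]
  · exact absurd (by simp [hq]) (h0 s f)

lemma HeadlessLeft.evalCA_apply {p : ℤ} (h : HeadlessLeft x p) (u : FreeGroup Gate) :
    evalCA u x p = x p := by
  refine (evalCA_induction (P := fun f => ∀ x, HeadlessLeft x p → f x p = x p ∧
    HeadlessLeft (f x) p) (fun x h => ⟨rfl, h⟩) (fun f g hf hg x h => ?_) (fun π x h => ?_)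
    (fun U x h => ?_) (fun U x h => ?_) u x h).1
  · exact ⟨(hf _ (hg _ h).2).1.trans (hg _ h).1, (hf _ (hg _ h).2).2⟩
  · exact h.of_eq fun q hq _ _ => headPerm_apply_of_ne π hq
  · exact h.of_eq fun q hq _ _ => flipPerm_apply_of_ne U hq
  · refine h.of_eq fun q hq hl hr => swapPermCA_apply_eq U hq (fun h => ?_) fun h => ?_
    · rcases hl h with h | h | h <;> simp [h]
    · simp [hr h]

lemma HeadlessRight.evalCA_apply {p : ℤ} (h : HeadlessRight x p) (u : FreeGroup Gate) :
    evalCA u x p = x p := by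
  refine (evalCA_induction (P := fun f => ∀ x, HeadlessRight x p → f x p = x p ∧
    HeadlessRight (f x) p) (fun x h => ⟨rfl, h⟩) (fun f g hf hg x h => ?_) (fun π x h => ?_)
    (fun U x h => ?_) (fun U x h => ?_) u x h).1
  · exact ⟨(hf _ (hg _ h).2).1.trans (hg _ h).1, (hf _ (hg _ h).2).2⟩
  · exact h.of_eq fun q hq _ _ => headPerm_apply_of_ne π hq
  · exact h.of_eq fun q hq _ _ => flipPerm_apply_of_ne U hq
  · refine h.of_eq fun q hq hr hl => swapPermCA_apply_eq U hq (fun h => ?_) fun h => ?_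
    · simp [hl h]
    · rcases hr h with h | h | h <;> simp [h]

lemma evalCA_eq_none_iff (u : FreeGroup Gate) (x : ℤ → Option Cell) (p : ℤ) :
    evalCA u x p = none ↔ x p = none := by
  refine evalCA_induction (P := fun f => ∀ x, f x p = none ↔ x p = none) (fun x => Iff.rfl)
    (fun f g hf hg x => (hf _).trans (hg _)) (fun π x => ?_) (fun U x => ?_) (fun U x => ?_) u x
  · simp
  · simp
  · simp [swapPermCA_apply]

lemma evalCA_shift (u : FreeGroup Gate) (x : ℤ → Option Cell) (t p : ℤ) :
    evalCA u (fun i => x (i + t)) p = evalCA u x (p + t) := by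
  refine evalCA_induction (P := fun f => ∀ x p, f (fun i => x (i + t)) p = f x (p + t))
    (fun x p => rfl) (fun f g hf hg x p => ?_) (fun π x p => rfl) (fun U x p => rfl)
    (fun U x p => ?_) u x p
  · have : g (fun i => x (i + t)) = fun i => g x (i + t) := funext fun i => hg x i
    rw [Equiv.Perm.mul_apply, this, hf, Equiv.Perm.mul_apply]
  · simp only [swapPermCA_apply]
    rw [add_right_comm p 1 t, ← sub_add_eq_add_sub p 1 t]

lemma exists_evalCA_local (u : FreeGroup Gate) : ∃ R : ℕ, ∀ (x y : ℤ → Option Cell) (p : ℤ),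
    (∀ q, |q - p| ≤ R → x q = y q) → evalCA u x p = evalCA u y p := by
  refine evalCA_induction (P := fun f => ∃ R : ℕ, ∀ (x y : ℤ → Option Cell) (p : ℤ),
    (∀ q, |q - p| ≤ R → x q = y q) → f x p = f y p) ⟨0, fun x y p h => ?_⟩ ?_
    (fun π => ⟨0, fun x y p h => ?_⟩) (fun U => ⟨0, fun x y p h => ?_⟩)
    (fun U => ⟨1, fun x y p h => ?_⟩) u
  · exact h p (by simp)
  · rintro f g ⟨R, hf⟩ ⟨R', hg⟩
    refine ⟨R + R', fun x y p h => hf _ _ _ fun q hq => hg _ _ _ fun r hr => h r ?_⟩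
    calc |r - p| = |(r - q) + (q - p)| := by ring_nf
      _ ≤ |r - q| + |q - p| := abs_add_le _ _
      _ ≤ _ := by push_cast; linarith
  · simp [h p (by simp)]
  · simp [h p (by simp)]
  · simp [swapPermCA_apply, h p (by simp), h (p + 1) (by simp), h (p - 1) (by simp)]

lemma exists_run_end {Q : ℕ → Prop} {N : ℕ} (hN : ¬ Q N) : ∃ k, (∀ j < k, Q j) ∧ ¬ Q k := by
  classical
  have h : ∃ k, ¬ Q k := ⟨N, hN⟩
  exact ⟨Nat.find h, fun j hj => not_not.1 (Nat.find_min h hj), Nat.find_spec h⟩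

/-- In a configuration of finite support, every head is on a belt. -/
lemma exists_isBelt_of_head (N : ℕ) (hN : ∀ q : ℤ, N < |q| → x q = none) {p : ℤ} {s : State}
    {f : Bool} (hp : lab (x p) = some (.h s f)) :
    ∃ i j : ℕ, (∀ q, p - i ≤ q → q < p → lab (x q) = some .l) ∧
      (∀ q, p < q → q ≤ p + j → lab (x q) = some .r) ∧
      ∃ c, IsBelt x (p - i) (i + 1 + j) c := by
  obtain ⟨i, hi, hi'⟩ := exists_run_end (Q := fun j => lab (x (p - 1 - j)) = some .l)
    (N := N + p.natAbs) (by rw [hN _ (by rw [lt_abs]; omega)]; simp)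
  obtain ⟨j, hj, hj'⟩ := exists_run_end (Q := fun j => lab (x (p + 1 + j)) = some .r)
    (N := N + p.natAbs) (by rw [hN _ (by rw [lt_abs]; omega)]; simp)
  have hl (q) (h1 : p - i ≤ q) (h2 : q < p) : lab (x q) = some .l := by
    have := hi (p - 1 - q).toNat (by omega)
    rwa [show p - 1 - ((p - 1 - q).toNat : ℤ) = q by omega] at this
  have hr (q) (h1 : p < q) (h2 : q ≤ p + j) : lab (x q) = some .r := by
    have := hj (q - (p + 1)).toNat (by omega)
    rwa [show p + 1 + ((q - (p + 1)).toNat : ℤ) = q by omega] at this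
  refine ⟨i, j, hl, hr, ?_⟩
  have hlab (q : ℕ) (hq : q < i + 1 + j) : lab (x (p - i + q)) = some (beltLab s i f q) := by
    rcases lt_trichotomy q i with h | rfl | h
    · rw [hl _ (by omega) (by omega), beltLab, if_pos h]
    · simp [hp, beltLab]
    · rw [hr _ (by omega) (by omega), beltLab, if_neg (by omega), if_neg (by omega)]
  choose! d hd using fun q (hq : q < i + 1 + j) => exists_of_lab_eq_some (hlab q hq)
  have key (k : ZMod (2 * (i + 1 + j))) := exists_slotPos (m := i + 1 + j) (by omega) k
  choose κ hκ φ hφ using key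
  refine ⟨(s, slotPos _ i f, fun k => if φ k then (d (κ k)).2 else (d (κ k)).1), i, by omega, f,
    rfl, fun q hq => ?_, ?_, ?_⟩
  · have h1 (g) := slotPos_inj hq (hκ (slotPos (i + 1 + j) q g)) (hφ (slotPos (i + 1 + j) q g))
    rw [hd q hq]
    simp only [← (h1 _).1, ← (h1 _).2]
    simp
  · rwa [sub_right_comm]
  · rwa [show p - i + ((i + 1 + j : ℕ) : ℤ) = p + 1 + j by push_cast; ring]

lemma evalCA_apply_of_finite_support {u : FreeGroup Gate}
    (hu : ∀ m, 1 ≤ m → evalAt (2 * m) (2 * m) u = 1) (N : ℕ) (hN : ∀ q : ℤ, N < |q| → x q = none)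
    (p : ℤ) : evalCA u x p = x p := by
  have belt {a : ℤ} {m : ℕ} {c : Ring (2 * m)} (h : IsBelt x a m c) (q : ℤ) (hq : a ≤ q)
      (hq' : q < a + m) : evalCA u x q = x q := by
    have : NeZero (2 * m) := ⟨by omega⟩
    have h2 := h.evalCA u
    rw [(evalRing_eq_one_iff _ _).2 (hu m (by omega))] at h2
    have := h2.cell_eq h (q - a).toNat (by omega)
    rwa [show a + ((q - a).toNat : ℤ) = q by omega] at this
  rcases hp : lab (x p) with _ | _ | _ | ⟨s, f⟩
  · rw [lab_eq_none] at hp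
    rw [hp, evalCA_eq_none_iff, hp]
  · obtain ⟨k, hk, hk'⟩ := exists_run_end (Q := fun j => lab (x (p + j)) = some .l)
      (N := N + p.natAbs + 1) (by rw [hN _ (by rw [lt_abs]; omega)]; simp)
    obtain ⟨k, rfl⟩ : ∃ i, k = i + 1 := by
      rcases k with _ | k
      · simp [hp] at hk'
      · exact ⟨k, rfl⟩
    push_cast at hk'
    rw [← add_assoc] at hk'
    have hhl (h : lab (x (p + k + 1)) = none ∨ lab (x (p + k + 1)) = some .r) :
        HeadlessLeft x p := ⟨k, fun j hj => hk j (by omega), h⟩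
    rcases hq : lab (x (p + k + 1)) with _ | _ | _ | ⟨s, f⟩
    · exact (hhl (.inl hq)).evalCA_apply u
    · exact absurd hq hk'
    · exact (hhl (.inr hq)).evalCA_apply u
    · obtain ⟨i, j, hl, hr, c, hc⟩ := exists_isBelt_of_head N hN hq
      have hi : (k : ℤ) < i := by
        by_contra h
        have h1 := hk (k - i) (by omega)
        obtain ⟨-, -, -, -, -, h2, -⟩ := hc
        apply h2
        rw [← h1]
        congr 2
        push_cast [show i ≤ k by omega]
        ring
      exact belt hc p (by omega) (by push_cast; omega)
  · obtain ⟨k, hk, hk'⟩ := exists_run_end (Q := fun j => lab (x (p - j)) = some .r)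
      (N := N + p.natAbs + 1) (by rw [hN _ (by rw [lt_abs]; omega)]; simp)
    obtain ⟨k, rfl⟩ : ∃ i, k = i + 1 := by
      rcases k with _ | k
      · simp [hp] at hk'
      · exact ⟨k, rfl⟩
    push_cast at hk'
    rw [← sub_sub] at hk'
    have hhl (h : lab (x (p - k - 1)) = none ∨ lab (x (p - k - 1)) = some .l) :
        HeadlessRight x p := ⟨k, fun j hj => hk j (by omega), h⟩
    rcases hq : lab (x (p - k - 1)) with _ | _ | _ | ⟨s, f⟩
    · exact (hhl (.inl hq)).evalCA_apply u
    · exact (hhl (.inr hq)).evalCA_apply u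
    · exact absurd hq hk'
    · obtain ⟨i, j, hl, hr, c, hc⟩ := exists_isBelt_of_head N hN hq
      have hi : (k : ℤ) < j := by
        by_contra h
        have h1 := hk (k - j) (by omega)
        obtain ⟨-, -, -, -, -, -, h2⟩ := hc
        apply h2
        rw [← h1]
        congr 2
        push_cast [show j ≤ k by omega]
        ring
      exact belt hc p (by omega) (by push_cast; omega)
  · obtain ⟨i, j, hl, hr, c, hc⟩ := exists_isBelt_of_head N hN hp
    exact belt hc p (by omega) (by push_cast; omega)

lemma evalCA_eq_one {u : FreeGroup Gate} (hu : ∀ m, 1 ≤ m → evalAt (2 * m) (2 * m) u = 1) :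
    evalCA u = 1 := by
  ext1 x
  funext p
  obtain ⟨R, hR⟩ := exists_evalCA_local u
  set y : ℤ → Option Cell := fun q => if |q - p| ≤ R then x q else none with hy
  rw [hR x y p (fun q hq => by simp [hy, hq]),
    evalCA_apply_of_finite_support hu (R + p.natAbs) (fun q hq => ?_)]
  · simp [hy]
  · refine if_neg fun h => ?_
    have := abs_add_le (q - p) p
    rw [sub_add_cancel] at this
    push_cast at hq
    linarith

/-- A nontrivial action on some belt is visible on a configuration of finite support. -/
lemma exists_evalCA_ne {u : FreeGroup Gate} {m : ℕ} (hm : 1 ≤ m)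
    (hu : evalAt (2 * m) (2 * m) u ≠ 1) :
    ∃ x : ℤ → Option Cell, (∀ p, x p ≠ none ↔ 0 ≤ p ∧ p < m) ∧ evalCA u x ≠ x := by
  have : NeZero (2 * m) := ⟨by omega⟩
  rw [Ne, ← evalRing_eq_one_iff] at hu
  obtain ⟨c, hc⟩ : ∃ c, evalRing (2 * m) u c ≠ c := by
    by_contra! h
    exact hu (Equiv.ext h)
  obtain ⟨x, hx, hb⟩ := exists_isBelt hm c
  refine ⟨x, hx, fun h => hc ?_⟩
  have := hb.evalCA u
  rw [h] at this
  exact this.eq hb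

end Conveyor

namespace Sofic

variable {A : Type*}

/-- The word of length `n` occurring in `x` at position `i`. -/
def word (x : ℤ → A) (i : ℤ) (n : ℕ) : List A := List.ofFn fun k : Fin n => x (i + (k : ℕ))

@[simp] lemma length_word (x : ℤ → A) (i : ℤ) (n : ℕ) : (word x i n).length = n := by simp [word]

@[simp] lemma getElem_word (x : ℤ → A) (i : ℤ) (n k : ℕ) (h : k < (word x i n).length) :
    (word x i n)[k] = x (i + k) := by simp [word]

lemma word_add (x : ℤ → A) (i : ℤ) (m n : ℕ) :
    word x i (m + n) = word x i m ++ word x (i + m) n := by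
  refine List.ext_getElem (by simp) fun k h1 h2 => ?_
  rw [List.getElem_append]
  split_ifs with h
  · simp
  · rw [getElem_word, getElem_word]
    congr 1
    simp only [length_word] at h ⊢
    omega

lemma word_eq_iff {x : ℤ → A} {i : ℤ} {w : List A} {n : ℕ} (hw : w.length = n) :
    word x i n = w ↔ ∀ k (h : k < w.length), x (i + k) = w[k] := by
  subst hw
  constructor
  · intro h k hk
    rw [← getElem_word x i w.length k (by simpa using hk)]
    simp only [h]
  · exact fun h => List.ext_getElem (by simp) fun k h1 h2 => by rw [getElem_word, h k h2]

lemma word_eq_word_iff {x y : ℤ → A} {i j : ℤ} {n : ℕ} :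
    word x i n = word y j n ↔ ∀ k < n, x (i + (k : ℕ)) = y (j + (k : ℕ)) := by
  rw [word_eq_iff (by simp)]
  simp

lemma mem_language_iff {X : Set (ℤ → A)} {w : List A} :
    w ∈ subshiftLanguage X ↔ ∃ x ∈ X, ∃ i, word x i w.length = w := by
  refine exists_congr fun x => and_congr Iff.rfl (exists_congr fun i => ?_)
  rw [word_eq_iff rfl]
  exact ⟨fun h k hk => h ⟨k, hk⟩, fun h j => h j j.2⟩

lemma word_mem_language {X : Set (ℤ → A)} {x : ℤ → A} (hx : x ∈ X) (i : ℤ) (n : ℕ) :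
    word x i n ∈ subshiftLanguage X :=
  mem_language_iff.2 ⟨x, hx, i, by simp⟩

lemma mem_language_of_append {X : Set (ℤ → A)} {u v w : List A}
    (h : u ++ v ++ w ∈ subshiftLanguage X) : v ∈ subshiftLanguage X := by
  obtain ⟨x, hx, i, h⟩ := mem_language_iff.1 h
  rw [List.length_append, List.length_append, word_add, word_add] at h
  have h2 := List.append_inj_right (List.append_inj_left h (by simp)) (by simp)
  rw [← h2]
  exact word_mem_language hx _ _

section shift

variable [TopologicalSpace A] {X : Set (ℤ → A)}

lemma shift_mem (hX : IsSubshift X) {x : ℤ → A} (hx : x ∈ X) (t : ℤ) :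
    (fun i => x (i + t)) ∈ X := by
  have h1 (y : ℤ → A) (hy : y ∈ X) : (fun i => y (i + 1)) ∈ X := hX.2 ▸ Set.mem_image_of_mem _ hy
  have h2 (y : ℤ → A) (hy : y ∈ X) : (fun i => y (i + -1)) ∈ X := by
    rw [← hX.2] at hy
    obtain ⟨z, hz, rfl⟩ := hy
    simpa [shiftMap] using hz
  induction t using Int.induction_on with
  | zero => simpa using hx
  | succ k ih => simpa [add_assoc, add_comm (1 : ℤ)] using h1 _ ih
  | pred k ih =>
    have := h2 _ ih
    simp only [add_assoc] at this
    convert this using 3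
    ring

lemma mem_of_word_mem [DiscreteTopology A] (hX : IsSubshift X) {x : ℤ → A}
    (h : ∀ n : ℕ, word x (-n) (2 * n + 1) ∈ subshiftLanguage X) : x ∈ X := by
  have h2 (n : ℕ) : ∃ y ∈ X, ∀ i : ℤ, |i| ≤ n → y i = x i := by
    obtain ⟨y, hy, i, hi⟩ := mem_language_iff.1 (h n)
    refine ⟨_, shift_mem hX hy (i + n), fun j hj => ?_⟩
    rw [length_word, word_eq_word_iff] at hi
    rw [abs_le] at hj
    have := hi (j + n).toNat (by omega)
    rw [Int.toNat_of_nonneg (by omega)] at this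
    convert this using 2 <;> ring
  choose y hy hyx using h2
  refine hX.1.mem_of_tendsto (f := y) (b := Filter.atTop) ?_ (Filter.Eventually.of_forall hy)
  rw [tendsto_pi_nhds]
  intro i
  refine tendsto_const_nhds.congr' ?_
  filter_upwards [Filter.eventually_ge_atTop i.natAbs] with n hn
  exact (hyx n i (by rw [Int.abs_eq_natAbs]; omega)).symm

end shift

/-- Two words are equivalent if they can be exchanged in all contexts. -/
def CtxEq (L : Language A) (u v : List A) : Prop := ∀ p s, p ++ u ++ s ∈ L ↔ p ++ v ++ s ∈ L

lemma CtxEq.symm {L : Language A} {u v : List A} (h : CtxEq L u v) : CtxEq L v u :=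
  fun p s => (h p s).symm

lemma CtxEq.trans {L : Language A} {u v w : List A} (h : CtxEq L u v) (h' : CtxEq L v w) :
    CtxEq L u w := fun p s => (h p s).trans (h' p s)

lemma CtxEq.append {L : Language A} {u v u' v' : List A} (h : CtxEq L u v) (h' : CtxEq L u' v') :
    CtxEq L (u ++ u') (v ++ v') := fun p s => by
  have h1 := h p (u' ++ s)
  have h2 := h' (p ++ v) s
  simp only [List.append_assoc] at h1 h2 ⊢
  exact h1.trans h2

lemma CtxEq.refl (L : Language A) (u : List A) : CtxEq L u u := fun _ _ => Iff.rfl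

lemma exists_finite_ctxEq {L : Language A} (h : L.IsRegular) :
    ∃ (T : Type) (_ : Finite T) (δ : List A → T), ∀ u v, δ u = δ v → CtxEq L u v := by
  obtain ⟨S, _, M, rfl⟩ := h
  refine ⟨S → S, inferInstance, fun w s => M.evalFrom s w, fun u v huv p s => ?_⟩
  have : M.eval (p ++ u ++ s) = M.eval (p ++ v ++ s) := by
    simp only [DFA.eval, DFA.evalFrom_of_append]
    have h := congrFun huv (M.evalFrom M.start p)
    simp only at h
    rw [h]
  rw [DFA.mem_accepts, DFA.mem_accepts, this]

/-- Concatenation of copies of two words. -/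
def cat (a b : List A) (z : List Bool) : List A := z.flatMap fun t => cond t b a

@[simp] lemma cat_nil (a b : List A) : cat a b [] = [] := rfl

@[simp] lemma cat_cons (a b : List A) (t : Bool) (z : List Bool) :
    cat a b (t :: z) = cond t b a ++ cat a b z := rfl

lemma cat_append (a b : List A) (y z : List Bool) : cat a b (y ++ z) = cat a b y ++ cat a b z :=
  List.flatMap_append

lemma length_cat {a b : List A} (h : a.length = b.length) (z : List Bool) :
    (cat a b z).length = z.length * a.length := by
  induction z with
  | nil => simp
  | cons t z ih => cases t <;> simp [ih, h] <;> ring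

lemma cat_cat (a b : List A) (u v z : List Bool) :
    cat (cat a b u) (cat a b v) z = cat a b (cat u v z) := by
  induction z with
  | nil => rfl
  | cons t z ih => cases t <;> simp [ih, cat_append]

lemma cat_injective {a b : List A} (h : a.length = b.length) (hne : a ≠ b) {y z : List Bool}
    (hyz : y.length = z.length) (hcat : cat a b y = cat a b z) : y = z := by
  induction y generalizing z with
  | nil => exact (List.length_eq_zero_iff.1 hyz.symm).symm
  | cons t y ih =>
    rcases z with _ | ⟨t', z⟩
    · simp at hyz
    · simp only [cat_cons] at hcat
      obtain ⟨h1, h2⟩ := List.append_inj hcat (by cases t <;> cases t' <;> simp [h])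
      rw [ih (by simpa using hyz) h2]
      cases t <;> cases t' <;> simp_all

/-- The two words `a` and `b` are distinct, of the same length, exchangeable, and can be freely
concatenated. -/
structure IsFreePair (L : Language A) (a b : List A) : Prop where
  length_eq : a.length = b.length
  ne : a ≠ b
  ctxEq : CtxEq L a b
  cat_mem : ∀ z, cat a b z ∈ L

/-- Two noncommuting words generating a free family of words of the language give a free pair. -/
lemma exists_isFreePair_of_not_comm {L : Language A} {T : Type} [Finite T] {δ : List A → T}
    (hδ : ∀ u v, δ u = δ v → CtxEq L u v) {u v : List A} (huv : u ++ v ≠ v ++ u)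
    (hL : ∀ z, cat u v z ∈ L) : ∃ a b, IsFreePair L a b := by
  have : Fintype T := Fintype.ofFinite T
  set n := Fintype.card T
  obtain ⟨y, z, hyz, h⟩ := Fintype.exists_ne_map_eq_of_card_lt
    (fun y : Fin n → Bool => δ (cat (u ++ v) (v ++ u) (List.ofFn y)))
    (by simpa using Nat.lt_two_pow_self (n := n))
  have e1 : u ++ v = cat u v [false, true] := by simp
  have e2 : v ++ u = cat u v [true, false] := by simp
  refine ⟨_, _, ?_, fun h' => ?_, hδ _ _ h, fun w => ?_⟩
  · rw [length_cat (by simp [add_comm]), length_cat (by simp [add_comm])]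
    simp
  · exact hyz (List.ofFn_injective (cat_injective (by simp [add_comm]) huv (by simp) h'))
  · rw [cat_cat, e1, e2, cat_cat]
    exact hL _

/-- A right-infinite word of a factorial language with finitely many classes is eventually periodic
unless the language contains a free pair. -/
lemma eventually_periodic_or_not_comm {L : Language A} {T : Type} [Finite T] {δ : List A → T}
    (hδ : ∀ u v, δ u = δ v → CtxEq L u v) (hfac : ∀ u v w, u ++ v ++ w ∈ L → v ∈ L)
    (x : ℤ → A) (hx : ∀ n, word x 0 n ∈ L) :
    (∃ d : ℕ, 1 ≤ d ∧ ∃ N : ℕ, ∀ i : ℤ, N ≤ i → x (i + d) = x i) ∨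
      ∃ u v : List A, u ++ v ≠ v ++ u ∧ ∀ z, cat u v z ∈ L := by
  obtain ⟨f, hf⟩ := Finite.exists_infinite_fiber fun n : ℕ => δ (word x 0 n)
  rw [Set.infinite_coe_iff] at hf
  obtain ⟨j, hj⟩ := hf.nonempty
  obtain ⟨k, hk, hjk⟩ := hf.exists_gt j
  obtain ⟨d, rfl⟩ : ∃ d, k = j + d := ⟨k - j, by omega⟩
  have hloop (n : ℕ) (hn : j + n ∈ (fun n : ℕ => δ (word x 0 n)) ⁻¹' {f}) :
      CtxEq L (word x 0 j ++ word x j n) (word x 0 j) := by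
    have := word_add x 0 j n
    rw [zero_add] at this
    rw [← this]
    exact hδ _ _ (hn.trans hj.symm)
  by_cases hcomm : ∀ n, j + n ∈ (fun n : ℕ => δ (word x 0 n)) ⁻¹' {f} →
      word x j d ++ word x j n = word x j n ++ word x j d
  · refine .inl ⟨d, by omega, j, fun i hi => ?_⟩
    obtain ⟨m, hm, hmi⟩ := hf.exists_gt (i.toNat + d)
    obtain ⟨n, rfl⟩ : ∃ n, m = j + n := ⟨m - j, by omega⟩
    have h1 := hcomm n hm
    obtain ⟨e, rfl⟩ : ∃ e : ℕ, i = j + e := ⟨(i - j).toNat, by omega⟩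
    have h2 : (word x j d ++ word x j n)[e + d]? = (word x j n ++ word x j d)[e + d]? := by
      rw [h1]
    rw [List.getElem?_append_right (by simp), List.getElem?_append_left (by simp; omega),
      List.getElem?_eq_getElem (by simp; omega), List.getElem?_eq_getElem (by simp; omega)] at h2
    simp only [getElem_word, length_word, Nat.add_sub_cancel, Option.some.injEq] at h2
    rw [h2]
    congr 1
    push_cast
    ring
  · push Not at hcomm
    obtain ⟨n, hn, hne⟩ := hcomm
    refine .inr ⟨_, _, hne, fun z => ?_⟩
    have h1 : CtxEq L (word x 0 j ++ cat (word x j d) (word x j n) z) (word x 0 j) := by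
      induction z with
      | nil => simpa using CtxEq.refl _ _
      | cons t z ih =>
        have h2 : CtxEq L (word x 0 j ++ cond t (word x j n) (word x j d)) (word x 0 j) := by
          cases t
          · exact hloop d hk
          · exact hloop n hn
        rw [cat_cons, ← List.append_assoc]
        exact (h2.append (CtxEq.refl _ _)).trans ih
    have h2 := (h1 [] []).2 (by simpa using hx j)
    exact hfac (word x 0 j) _ [] (by simpa using h2)

lemma reverse_cat (a b : List A) (z : List Bool) :
    (cat a b z).reverse = cat a.reverse b.reverse z.reverse := by
  induction z with
  | nil => rfl
  | cons t z ih =>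
    rw [cat_cons, List.reverse_append, ih, List.reverse_cons, cat_append]
    cases t <;> simp

variable {X : Set (ℤ → A)}

lemma eventually_periodic_right (hreg : (subshiftLanguage X).IsRegular)
    (hfree : ∀ a b, ¬ IsFreePair (subshiftLanguage X) a b) {x : ℤ → A} (hx : x ∈ X) :
    ∃ d : ℕ, 1 ≤ d ∧ ∃ N : ℕ, ∀ i : ℤ, N ≤ i → x (i + d) = x i := by
  obtain ⟨T, _, δ, hδ⟩ := exists_finite_ctxEq hreg
  rcases eventually_periodic_or_not_comm hδ (fun u v w => mem_language_of_append) x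
    (fun n => word_mem_language hx _ _) with h | ⟨u, v, huv, h⟩
  · exact h
  · obtain ⟨a, b, hab⟩ := exists_isFreePair_of_not_comm hδ huv h
    exact absurd hab (hfree a b)

lemma eventually_periodic_left (hreg : (subshiftLanguage X).IsRegular)
    (hfree : ∀ a b, ¬ IsFreePair (subshiftLanguage X) a b) {x : ℤ → A} (hx : x ∈ X) :
    ∃ d : ℕ, 1 ≤ d ∧ ∃ N : ℕ, ∀ i : ℤ, i ≤ -N → x (i - d) = x i := by
  obtain ⟨T, _, δ, hδ⟩ := exists_finite_ctxEq hreg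
  set L := subshiftLanguage X with hL
  set L' : Language A := {w | w.reverse ∈ L}
  have hmem (w) : w ∈ L' ↔ w.reverse ∈ L := Iff.rfl
  have hδ' (u v : List A) (h : δ u.reverse = δ v.reverse) : CtxEq L' u v := fun p s => by
    have := hδ _ _ h s.reverse p.reverse
    simpa [hmem] using this
  rcases eventually_periodic_or_not_comm (L := L') hδ' (fun u v w h => by
      rw [hmem] at h ⊢
      simp only [List.reverse_append, ← List.append_assoc] at h
      exact mem_language_of_append h) (fun i => x (-i)) (fun n => by
      rw [hmem]
      have : (word (fun i => x (-i)) 0 n).reverse = word x (1 - n) n :=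
        List.ext_getElem (by simp) fun k h1 h2 => by
          simp only [List.length_reverse, length_word] at h1
          simp only [List.getElem_reverse, getElem_word, length_word]
          congr 1
          omega
      rw [this]
      exact word_mem_language hx _ _) with ⟨d, hd, N, h⟩ | ⟨u, v, huv, h⟩
  · refine ⟨d, hd, N, fun i hi => ?_⟩
    have := h (-i) (by omega)
    simpa [sub_eq_add_neg, add_comm] using this
  · obtain ⟨a, b, hab⟩ := exists_isFreePair_of_not_comm hδ (u := u.reverse) (v := v.reverse)
      (fun h' => huv (by simpa using (congrArg List.reverse h').symm)) (fun z => by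
        have := h z.reverse
        rw [hmem, reverse_cat] at this
        simpa using this)
    exact absurd hab (hfree a b)

lemma apply_add_mul_of_periodic {x : ℤ → A} {d N : ℕ} (h : ∀ i : ℤ, N ≤ i → x (i + d) = x i)
    (k : ℕ) (i : ℤ) (hi : N ≤ i) : x (i + (k * d : ℕ)) = x i := by
  induction k with
  | zero => simp
  | succ k ih =>
    rw [← ih, ← h (i + (k * d : ℕ)) (by omega)]
    congr 1
    push_cast
    ring

lemma countable_of_not_isFreePair [Finite A] (hreg : (subshiftLanguage X).IsRegular)
    (hfree : ∀ a b, ¬ IsFreePair (subshiftLanguage X) a b) : X.Countable := by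
  set S : ℕ × ℕ → Set (ℤ → A) := fun c =>
    {x | (∀ i : ℤ, c.1 ≤ i → x (i + (c.2 + 1 : ℕ)) = x i) ∧
      ∀ i : ℤ, i ≤ -c.1 → x (i - (c.2 + 1 : ℕ)) = x i} with hS
  have hsub : X ⊆ ⋃ c, S c := by
    intro x hx
    obtain ⟨d, hd, N, h⟩ := eventually_periodic_right hreg hfree hx
    obtain ⟨e, he, M, h'⟩ := eventually_periodic_left hreg hfree hx
    have h1 := apply_add_mul_of_periodic h e
    have h2 := apply_add_mul_of_periodic (x := fun i => x (-i)) (d := e) (N := M) (fun i hi => by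
      have := h' (-i) (by omega)
      simpa [sub_eq_add_neg, add_comm] using this) d
    have hde : 1 ≤ e * d := Nat.mul_pos he hd
    refine Set.mem_iUnion.2 ⟨(max N M, e * d - 1), fun i hi => ?_, fun i hi => ?_⟩
    · simp only [Nat.sub_add_cancel hde]
      exact h1 i (by simp only at hi; omega)
    · simp only [Nat.sub_add_cancel hde]
      have := h2 (-i) (by simp only at hi; omega)
      simpa [sub_eq_add_neg, add_comm, mul_comm e] using this
  refine (Set.countable_iUnion fun c => Set.Finite.countable ?_).mono hsub
  obtain ⟨N, d⟩ := c
  refine Set.Finite.of_finite_image (f := fun x => fun i : Set.Icc (-(N + d + 1) : ℤ) (N + d + 1) =>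
    x i) (Set.toFinite _) fun x hx y hy hxy => ?_
  have hmid (i : ℤ) (h1 : -(N + d + 1) ≤ i) (h2 : i ≤ N + d + 1) : x i = y i :=
    congrFun hxy ⟨i, h1, h2⟩
  have key (n : ℕ) : ∀ i : ℤ, i.natAbs ≤ n → x i = y i := by
    induction n with
    | zero => exact fun i hi => hmid i (by omega) (by omega)
    | succ n ih =>
      intro i hi
      by_cases h1 : i < -(N + d + 1)
      · rw [show i = (i + (d + 1 : ℕ)) - (d + 1 : ℕ) by ring, hx.2 _ (by simp only; omega),
          hy.2 _ (by simp only; omega), ih _ (by omega)]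
      · by_cases h2 : N + d + 1 < i
        · rw [show i = (i - (d + 1 : ℕ)) + (d + 1 : ℕ) by ring, hx.1 _ (by simp only; omega),
            hy.1 _ (by simp only; omega), ih _ (by omega)]
        · exact hmid i (by omega) (by omega)
  exact funext fun i => key _ i le_rfl

lemma word_mem_language_of_le {x : ℤ → A} {i j : ℤ} {m n : ℕ}
    (h : word x i m ∈ subshiftLanguage X) (hij : i ≤ j) (hmn : j + n ≤ i + m) :
    word x j n ∈ subshiftLanguage X := by
  obtain ⟨k, rfl⟩ : ∃ k : ℕ, j = i + k := ⟨(j - i).toNat, by omega⟩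
  obtain ⟨l, rfl⟩ : ∃ l : ℕ, m = k + n + l := ⟨m - k - n, by omega⟩
  rw [word_add, word_add] at h
  exact mem_language_of_append h

lemma IsFreePair.length_pos {L : Language A} {a b : List A} (h : IsFreePair L a b) :
    0 < a.length := by
  rw [List.length_pos_iff]
  rintro rfl
  exact h.ne (List.length_eq_zero_iff.1 h.length_eq.symm).symm

lemma word_mul_eq_cat {a b : List A} {x : ℤ → A} {z : ℤ → Bool}
    (h : ∀ k : ℤ, word x (k * a.length) a.length = cond (z k) b a) (k : ℤ) (n : ℕ) :
    word x (k * a.length) (n * a.length) = cat a b (word z k n) := by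
  induction n generalizing k with
  | zero => simp [word]
  | succ n ih =>
    have := ih (k + 1)
    rw [add_mul, one_mul] at this
    rw [add_mul, one_mul, add_comm (n * _), word_add, h, this, add_comm n, word_add, cat_append]
    simp [word]

section free

variable [TopologicalSpace A] [DiscreteTopology A] {a b : List A}

/-- A free pair can be concatenated along any bi-infinite sequence. -/
lemma IsFreePair.exists_mem (h : IsFreePair (subshiftLanguage X) a b) (hX : IsSubshift X)
    (z : ℤ → Bool) :
    ∃ x ∈ X, ∀ k : ℤ, word x (k * a.length) a.length = cond (z k) b a := by
  set c := a.length with hc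
  have hpos : 0 < (c : ℤ) := by exact_mod_cast h.length_pos
  have hlen (t : Bool) : (cond t b a).length = c := by cases t <;> simp [hc, h.length_eq]
  set x : ℤ → A := fun i => (cond (z (i / c)) b a)[(i % c).toNat]'(by
    rw [hlen]
    have := Int.emod_lt_of_pos i hpos
    omega) with hx
  have hword (k : ℤ) : word x (k * c) c = cond (z k) b a := by
    rw [word_eq_iff (hlen _)]
    intro j hj
    rw [hlen] at hj
    have e1 : (k * c + j) / c = k := by
      rw [add_comm, Int.add_mul_ediv_right _ _ hpos.ne', Int.ediv_eq_zero_of_lt (by omega)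
        (by omega), zero_add]
    have e2 : (k * c + j) % c = j := by
      rw [add_comm, Int.add_mul_emod_self_right, Int.emod_eq_of_lt (by omega) (by omega)]
    simp only [hx, e1, e2, Int.toNat_natCast]
  refine ⟨x, mem_of_word_mem hX fun n => ?_, hword⟩
  have h1 := h.cat_mem (word z (-(n + 1 : ℕ)) (2 * (n + 1)))
  rw [← word_mul_eq_cat hword] at h1
  have h2 : (n : ℤ) + 1 ≤ (n + 1) * c := le_mul_of_one_le_right (by omega) (by omega)
  refine word_mem_language_of_le h1 ?_ ?_
  · push_cast
    linarith
  · push_cast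
    linarith

lemma IsFreePair.not_countable (h : IsFreePair (subshiftLanguage X) a b) (hX : IsSubshift X) :
    ¬ X.Countable := by
  choose f hf hfz using h.exists_mem hX
  intro hc
  have : Countable X := hc
  obtain ⟨e, he⟩ := exists_injective_nat X
  classical
  refine Function.cantor_injective
    (fun s : Set ℤ => (e ⟨f fun i => decide (i ∈ s), hf _⟩ : ℤ)) fun s t hst => ?_
  have h1 := congrArg Subtype.val (he (Nat.cast_injective hst))
  ext i
  have h2 := hfz (fun i => decide (i ∈ s)) i
  simp only at h1
  rw [h1, hfz] at h2
  by_cases hs : i ∈ s <;> by_cases ht : i ∈ t <;> simp [hs, ht] at h2 ⊢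
  · exact h.ne h2
  · exact h.ne h2.symm

end free

end Sofic

namespace Sofic

variable {A : Type*} [TopologicalSpace A] {X : Set (ℤ → A)}

/-- The shift by `t` on a subshift. -/
def shift (hX : IsSubshift X) (t : ℤ) (x : X) : X := ⟨fun i => x.1 (i + t), shift_mem hX x.2 t⟩

variable (hX : IsSubshift X)

lemma shift_apply (t : ℤ) (x : X) (i : ℤ) : (shift hX t x).1 i = x.1 (i + t) := rfl

lemma shift_shift (s t : ℤ) (x : X) : shift hX s (shift hX t x) = shift hX (s + t) x :=
  Subtype.ext (funext fun i => by simp only [shift_apply, add_assoc])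

@[simp] lemma shift_zero (x : X) : shift hX 0 x = x :=
  Subtype.ext (funext fun i => by simp [shift_apply])

lemma shift_injective (t : ℤ) : Function.Injective (shift hX t) := fun x y h => by
  simpa [shift_shift] using congrArg (shift hX (-t)) h

lemma continuous_shift (t : ℤ) : Continuous (shift hX t) := by
  refine Continuous.subtype_mk (continuous_pi fun i => ?_) _
  exact (continuous_apply (i + t)).comp continuous_subtype_val

lemma aut_shift {f : Equiv.Perm X} (hf : f ∈ SubshiftAut X) (t : ℤ) (x : X) :
    f (shift hX t x) = shift hX t (f x) := by
  have h1 (y : X) : f (shift hX 1 y) = shift hX 1 (f y) := Subtype.ext (hf.2.2 y _ rfl)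
  have h2 (y : X) : f (shift hX (-1) y) = shift hX (-1) (f y) := by
    refine shift_injective hX 1 ?_
    rw [← h1, shift_shift, shift_shift]
    simp
  induction t using Int.induction_on with
  | zero => simp
  | succ k ih => rw [add_comm, ← shift_shift, h1, ih, shift_shift]
  | pred k ih => rw [sub_eq_add_neg, add_comm, ← shift_shift, h2, ih, shift_shift]

/-- The automorphism group of a subshift as a subgroup of its group of permutations. -/
def autSubgroup (hX : IsSubshift X) : Subgroup (Equiv.Perm X) where
  carrier := SubshiftAut X
  one_mem' := ⟨continuous_id, continuous_id, fun _ _ h => h⟩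
  mul_mem' {f g} hf hg := ⟨hf.1.comp hg.1, hg.2.1.comp hf.2.1,
    fun x y h => hf.2.2 _ _ (hg.2.2 x y h)⟩
  inv_mem' {f} hf := ⟨hf.2.1, hf.1, fun x y h => by
    obtain rfl : y = shift hX 1 x := Subtype.ext h
    have : f⁻¹ (shift hX 1 x) = shift hX 1 (f⁻¹ x) := by
      rw [Equiv.Perm.inv_eq_iff_eq, aut_shift hX hf]
      simp
    exact congrArg Subtype.val this⟩

variable {hX}

lemma eq_of_forall_shift {f : Equiv.Perm X} (hf : f ∈ autSubgroup hX) {x : X}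
    (h : ∀ t, (f (shift hX t x)).1 0 = (shift hX t x).1 0) : f x = x := by
  refine Subtype.ext (funext fun t => ?_)
  have := h t
  rw [aut_shift hX hf] at this
  simpa [shift_apply] using this

section compact

variable [Finite A]

lemma compactSpace (hX : IsSubshift X) : CompactSpace X :=
  isCompact_iff_compactSpace.1 hX.1.isCompact

variable [DiscreteTopology A]

/-- The Curtis–Hedlund–Lyndon theorem. -/
lemma exists_radius {f : Equiv.Perm X} (hf : f ∈ autSubgroup hX) : ∃ R : ℕ, ∀ (x y : X) (p : ℤ),
    (∀ q, |q - p| ≤ R → x.1 q = y.1 q) → (f x).1 p = (f y).1 p := by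
  have := compactSpace hX
  suffices h : ∃ R : ℕ, ∀ x y : X, (∀ q, |q| ≤ (R : ℤ) → x.1 q = y.1 q) → (f x).1 0 = (f y).1 0 by
    obtain ⟨R, h⟩ := h
    refine ⟨R, fun x y p hxy => ?_⟩
    have := h (shift hX p x) (shift hX p y) fun q hq => hxy _ (by simpa using hq)
    rw [aut_shift hX hf, aut_shift hX hf] at this
    simpa [shift_apply] using this
  by_contra! h
  have hval (i : ℤ) : Continuous fun x : X => x.1 i :=
    (continuous_apply i).comp continuous_subtype_val
  set K : ℕ → Set (X × X) := fun R =>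
    {z | (∀ q, |q| ≤ (R : ℤ) → z.1.1 q = z.2.1 q) ∧ (f z.1).1 0 ≠ (f z.2).1 0}
  have hK (R : ℕ) : IsClosed (K R) := by
    have h1 : IsClosed {z : X × X | ∀ q : ℤ, |q| ≤ (R : ℤ) → z.1.1 q = z.2.1 q} := by
      simp only [Set.ofPred_forall]
      refine isClosed_iInter fun q => isClosed_iInter fun _ => isClosed_eq ?_ ?_
      · exact (hval q).comp continuous_fst
      · exact (hval q).comp continuous_snd
    have hc : Continuous fun z : X × X => ((f z.1).1 0, (f z.2).1 0) :=
      ((hval 0).comp (hf.1.comp continuous_fst)).prodMk ((hval 0).comp (hf.1.comp continuous_snd))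
    exact h1.inter ((isClosed_discrete {z : A × A | z.1 ≠ z.2}).preimage hc)
  obtain ⟨⟨x, y⟩, hxy⟩ := IsCompact.nonempty_iInter_of_sequence_nonempty_isCompact_isClosed K
    (fun n z hz => ⟨fun q hq => hz.1 q (by push_cast; omega), hz.2⟩)
    (fun n => let ⟨x, y, h1, h2⟩ := h n; ⟨(x, y), h1, h2⟩) (hK 0).isCompact hK
  rw [Set.mem_iInter] at hxy
  refine (hxy 0).2 ?_
  have : x = y := Subtype.ext (funext fun i => (hxy i.natAbs).1 i (by rw [Int.abs_eq_natAbs]))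
  simp [this]

end compact

/-- The configuration `x` has period `p` up to position `N`. -/
def LeftPeriodic (p N : ℤ) (x : ℤ → A) : Prop := ∀ i ≤ N, x (i - p) = x i

lemma LeftPeriodic.map {f : Equiv.Perm X} (hf : f ∈ autSubgroup hX) {R : ℕ}
    (hR : ∀ (x y : X) (p : ℤ), (∀ q, |q - p| ≤ R → x.1 q = y.1 q) → (f x).1 p = (f y).1 p)
    {p N : ℤ} {x : X} (hx : LeftPeriodic p N x.1) : LeftPeriodic p (N - R) (f x).1 := by
  intro i hi
  have := hR (shift hX (-p) x) x i fun q hq => hx q (by rw [abs_le] at hq; omega)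
  rwa [aut_shift hX hf] at this

lemma LeftPeriodic.map_prod {F : Set (Equiv.Perm X)} (hF : F ⊆ autSubgroup hX) {R : ℕ}
    (hR : ∀ f ∈ F, (∀ (x y : X) (p : ℤ), (∀ q, |q - p| ≤ R → x.1 q = y.1 q) →
      (f x).1 p = (f y).1 p) ∧ ∀ (x y : X) (p : ℤ), (∀ q, |q - p| ≤ R → x.1 q = y.1 q) →
      (f⁻¹ x).1 p = (f⁻¹ y).1 p) (w : List (Equiv.Perm X)) (hw : ∀ f ∈ w, f ∈ F ∨ f⁻¹ ∈ F)
    {p N : ℤ} (x : X) : (LeftPeriodic p N x.1 → LeftPeriodic p (N - w.length * R) (w.prod x).1) ∧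
      (LeftPeriodic p N (w.prod x).1 → LeftPeriodic p (N - w.length * R) x.1) := by
  induction w generalizing N with
  | nil => simp
  | cons f w ih =>
    have hf : ∀ N (y : X), (LeftPeriodic p N y.1 → LeftPeriodic p (N - R) (f y).1) ∧
        (LeftPeriodic p N (f y).1 → LeftPeriodic p (N - R) y.1) := by
      intro N y
      rcases hw f (by simp) with h | h
      · refine ⟨fun hy => hy.map (hF h) (hR f h).1, fun hy => ?_⟩
        simpa using hy.map (inv_mem (hF h)) (hR f h).2
      · refine ⟨fun hy => ?_, fun hy => ?_⟩
        · have := hy.map (inv_mem (hF h)) (hR _ h).2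
          simpa using this
        · simpa using hy.map (hF h) (hR _ h).1
    have ih' := fun {N} => ih (N := N) (fun f hf => hw f (by simp [hf]))
    have e : (N - ((f :: w).length : ℕ) * R : ℤ) = N - w.length * R - R := by
      push_cast [List.length_cons]
      ring
    rw [List.prod_cons, Equiv.Perm.mul_apply, e]
    refine ⟨fun h => (hf _ _).1 (ih'.1 h), fun h => ?_⟩
    rw [sub_right_comm]
    exact ih'.2 ((hf _ _).2 h)

lemma exists_wordNorm {G : Type*} [Group G] {F : Set G} {g : G} (hg : g ∈ Subgroup.closure F) :
    ∃ w : List G, w.length = wordNorm F g ∧ (∀ x ∈ w, x ∈ F ∨ x⁻¹ ∈ F) ∧ w.prod = g := by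
  rw [← Subgroup.mem_toSubmonoid, Subgroup.closure_toSubmonoid] at hg
  obtain ⟨l, hl, rfl⟩ := Submonoid.exists_list_of_mem_closure hg
  exact Nat.sInf_mem (s := {n : ℕ | ∃ w : List G, w.length = n ∧ (∀ x ∈ w, x ∈ F ∨ x⁻¹ ∈ F) ∧
    w.prod = l.prod}) ⟨_, l, rfl, hl, rfl⟩

section compact

variable [DiscreteTopology A] [Finite A]

open Filter in
/-- An automorphism some power of which acts as a nontrivial shift on a left eventually periodic
aperiodic point is undistorted. -/
lemma not_tendsto_wordNorm {g : Equiv.Perm X} {F : Finset (Equiv.Perm X)}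
    (hF : (F : Set (Equiv.Perm X)) ⊆ SubshiftAut X)
    (hg : g ∈ Subgroup.closure (F : Set (Equiv.Perm X))) {y : X}
    (hper : ∃ d : ℕ, 1 ≤ d ∧ ∃ N : ℕ, ∀ i : ℤ, i ≤ -N → y.1 (i - d) = y.1 i)
    (hy : ∀ t, t ≠ 0 → shift hX t y ≠ y) {m : ℕ} (hm : 1 ≤ m) {d : ℤ} (hd : d ≠ 0)
    (hgy : (g ^ m) y = shift hX d y) :
    ¬ Tendsto (fun n : ℕ => (wordNorm (F : Set (Equiv.Perm X)) (g ^ n) : ℝ) / n) atTop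
      (nhds 0) := by
  intro hlim
  obtain ⟨p, hp, N, hN⟩ := hper
  have hFS : (F : Set (Equiv.Perm X)) ⊆ autSubgroup hX := hF
  have hgS : g ∈ autSubgroup hX := (Subgroup.closure_le _).2 hFS hg
  have hr (f : F) : ∃ R : ℕ, (∀ (x y : X) (p : ℤ), (∀ q, |q - p| ≤ R → x.1 q = y.1 q) →
      (f.1 x).1 p = (f.1 y).1 p) ∧ ∀ (x y : X) (p : ℤ), (∀ q, |q - p| ≤ R → x.1 q = y.1 q) →
      (f.1⁻¹ x).1 p = (f.1⁻¹ y).1 p := by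
    obtain ⟨R1, h1⟩ := exists_radius (hFS f.2)
    obtain ⟨R2, h2⟩ := exists_radius (inv_mem (hFS f.2))
    exact ⟨max R1 R2, fun x y p h => h1 x y p fun q hq => h q (by push_cast; omega),
      fun x y p h => h2 x y p fun q hq => h q (by push_cast; omega)⟩
  choose r hr using hr
  set R := Finset.univ.sup r
  have hR (f) (hf : f ∈ (F : Set (Equiv.Perm X))) : (∀ (x y : X) (p : ℤ),
      (∀ q, |q - p| ≤ R → x.1 q = y.1 q) → (f x).1 p = (f y).1 p) ∧ ∀ (x y : X) (p : ℤ),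
      (∀ q, |q - p| ≤ R → x.1 q = y.1 q) → (f⁻¹ x).1 p = (f⁻¹ y).1 p := by
    have hle : (r ⟨f, hf⟩ : ℤ) ≤ R := by
      exact_mod_cast Finset.le_sup (f := r) (Finset.mem_univ (⟨f, hf⟩ : F))
    exact ⟨fun x y p h => (hr ⟨f, hf⟩).1 x y p fun q hq => h q (hq.trans hle),
      fun x y p h => (hr ⟨f, hf⟩).2 x y p fun q hq => h q (hq.trans hle)⟩
  obtain ⟨N₀, h0, h1⟩ : ∃ N₀, LeftPeriodic p N₀ y.1 ∧ ∀ N, LeftPeriodic p N y.1 → N ≤ N₀ := by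
    have hbdd : ∃ b, ∀ N, LeftPeriodic p N y.1 → N ≤ b := by
      by_contra! hcon
      refine hy p (by omega) (Subtype.ext (funext fun i => ?_))
      obtain ⟨N, h2, h3⟩ := hcon (i + p)
      have := h2 (i + p) h3.le
      rw [shift_apply, ← this, add_sub_cancel_right]
    obtain ⟨N₀, h2, h3⟩ := Int.exists_greatest_of_bdd hbdd ⟨-N, hN⟩
    exact ⟨N₀, h2, h3⟩
  have hshift (N t : ℤ) : LeftPeriodic p N (shift hX t y).1 ↔ LeftPeriodic p (N + t) y.1 := by
    constructor
    · intro h i hi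
      have := h (i - t) (by omega)
      simp only [shift_apply] at this
      ring_nf at this ⊢
      exact this
    · intro h i hi
      have := h (i + t) (by omega)
      simp only [shift_apply]
      rw [← this]
      ring_nf
  have hpow (n : ℕ) : (g ^ (m * n)) y = shift hX (n * d) y := by
    induction n with
    | zero => simp
    | succ n ih =>
      rw [Nat.mul_succ, add_comm, pow_add, Equiv.Perm.mul_apply, ih,
        aut_shift hX (pow_mem hgS m), hgy, shift_shift]
      congr 1
      push_cast
      ring
  have key (n : ℕ) : n * |d| ≤ wordNorm (F : Set (Equiv.Perm X)) (g ^ (m * n)) * R := by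
    obtain ⟨w, hw, hwF, hwg⟩ := exists_wordNorm (F := (F : Set (Equiv.Perm X)))
      (pow_mem hg (m * n))
    have h2 := fun {N} => LeftPeriodic.map_prod hFS hR w hwF (p := p) (N := N) y
    rw [hwg, hw, hpow] at h2
    have h3 := h1 _ ((hshift _ _).1 (h2.1 h0))
    have h4 := h1 _ (h2.2 ((hshift (N₀ - n * d) (n * d)).2 (by simpa using h0)))
    rcases abs_choice d with h | h <;> rw [h]
    · linarith
    · linarith
  have hlim2 := (hlim.comp (tendsto_id.const_mul_atTop' (α := ℕ) (show 0 < m by omega))).const_mul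
    ((R : ℝ) * m)
  rw [mul_zero] at hlim2
  have hle : |(d : ℝ)| ≤ 0 := by
    refine ge_of_tendsto hlim2 ?_
    filter_upwards [eventually_ge_atTop 1] with n hn
    have h2 : (n * |(d : ℝ)|) ≤ wordNorm (F : Set (Equiv.Perm X)) (g ^ (m * n)) * R := by
      exact_mod_cast key n
    have hn' : (0 : ℝ) < n := by exact_mod_cast hn
    have hm' : (0 : ℝ) < m := by exact_mod_cast hm
    simp only [Function.comp_apply, id_eq, Nat.cast_mul]
    field_simp
    linarith
  have := abs_nonpos_iff.1 hle
  exact hd (by exact_mod_cast this)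

end compact

end Sofic

namespace Sofic

variable {A : Type*} [TopologicalSpace A] [DiscreteTopology A] {X : Set (ℤ → A)}
  {hX : IsSubshift X}

/-- The closed subsets of a subshift invariant under the shift and under an automorphism `g`, on
which `g` has infinite order. -/
structure IsWild (hX : IsSubshift X) (g : Equiv.Perm X) (Y : Set X) : Prop where
  isClosed : IsClosed Y
  shift_mem : ∀ t, ∀ y ∈ Y, shift hX t y ∈ Y
  zpow_mem : ∀ j : ℤ, ∀ y ∈ Y, (g ^ j) y ∈ Y
  exists_ne : ∀ k : ℕ, 1 ≤ k → ∃ y ∈ Y, (g ^ k) y ≠ y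

lemma isClopen_setOf_apply_eq {f : Equiv.Perm X} (hf : f ∈ autSubgroup hX) :
    IsClopen {x : X | (f x).1 0 = x.1 0} := by
  have hval : Continuous fun x : X => x.1 0 := (continuous_apply 0).comp continuous_subtype_val
  exact (isClopen_discrete {z : A × A | z.1 = z.2}).preimage ((hval.comp hf.1).prodMk hval)

lemma exists_minimal_isWild [Finite A] {g : Equiv.Perm X} (hg : g ∈ autSubgroup hX)
    (hne : ∀ n : ℕ, 1 ≤ n → g ^ n ≠ 1) : ∃ Y, Minimal (IsWild hX g) Y := by
  have := compactSpace hX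
  refine zorn_superset {Y | IsWild hX g Y} fun c hc hchain => ?_
  rcases c.eq_empty_or_nonempty with rfl | hcne
  · refine ⟨Set.univ, ⟨isClosed_univ, fun _ _ _ => trivial, fun _ _ _ => trivial, fun k hk => ?_⟩,
      by simp⟩
    by_contra! h
    exact hne k hk (Equiv.ext fun y => h y trivial)
  · refine ⟨⋂₀ c, ⟨isClosed_sInter fun Y hY => (hc hY).isClosed,
      fun t y hy Y hY => (hc hY).shift_mem t y (hy Y hY),
      fun j y hy Y hY => (hc hY).zpow_mem j y (hy Y hY), fun k hk => ?_⟩,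
      fun Y hY => Set.sInter_subset_of_mem hY⟩
    by_contra! h
    have : Nonempty c := hcne.to_subtype
    obtain ⟨⟨Y, hY⟩, hYU⟩ := exists_subset_nhds_of_compactSpace (V := fun Y : c => Y.1)
      (U := {x : X | ((g ^ k) x).1 0 = x.1 0})
      (fun Y Z => (hchain.total Y.2 Z.2).elim (fun h => ⟨Y, subset_rfl, h⟩)
        fun h => ⟨Z, h, subset_rfl⟩)
      (fun Y => (hc Y.2).isClosed) (fun x hx => by
        refine (isClopen_setOf_apply_eq (pow_mem hg k)).isOpen.mem_nhds ?_
        rw [← Set.sInter_eq_iInter] at hx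
        simp [h x hx])
    obtain ⟨y, hy, hgy⟩ := (hc hY).exists_ne k hk
    exact hgy (eq_of_forall_shift (pow_mem hg k) fun t => hYU ((hc hY).shift_mem t y hy))

lemma exists_isolated [Finite A] (hX : IsSubshift X) (hc : X.Countable) {Y : Set X}
    (hY : IsClosed Y) (hne : Y.Nonempty) : ∃ x ∈ Y, ∃ U, IsOpen U ∧ U ∩ Y = {x} := by
  have := compactSpace hX
  have : CompactSpace Y := isCompact_iff_compactSpace.1 hY.isCompact
  have : Countable X := hc
  have : Nonempty Y := hne.to_subtype
  obtain ⟨x, hx⟩ := nonempty_interior_of_iUnion_of_closed (X := Y) (f := fun y : Y => {y})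
    (fun _ => isClosed_singleton) (by ext; simp)
  obtain ⟨y, hy⟩ := hx
  obtain ⟨V, hV, hVo, hyV⟩ := mem_interior.1 hy
  obtain ⟨U, hU, rfl⟩ := isOpen_induced_iff.1 hVo
  refine ⟨y, y.2, U, hU, ?_⟩
  have hyx : y = x := by simpa using hV hyV
  ext z
  constructor
  · rintro ⟨h1, h2⟩
    have : (⟨z, h2⟩ : Y) = x := hV h1
    rw [Set.mem_singleton_iff, hyx, ← this]
  · rintro rfl
    exact ⟨hyV, y.2⟩

/-- An automorphism of infinite order of a countable subshift has a power acting as a nontrivial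
shift on some aperiodic point. -/
lemma exists_pow_eq_shift [Finite A] (hc : X.Countable) {g : Equiv.Perm X}
    (hg : g ∈ autSubgroup hX) (hne : ∀ n : ℕ, 1 ≤ n → g ^ n ≠ 1) :
    ∃ y : X, (∀ t, t ≠ 0 → shift hX t y ≠ y) ∧ ∃ m : ℕ, 1 ≤ m ∧ ∃ d : ℤ, d ≠ 0 ∧
      (g ^ m) y = shift hX d y := by
  by_contra! hcon
  have := compactSpace hX
  obtain ⟨Y, hY, hmin⟩ := exists_minimal_isWild hg hne
  obtain ⟨y₀, hy₀, -⟩ := hY.exists_ne 1 le_rfl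
  obtain ⟨x, hxY, U, hU, hUx⟩ := exists_isolated hX hc hY.isClosed ⟨y₀, hy₀⟩
  set V : ℤ × ℤ → Set X := fun i => {y | shift hX i.1 ((g ^ i.2) y) ∈ U} with hV
  have hVo (i) : IsOpen (V i) :=
    hU.preimage ((continuous_shift hX i.1).comp (zpow_mem hg i.2).1)
  have hVx (i) (y) (hy : y ∈ Y) (hyV : y ∈ V i) : shift hX i.1 ((g ^ i.2) y) = x :=
    hUx.subset ⟨hyV, hY.shift_mem _ _ (hY.zpow_mem _ _ hy)⟩
  obtain ⟨k, hk, hkZ⟩ : ∃ k : ℕ, 1 ≤ k ∧ ∀ y ∈ Y, (∀ i, y ∉ V i) → (g ^ k) y = y := by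
    by_contra! h
    have hZ : IsWild hX g (Y ∩ ⋂ i, (V i)ᶜ) := by
      refine ⟨hY.isClosed.inter (isClosed_iInter fun i => (hVo i).isClosed_compl), ?_, ?_, ?_⟩
      · rintro t y ⟨h1, h2⟩
        refine ⟨hY.shift_mem t y h1, Set.mem_iInter.2 fun i hi => ?_⟩
        refine Set.mem_iInter.1 h2 (i.1 + t, i.2) ?_
        simpa [hV, aut_shift hX (zpow_mem hg _), shift_shift] using hi
      · rintro j y ⟨h1, h2⟩
        refine ⟨hY.zpow_mem j y h1, Set.mem_iInter.2 fun i hi => ?_⟩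
        refine Set.mem_iInter.1 h2 (i.1, i.2 + j) ?_
        simpa [hV, zpow_add] using hi
      · intro k hk
        obtain ⟨y, h1, h2, h3⟩ := h k hk
        exact ⟨y, ⟨h1, by simpa using h2⟩, h3⟩
    have hx := (hmin hZ Set.inter_subset_left hxY).2
    refine Set.mem_iInter.1 hx (0, 0) ?_
    have : x ∈ U ∩ Y := hUx ▸ rfl
    simpa [hV] using this.1
  set D : Set X := Y ∩ {y | ((g ^ k) y).1 0 = y.1 0}ᶜ with hD
  have hDfin : D.Finite := by
    have hDc : IsCompact D := (hY.isClosed.inter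
      (isClopen_setOf_apply_eq (pow_mem hg k)).compl.isClosed).isCompact
    obtain ⟨s, hs⟩ := hDc.elim_finite_subcover V hVo (fun y hy => by
      by_contra h
      refine hy.2 ?_
      have := hkZ y hy.1 (by simpa using h)
      simp [this])
    refine (s.finite_toSet.biUnion (t := fun i => D ∩ V i) fun i _ =>
      Set.Subsingleton.finite ?_).subset fun y hy => ?_
    · intro y hy z hz
      exact (g ^ i.2).injective (shift_injective hX i.1
        ((hVx i y hy.1.1 hy.2).trans (hVx i z hz.1.1 hz.2).symm))
    · obtain ⟨i, hi, hyi⟩ := Set.mem_iUnion₂.1 (hs hy)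
      exact Set.mem_iUnion₂.2 ⟨i, hi, hy, hyi⟩
  have hshiftD (y) (hy : y ∈ Y) (hgy : (g ^ k) y ≠ y) : ∃ t, shift hX t y ∈ D := by
    by_contra! h
    refine hgy (eq_of_forall_shift (pow_mem hg k) fun t => ?_)
    by_contra h'
    exact h t ⟨hY.shift_mem t y hy, h'⟩
  have hfix (y) (hy : y ∈ D) : ∃ m : ℕ, 1 ≤ m ∧ (g ^ m) y = y := by
    have hy2 (j : ℕ) : (g ^ k) ((g ^ (k * j)) y) ≠ (g ^ (k * j)) y := by
      rw [← Equiv.Perm.mul_apply, ← pow_add, add_comm, pow_add, Equiv.Perm.mul_apply]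
      intro h
      exact hy.2 (by simp [(g ^ (k * j)).injective h])
    have hyj (j : ℕ) : (g ^ (k * j)) y ∈ Y := by
      rw [← zpow_natCast]
      exact hY.zpow_mem _ y hy.1
    choose t ht using fun j => hshiftD _ (hyj j) (hy2 j)
    obtain ⟨j, -, j', -, hjj, h⟩ :=
      Set.infinite_univ.exists_lt_map_eq_of_mapsTo (fun j _ => ht j) hDfin
    obtain ⟨l, rfl⟩ : ∃ l, j' = j + l := ⟨j' - j, by omega⟩
    have h1 : (g ^ (k * l)) y = shift hX (t j - t (j + l)) y := by
      refine (g ^ (k * j)).injective (shift_injective hX (t (j + l)) ?_)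
      rw [aut_shift hX (pow_mem hg _), shift_shift, add_sub_cancel, h, mul_add, pow_add,
        Equiv.Perm.mul_apply]
    have hkl : 1 ≤ k * l := Nat.mul_pos hk (by omega)
    by_cases hd : t j - t (j + l) = 0
    · exact ⟨k * l, hkl, by rw [h1, hd, shift_zero]⟩
    · obtain ⟨e, he, hey⟩ : ∃ e, e ≠ 0 ∧ shift hX e y = y := by
        by_contra! h'
        exact hcon y h' _ hkl _ hd h1
      have h2 (n : ℕ) : (g ^ (k * l * n)) y = shift hX ((t j - t (j + l)) * n) y := by
        induction n with
        | zero => simp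
        | succ n ih =>
          rw [Nat.mul_succ, pow_add, Equiv.Perm.mul_apply, h1, aut_shift hX (pow_mem hg _), ih,
            shift_shift]
          congr 1
          push_cast
          ring
      have h3 (n : ℕ) : shift hX (e * n) y = y := by
        induction n with
        | zero => simp
        | succ n ih =>
          rw [Nat.cast_succ, mul_add, mul_one, ← shift_shift, hey, ih]
      have h4 (n : ℤ) : shift hX (e * n) y = y := by
        rcases Int.eq_nat_or_neg n with ⟨n, rfl | rfl⟩
        · exact h3 n
        · refine shift_injective hX (e * n) ?_
          rw [shift_shift, h3]
          simp
      refine ⟨k * l * e.natAbs, Nat.mul_pos hkl (Int.natAbs_pos.2 he), ?_⟩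
      obtain ⟨n, hn⟩ : e ∣ (t j - t (j + l)) * e.natAbs := (Int.dvd_natAbs.2 dvd_rfl).mul_left _
      rw [h2, hn, h4]
  choose! m hm hmy using hfix
  set M := ∏ y ∈ hDfin.toFinset, m y with hM
  have hMpos : 1 ≤ M := Nat.succ_le_of_lt (Finset.prod_pos fun y hy => hm y (by simpa using hy))
  obtain ⟨y, hy, hgy⟩ := hY.exists_ne (k * M) (Nat.mul_pos hk hMpos)
  by_cases h : (g ^ k) y = y
  · refine hgy ?_
    rw [pow_mul]
    exact Function.IsFixedPt.perm_pow h M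
  · obtain ⟨t, ht⟩ := hshiftD y hy h
    refine hgy (shift_injective hX t ?_)
    obtain ⟨r, hr⟩ : m (shift hX t y) ∣ k * M :=
      (Finset.dvd_prod_of_mem m (by simpa using ht)).mul_left k
    rw [← aut_shift hX (pow_mem hg _), hr, pow_mul]
    exact Function.IsFixedPt.perm_pow (hmy _ ht) r

/-- The automorphism group of a countable sofic shift has no distortion elements. -/
lemma not_isDistortionElement [Finite A] (hX : IsSubshift X)
    (hreg : (subshiftLanguage X).IsRegular) (hc : X.Countable) (g : Equiv.Perm X) :
    ¬ IsDistortionElement (SubshiftAut X) g := by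
  rintro ⟨hg, hne, F, hF, hgF, hlim⟩
  obtain ⟨y, hy, m, hm, d, hd, hgy⟩ := exists_pow_eq_shift (hX := hX) hc hg hne
  exact not_tendsto_wordNorm hF hgF
    (eventually_periodic_left hreg (fun a b hab => hab.not_countable hX hc) y.2) hy hm hd hgy hlim

end Sofic

namespace Sofic

variable {A C : Type*}

/-- A marker word and a family of data words of the same length, given by functions of which only
the initial values matter. -/
structure Code (A C : Type*) where
  lenM : ℕ
  lenD : ℕ
  marker : ℤ → A
  data : C → ℤ → A

namespace Code

variable (κ : Code A C)

/-- The length of a marker followed by a data word. -/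
def len : ℕ := κ.lenM + κ.lenD

/-- The data word of `c` occurs in `x` between two markers, the first of which is at `p`. -/
structure Occ (x : ℤ → A) (p : ℤ) (c : C) : Prop where
  left : ∀ k : ℤ, 0 ≤ k → k < κ.lenM → x (p + k) = κ.marker k
  mid : ∀ k : ℤ, 0 ≤ k → k < κ.lenD → x (p + κ.lenM + k) = κ.data c k
  right : ∀ k : ℤ, 0 ≤ k → k < κ.lenM → x (p + κ.len + k) = κ.marker k

/-- The properties of a code ensuring that data words can be read and exchanged. -/
structure IsGood (L : Language A) : Prop where
  injective : ∀ c c', (∀ k : ℤ, 0 ≤ k → k < κ.lenD → κ.data c k = κ.data c' k) → c = c'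
  ctxEq : ∀ c c', CtxEq L (word (κ.data c) 0 κ.lenD) (word (κ.data c') 0 κ.lenD)
  synchronizing : ∀ x p c p', κ.Occ x p c → p < p' → p' < p + κ.len →
    ¬ ∀ k : ℤ, 0 ≤ k → k < κ.lenM → x (p' + k) = κ.marker k

open Classical in
/-- The datum read at position `p`. -/
noncomputable def content (x : ℤ → A) (p : ℤ) : Option C :=
  if h : ∃ c, κ.Occ x p c then some h.choose else none

/-- The data read at multiples of the length, relative to position `p`. -/
noncomputable def view (x : ℤ → A) (p : ℤ) : ℤ → Option C := fun k => κ.content x (p + k * κ.len)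

/-- The data regions determined by `r` are disjoint. -/
def Separated (r : ℤ → Option C) : Prop :=
  ∀ p q, r p ≠ none → r q ≠ none → p < q → p + κ.len ≤ q

/-- The position `i` belongs to the data word `c` at `p`. -/
def InData (r : ℤ → Option C) (i p : ℤ) (c : C) : Prop :=
  r p = some c ∧ p + κ.lenM ≤ i ∧ i < p + κ.len

open Classical in
/-- Overwrite the data words of `x` according to `r`. -/
noncomputable def overwrite (x : ℤ → A) (r : ℤ → Option C) (i : ℤ) : A :=
  if h : ∃ pc : ℤ × C, κ.InData r i pc.1 pc.2 then
    κ.data h.choose.2 (i - h.choose.1 - κ.lenM) else x i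

variable {κ} {x : ℤ → A} {r : ℤ → Option C} {i p : ℤ} {c : C}

lemma overwrite_of_inData (hr : κ.Separated r) (h : κ.InData r i p c) :
    κ.overwrite x r i = κ.data c (i - p - κ.lenM) := by
  have hex : ∃ pc : ℤ × C, κ.InData r i pc.1 pc.2 := ⟨(p, c), h⟩
  rw [overwrite, dif_pos hex]
  have h' := hex.choose_spec
  set pc := hex.choose
  have hp : pc.1 = p := by
    have h1 := hr p pc.1 (by simp [h.1]) (by simp [h'.1])
    have h2 := hr pc.1 p (by simp [h'.1]) (by simp [h.1])
    have h3 := h.2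
    have h4 := h'.2
    by_contra hne
    rcases lt_or_gt_of_ne hne with hlt | hlt
    · have := h2 hlt
      omega
    · have := h1 hlt
      omega
  have hc : pc.2 = c := by
    have := h'.1
    rw [hp, h.1] at this
    exact (Option.some_injective _ this).symm
  rw [hp, hc]

lemma overwrite_of_not_inData (h : ∀ p c, ¬ κ.InData r i p c) : κ.overwrite x r i = x i :=
  dif_neg fun ⟨_, hpc⟩ => h _ _ hpc

lemma content_shift (x : ℤ → A) (t p : ℤ) :
    κ.content (fun i => x (i + t)) p = κ.content x (p + t) := by
  have : κ.Occ (fun i => x (i + t)) p = κ.Occ x (p + t) := by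
    funext c
    refine propext ⟨fun h => ⟨fun k h1 h2 => ?_, fun k h1 h2 => ?_, fun k h1 h2 => ?_⟩,
      fun h => ⟨fun k h1 h2 => ?_, fun k h1 h2 => ?_, fun k h1 h2 => ?_⟩⟩
    · rw [← h.left k h1 h2, add_right_comm]
    · rw [← h.mid k h1 h2, add_right_comm p t, add_right_comm]
    · rw [← h.right k h1 h2, add_right_comm p t, add_right_comm]
    · rw [← h.left k h1 h2, add_right_comm]
    · rw [← h.mid k h1 h2, add_right_comm p t, add_right_comm]
    · rw [← h.right k h1 h2, add_right_comm p t, add_right_comm]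
  unfold content
  rw [this]

lemma content_congr {y : ℤ → A} (h : ∀ i, p ≤ i → i < p + κ.len + κ.lenM → x i = y i) :
    κ.content x p = κ.content y p := by
  have key (x y : ℤ → A) (h : ∀ i, p ≤ i → i < p + κ.len + κ.lenM → x i = y i) (c : C)
      (hc : κ.Occ x p c) : κ.Occ y p c := by
    have hlen : κ.len = κ.lenM + κ.lenD := rfl
    refine ⟨fun k h1 h2 => ?_, fun k h1 h2 => ?_, fun k h1 h2 => ?_⟩
    · rw [← hc.left k h1 h2, h _ (by omega) (by omega)]
    · rw [← hc.mid k h1 h2, h _ (by omega) (by omega)]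
    · rw [← hc.right k h1 h2, h _ (by omega) (by omega)]
  have : κ.Occ x p = κ.Occ y p := funext fun c =>
    propext ⟨key x y h c, key y x (fun i h1 h2 => (h i h1 h2).symm) c⟩
  unfold content
  rw [this]

lemma overwrite_shift (hr : κ.Separated r) (t : ℤ) :
    κ.overwrite (fun i => x (i + t)) (fun p => r (p + t)) i = κ.overwrite x r (i + t) := by
  have hr' : κ.Separated fun p => r (p + t) := fun p p' h h' hlt => by
    have := hr _ _ h h' (by omega)
    omega
  by_cases h : ∃ p c, κ.InData r (i + t) p c
  · obtain ⟨p, c, h1, h2, h3⟩ := h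
    rw [overwrite_of_inData hr ⟨h1, h2, h3⟩, overwrite_of_inData (p := p - t) (c := c) hr'
      ⟨by simpa using h1, by omega, by omega⟩]
    congr 1
    ring
  · push Not at h
    rw [overwrite_of_not_inData h, overwrite_of_not_inData]
    rintro p c ⟨h1, h2, h3⟩
    exact h (p + t) c ⟨h1, by omega, by omega⟩

lemma overwrite_congr {y : ℤ → A} {s : ℤ → Option C} (hr : κ.Separated r) (hs : κ.Separated s)
    (hxy : x i = y i) (hrs : ∀ p, i - κ.len < p → p ≤ i → r p = s p) :
    κ.overwrite x r i = κ.overwrite y s i := by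
  by_cases h : ∃ p c, κ.InData r i p c
  · obtain ⟨p, c, h1, h2, h3⟩ := h
    rw [overwrite_of_inData hr ⟨h1, h2, h3⟩, overwrite_of_inData (p := p) (c := c) hs
      ⟨by rw [← hrs p (by omega) (by omega), h1], h2, h3⟩]
  · push Not at h
    rw [overwrite_of_not_inData h, overwrite_of_not_inData, hxy]
    rintro p c ⟨h1, h2, h3⟩
    exact h p c ⟨by rw [hrs p (by omega) (by omega), h1], h2, h3⟩

namespace IsGood

variable {L : Language A}

lemma content_eq_some (h : κ.IsGood L) : κ.content x p = some c ↔ κ.Occ x p c := by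
  unfold content
  constructor
  · intro hc
    split_ifs at hc with hex
    exact Option.some_injective _ hc ▸ hex.choose_spec
  · intro hc
    have hex : ∃ c, κ.Occ x p c := ⟨c, hc⟩
    rw [dif_pos hex, Option.some.injEq]
    refine h.injective _ _ fun k h1 h2 => ?_
    rw [← hc.mid k h1 h2, ← hex.choose_spec.mid k h1 h2]

lemma separated_content (h : κ.IsGood L) (x : ℤ → A) : κ.Separated (κ.content x) := by
  intro p p' hp hp' hlt
  obtain ⟨c, hc⟩ := Option.ne_none_iff_exists'.1 hp
  obtain ⟨c', hc'⟩ := Option.ne_none_iff_exists'.1 hp'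
  rw [h.content_eq_some] at hc hc'
  by_contra hcon
  exact h.synchronizing x p c p' hc hlt (by omega) hc'.left

lemma separated_of_iff (h : κ.IsGood L) (hr : ∀ p, r p = none ↔ κ.content x p = none) :
    κ.Separated r :=
  fun p p' hp hp' => h.separated_content x p p' (by rwa [Ne, ← hr]) (by rwa [Ne, ← hr])

lemma content_overwrite (h : κ.IsGood L) (hr : ∀ p, r p = none ↔ κ.content x p = none) :
    κ.content (κ.overwrite x r) = r := by
  have hsep := h.separated_of_iff hr
  have hlen : (κ.len : ℤ) = κ.lenM + κ.lenD := by simp [len]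
  have hsome (p c) (hpc : r p = some c) : κ.content (κ.overwrite x r) p = some c := by
    obtain ⟨c', hc'⟩ : ∃ c', κ.content x p = some c' := by
      rw [← Option.ne_none_iff_exists', Ne, ← hr, hpc]
      simp
    rw [h.content_eq_some] at hc' ⊢
    refine ⟨fun k h1 h2 => ?_, fun k h1 h2 => ?_, fun k h1 h2 => ?_⟩
    · rw [overwrite_of_not_inData, hc'.left k h1 h2]
      rintro p' c ⟨h3, h4, h5⟩
      have := hsep p' p (by simp [h3]) (by simp [hpc]) (by omega)
      omega
    · rw [overwrite_of_inData hsep (p := p) (c := c) ⟨hpc, by omega, by omega⟩]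
      congr 1
      ring
    · rw [overwrite_of_not_inData, hc'.right k h1 h2]
      rintro p' c ⟨h3, h4, h5⟩
      rcases lt_or_ge p p' with hlt | hle
      · have := hsep p p' (by simp [hpc]) (by simp [h3]) hlt
        omega
      · omega
  funext p
  rcases hp : r p with _ | c
  · by_contra hne
    obtain ⟨c, hc⟩ := Option.ne_none_iff_exists'.1 hne
    rw [hr] at hp
    refine Option.ne_none_iff_exists'.2 ⟨c, ?_⟩ hp
    rw [← hc]
    refine content_congr fun i h1 h2 => (overwrite_of_not_inData ?_).symm
    rintro p' c' ⟨h3, h4, h5⟩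
    have h6 : p' ≠ p := by
      rintro rfl
      rw [← hr, h3] at hp
      simp at hp
    have hs := h.separated_content (κ.overwrite x r)
    rcases lt_or_gt_of_ne h6 with hlt | hlt
    · have := hs p' p (by simp [hsome _ _ h3]) hne hlt
      omega
    · have := hs p p' hne (by simp [hsome _ _ h3]) hlt
      omega
  · exact hsome p c hp

lemma overwrite_content (h : κ.IsGood L) (x : ℤ → A) : κ.overwrite x (κ.content x) = x := by
  funext i
  by_cases hi : ∃ p c, κ.InData (κ.content x) i p c
  · obtain ⟨p, c, h1, h2, h3⟩ := hi
    rw [overwrite_of_inData (h.separated_content x) ⟨h1, h2, h3⟩]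
    rw [h.content_eq_some] at h1
    have hlen : (κ.len : ℤ) = κ.lenM + κ.lenD := by simp [len]
    rw [← h1.mid _ (by omega) (by omega)]
    congr 1
    ring
  · push Not at hi
    exact overwrite_of_not_inData hi

lemma overwrite_overwrite (h : κ.IsGood L) {s : ℤ → Option C}
    (hr : ∀ p, r p = none ↔ κ.content x p = none)
    (hs : ∀ p, s p = none ↔ r p = none) :
    κ.overwrite (κ.overwrite x r) s = κ.overwrite x s := by
  have hsep := h.separated_of_iff hr
  have hsep' := h.separated_of_iff fun p => (hs p).trans (hr p)
  funext i
  by_cases hi : ∃ p c, κ.InData s i p c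
  · obtain ⟨p, c, hpc⟩ := hi
    rw [overwrite_of_inData hsep' hpc, overwrite_of_inData hsep' hpc]
  · push Not at hi
    rw [overwrite_of_not_inData hi, overwrite_of_not_inData hi, overwrite_of_not_inData]
    rintro p c ⟨h1, h2⟩
    obtain ⟨c', hc'⟩ : ∃ c', s p = some c' := by
      rw [← Option.ne_none_iff_exists', Ne, hs, h1]
      simp
    exact hi p c' ⟨hc', h2⟩

end IsGood

end Code

section replace

variable [TopologicalSpace A] [DiscreteTopology A] {X : Set (ℤ → A)}

lemma mem_of_ctxEq (hX : IsSubshift X) {x y : ℤ → A} (hx : x ∈ X) {p : ℤ} {q : ℕ}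
    (hxy : CtxEq (subshiftLanguage X) (word x p q) (word y p q))
    (heq : ∀ i, i < p ∨ p + q ≤ i → x i = y i) : y ∈ X := by
  refine mem_of_word_mem hX fun n => ?_
  set i : ℤ := min (-n) p with hi
  set k : ℕ := (p - i).toNat with hk
  set l : ℕ := (n + 1 - (p + q)).toNat
  have e (x : ℤ → A) : word x i (k + q + l) = word x i k ++ word x p q ++ word x (p + q) l := by
    rw [word_add, word_add]
    have : i + (k : ℤ) = p := by omega
    have h2 : i + ((k + q : ℕ) : ℤ) = p + q := by omega
    rw [this, h2]
  have h1 := word_mem_language hx i (k + q + l)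
  rw [e, hxy] at h1
  have e1 : word x i k = word y i k :=
    word_eq_word_iff.2 fun j hj => heq _ (by omega)
  have e2 : word x (p + q) l = word y (p + q) l :=
    word_eq_word_iff.2 fun j hj => heq _ (by omega)
  rw [e1, e2, ← e] at h1
  exact word_mem_language_of_le h1 (by omega) (by omega)

lemma Code.IsGood.overwrite_mem {κ : Code A C} (h : κ.IsGood (subshiftLanguage X))
    (hX : IsSubshift X) {x : ℤ → A} (hx : x ∈ X) {r : ℤ → Option C}
    (hr : ∀ p, r p = none ↔ κ.content x p = none) : κ.overwrite x r ∈ X := by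
  have hlen : (κ.len : ℤ) = κ.lenM + κ.lenD := by simp [Code.len]
  have hpw (S : Finset ℤ) (p : ℤ) :
      S.piecewise r (κ.content x) p = none ↔ κ.content x p = none := by
    by_cases hp : p ∈ S <;> simp [hp, hr]
  have hfin (S : Finset ℤ) : κ.overwrite x (S.piecewise r (κ.content x)) ∈ X := by
    induction S using Finset.induction_on with
    | empty => simpa [h.overwrite_content] using hx
    | insert p S hp ih =>
      have hsep := h.separated_of_iff (hpw S)
      have hsep' := h.separated_of_iff (hpw (insert p S))
      have hne (p') (hp' : p' ≠ p) : (insert p S).piecewise r (κ.content x) p' =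
          S.piecewise r (κ.content x) p' := by
        simp [Finset.piecewise, hp']
      rcases hrp : r p with _ | c
      · convert ih using 2
        funext p'
        by_cases hp' : p' = p
        · subst hp'
          simp [hp, hrp, ((hr _).1 hrp)]
        · exact hne _ hp'
      · obtain ⟨c', hc'⟩ : ∃ c', κ.content x p = some c' := by
          rw [← Option.ne_none_iff_exists', Ne, ← hr, hrp]
          simp
        refine mem_of_ctxEq hX ih (p := p + κ.lenM) (q := κ.lenD) ?_ fun i hi => ?_
        · convert h.ctxEq c' c using 1
          · refine word_eq_word_iff.2 fun k hk => ?_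
            rw [Code.overwrite_of_inData hsep (p := p) (c := c')
              ⟨by simp [hp, hc'], by omega, by omega⟩]
            congr 1
            ring
          · refine word_eq_word_iff.2 fun k hk => ?_
            rw [Code.overwrite_of_inData hsep' (p := p) (c := c)
              ⟨by simp [hrp], by omega, by omega⟩]
            congr 1
            ring
        · by_cases hex : ∃ p' c, κ.InData (S.piecewise r (κ.content x)) i p' c
          · obtain ⟨p', c, h1, h2, h3⟩ := hex
            have hp' : p' ≠ p := by
              rintro rfl
              omega
            rw [Code.overwrite_of_inData hsep ⟨h1, h2, h3⟩,
              Code.overwrite_of_inData hsep' ⟨by rw [hne p' hp', h1], h2, h3⟩]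
          · push Not at hex
            rw [Code.overwrite_of_not_inData hex, Code.overwrite_of_not_inData]
            rintro p' c ⟨h1, h2, h3⟩
            have hp' : p' ≠ p := by
              rintro rfl
              omega
            exact hex p' c ⟨by rw [← hne p' hp', h1], h2, h3⟩
  refine mem_of_word_mem hX fun n => ?_
  convert word_mem_language (hfin (Finset.Icc (-n - κ.len) n)) (-n) (2 * n + 1) using 1
  refine word_eq_word_iff.2 fun k hk => ?_
  refine Code.overwrite_congr (h.separated_of_iff hr) (h.separated_of_iff (hpw _)) rfl
    fun p h1 h2 => ?_
  rw [Finset.piecewise_eq_of_mem]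
  rw [Finset.mem_Icc]
  omega

end replace

end Sofic

namespace Sofic

variable {A C Γ : Type*} [Group Γ]

/-- An action by reversible cellular automata fixing the set of empty cells. -/
structure IsCellular (θ : Γ →* Equiv.Perm (ℤ → Option C)) : Prop where
  eq_none_iff : ∀ u x p, θ u x p = none ↔ x p = none
  shift : ∀ u x t p, θ u (fun i => x (i + t)) p = θ u x (p + t)
  exists_local : ∀ u, ∃ R : ℕ, ∀ x y p, (∀ q : ℤ, |q - p| ≤ (R : ℤ) → x q = y q) → θ u x p = θ u y p

namespace Code

/-- Apply a map to the data of `x`. -/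
noncomputable def lift (κ : Code A C) (G : (ℤ → Option C) → ℤ → Option C) (x : ℤ → A) : ℤ → A :=
  κ.overwrite x fun p => G (κ.view x p) 0

variable {κ : Code A C} {θ : Γ →* Equiv.Perm (ℤ → Option C)}

lemma view_zero (x : ℤ → A) (p : ℤ) : κ.view x p 0 = κ.content x p := by simp [view]

lemma lift_data_eq_none_iff (hθ : IsCellular θ) (u : Γ) (x : ℤ → A) (p : ℤ) :
    θ u (κ.view x p) 0 = none ↔ κ.content x p = none := by
  rw [hθ.eq_none_iff, view_zero]

lemma view_shift (x : ℤ → A) (t p : ℤ) : κ.view (fun i => x (i + t)) p = κ.view x (p + t) := by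
  funext k
  rw [view, view, content_shift, add_right_comm]

namespace IsGood

variable {L : Language A}

lemma content_lift (h : κ.IsGood L) (hθ : IsCellular θ) (u : Γ) (x : ℤ → A) (p : ℤ) :
    κ.content (κ.lift (θ u) x) p = θ u (κ.view x p) 0 := by
  rw [lift, h.content_overwrite (lift_data_eq_none_iff hθ u x)]

lemma view_lift (h : κ.IsGood L) (hθ : IsCellular θ) (u : Γ) (x : ℤ → A) (p : ℤ) :
    κ.view (κ.lift (θ u) x) p = θ u (κ.view x p) := by
  funext k
  rw [view, h.content_lift hθ]
  have h1 : κ.view x (p + k * κ.len) = fun i => κ.view x p (i + k) := by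
    funext i
    rw [view, view]
    congr 1
    ring
  rw [h1, hθ.shift, zero_add]

lemma lift_mul (h : κ.IsGood L) (hθ : IsCellular θ) (u v : Γ) (x : ℤ → A) :
    κ.lift (θ (u * v)) x = κ.lift (θ u) (κ.lift (θ v) x) := by
  conv_rhs => rw [lift]
  simp only [h.view_lift hθ]
  rw [map_mul]
  exact (h.overwrite_overwrite (s := fun p => θ u (θ v (κ.view x p)) 0)
    (lift_data_eq_none_iff hθ v x) fun p => hθ.eq_none_iff _ _ _).symm

lemma lift_one (h : κ.IsGood L) (x : ℤ → A) : κ.lift (θ 1) x = x := by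
  rw [lift, map_one]
  simp only [Equiv.Perm.one_apply, view_zero]
  exact h.overwrite_content x

lemma lift_shift (h : κ.IsGood L) (hθ : IsCellular θ) (u : Γ) (x : ℤ → A) (t i : ℤ) :
    κ.lift (θ u) (fun i => x (i + t)) i = κ.lift (θ u) x (i + t) := by
  rw [lift, lift,
    ← overwrite_shift (h.separated_of_iff (lift_data_eq_none_iff hθ u x))]
  simp only [view_shift]

lemma lift_local (h : κ.IsGood L) (hθ : IsCellular θ) (u : Γ) (i : ℤ) :
    ∃ R : ℕ, ∀ x y : ℤ → A, (∀ q : ℤ, |q - i| ≤ (R : ℤ) → x q = y q) →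
      κ.lift (θ u) x i = κ.lift (θ u) y i := by
  obtain ⟨R, hR⟩ := hθ.exists_local u
  refine ⟨R * κ.len + 3 * κ.len, fun x y hxy => ?_⟩
  refine overwrite_congr (h.separated_of_iff (lift_data_eq_none_iff hθ u x))
    (h.separated_of_iff (lift_data_eq_none_iff hθ u y)) (hxy i (by simp; positivity))
    fun p h1 h2 => ?_
  refine hR _ _ _ fun k hk => content_congr fun j h3 h4 => hxy j ?_
  rw [sub_zero, abs_le] at hk
  have hl : κ.lenM ≤ κ.len := Nat.le_add_right _ _
  have h5 : k * κ.len ≤ R * κ.len := mul_le_mul_of_nonneg_right hk.2 (by positivity)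
  have h6 : -R * κ.len ≤ k * κ.len := mul_le_mul_of_nonneg_right hk.1 (by positivity)
  rw [abs_le]
  push_cast
  constructor <;> linarith

variable [TopologicalSpace A] [DiscreteTopology A] {X : Set (ℤ → A)}

lemma continuous_of_local {f : X → X} (hf : ∀ i : ℤ, ∃ R : ℕ, ∀ x y : X,
    (∀ q : ℤ, |q - i| ≤ (R : ℤ) → x.1 q = y.1 q) → (f x).1 i = (f y).1 i) : Continuous f := by
  refine continuous_induced_rng.2 (continuous_pi fun i => ?_)
  obtain ⟨R, hR⟩ := hf i
  refine IsLocallyConstant.continuous ((IsLocallyConstant.iff_exists_open _).2 fun x => ?_)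
  refine ⟨⋂ q ∈ Finset.Icc (i - R) (i + R), {y : X | y.1 q = x.1 q}, ?_, ?_, fun y hy => ?_⟩
  · refine isOpen_biInter_finset fun q _ => ?_
    have hc : Continuous fun y : X => y.1 q := (continuous_apply q).comp continuous_subtype_val
    exact (isOpen_discrete {x.1 q}).preimage hc
  · simp
  · refine hR y x fun q hq => ?_
    rw [abs_le] at hq
    exact Set.mem_iInter₂.1 hy q (Finset.mem_Icc.2 ⟨by omega, by omega⟩)

lemma lift_mem (h : κ.IsGood (subshiftLanguage X)) (hX : IsSubshift X) (hθ : IsCellular θ) (u : Γ)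
    {x : ℤ → A} (hx : x ∈ X) : κ.lift (θ u) x ∈ X :=
  h.overwrite_mem hX hx (lift_data_eq_none_iff hθ u x)

/-- A cellular action on the data of a subshift. -/
noncomputable def liftHom (h : κ.IsGood (subshiftLanguage X)) (hX : IsSubshift X)
    (hθ : IsCellular θ) : Γ →* Equiv.Perm X where
  toFun u :=
    { toFun := fun x => ⟨κ.lift (θ u) x, h.lift_mem hX hθ u x.2⟩
      invFun := fun x => ⟨κ.lift (θ u⁻¹) x, h.lift_mem hX hθ u⁻¹ x.2⟩
      left_inv := fun x => Subtype.ext (by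
        simp only
        rw [← h.lift_mul hθ, inv_mul_cancel, h.lift_one])
      right_inv := fun x => Subtype.ext (by
        simp only
        rw [← h.lift_mul hθ, mul_inv_cancel, h.lift_one]) }
  map_one' := Equiv.ext fun x => Subtype.ext (h.lift_one x.1)
  map_mul' u v := Equiv.ext fun x => Subtype.ext (h.lift_mul hθ u v x.1)

lemma liftHom_apply (h : κ.IsGood (subshiftLanguage X)) (hX : IsSubshift X)
    (hθ : IsCellular θ) (u : Γ) (x : X) : (h.liftHom hX hθ u x).1 = κ.lift (θ u) x := rfl

lemma liftHom_mem (h : κ.IsGood (subshiftLanguage X)) (hX : IsSubshift X)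
    (hθ : IsCellular θ) (u : Γ) : h.liftHom hX hθ u ∈ SubshiftAut X := by
  have hc (u : Γ) : Continuous (h.liftHom hX hθ u) := continuous_of_local fun i =>
    let ⟨R, hR⟩ := h.lift_local hθ u i
    ⟨R, fun x y hxy => hR x.1 y.1 hxy⟩
  refine ⟨hc u, ?_, fun x y hxy => ?_⟩
  · have := hc u⁻¹
    rw [map_inv] at this
    exact this
  · rw [liftHom_apply, liftHom_apply, hxy]
    exact funext fun i => h.lift_shift hθ u x.1 1 i

lemma liftHom_eq_of_eq (h : κ.IsGood (subshiftLanguage X)) (hX : IsSubshift X)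
    (hθ : IsCellular θ) {u v : Γ} (huv : θ u = θ v) : h.liftHom hX hθ u = h.liftHom hX hθ v :=
  Equiv.ext fun x => Subtype.ext (by rw [liftHom_apply, liftHom_apply, huv])

lemma liftHom_ne_one (h : κ.IsGood (subshiftLanguage X)) (hX : IsSubshift X)
    (hθ : IsCellular θ) {u : Γ} {v : ℤ → Option C} (hv : θ u v ≠ v) {x : ℤ → A} (hx : x ∈ X)
    (hxv : κ.view x 0 = v) : h.liftHom hX hθ u ≠ 1 := by
  intro h1
  have h2 := congrArg Subtype.val (DFunLike.congr_fun h1 ⟨x, hx⟩)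
  rw [liftHom_apply] at h2
  refine hv ?_
  rw [← hxv, ← h.view_lift hθ, h2]
  rfl

end IsGood

end Code

end Sofic

namespace Sofic

variable {A C : Type*}

/-- The concatenation of the blocks `bl t` of length `c` according to `z`. -/
def conc (c : ℕ) (bl : Bool → ℤ → A) (z : ℤ → Bool) (i : ℤ) : A := bl (z (i / c)) (i % c)

section conc

variable {c : ℕ} {bl : Bool → ℤ → A} {z z' : ℤ → Bool}

lemma conc_mul_add (hc : 0 < c) (k i : ℤ) :
    conc c bl z (k * c + i) = bl (z (k + i / c)) (i % c) := by
  have hc' : (c : ℤ) ≠ 0 := by omega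
  rw [conc, add_comm (k * (c : ℤ)), Int.add_mul_ediv_right _ _ hc', Int.add_mul_emod_self_right,
    add_comm k]

lemma conc_congr (hc : 0 < c) {n k k' i : ℤ} (h : ∀ j, 0 ≤ j → j < n → z (k + j) = z' (k' + j))
    (hi : 0 ≤ i) (hin : i < n * c) : conc c bl z (k * c + i) = conc c bl z' (k' * c + i) := by
  rw [conc_mul_add hc, conc_mul_add hc, h _ (Int.ediv_nonneg hi (by omega))
    (Int.ediv_lt_of_lt_mul (by omega) hin)]

lemma eq_of_conc_eq {j₀ : ℤ} (hj₀ : 0 ≤ j₀) (hj₀c : j₀ < c) (hne : bl true j₀ ≠ bl false j₀)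
    {k k' : ℤ} (h : ∀ j : ℤ, 0 ≤ j → j < c → conc c bl z (k * c + j) = conc c bl z' (k' * c + j)) :
    z k = z' k' := by
  have h1 := h j₀ hj₀ hj₀c
  have hc : 0 < c := by omega
  rw [conc_mul_add hc, conc_mul_add hc, Int.ediv_eq_zero_of_lt hj₀ hj₀c,
    Int.emod_eq_of_lt hj₀ hj₀c, add_zero, add_zero] at h1
  generalize z k = s at *
  generalize z' k' = s' at *
  cases s <;> cases s' <;> simp_all

lemma word_conc (hc : 0 < c) (k : ℤ) : word (conc c bl z) (k * c) c = word (bl (z k)) 0 c := by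
  rw [word_eq_word_iff]
  intro j hj
  rw [conc_mul_add hc, Int.ediv_eq_zero_of_lt (by omega) (by omega),
    Int.emod_eq_of_lt (by omega) (by omega), add_zero, zero_add]

end conc

/-- The blocks of the marker: an alternating sequence with a single defect. -/
def markerBlock (K : ℕ) (k : ℤ) : Bool := decide (k % 2 = 1 ∧ k ≠ 2 * K + 1)

/-- The blocks of the data words. -/
def dataBlock (e : ℕ) (k : ℤ) : Bool := decide (k = 6 + e)

section marker

variable {c K : ℕ} {bl : Bool → ℤ → A} {j₀ : ℤ}

lemma marker_not_periodic (hj₀ : 0 ≤ j₀) (hj₀c : j₀ < c) (hne : bl true j₀ ≠ bl false j₀) {s : ℤ}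
    (hs : 0 < s) (hsK : s ≤ K)
    (h : ∀ k, 0 ≤ k → k + s < (4 * K + 2) * c →
      conc c bl (markerBlock K) (k + s) = conc c bl (markerBlock K) k) : False := by
  have hc : 0 < c := by omega
  have hiter (n : ℕ) : ∀ k, 0 ≤ k → k + n * s < (4 * K + 2) * c →
      conc c bl (markerBlock K) (k + n * s) = conc c bl (markerBlock K) k := by
    induction n with
    | zero => simp
    | succ n ih =>
      intro k hk hkn
      push_cast at hkn ⊢
      have h0 : 0 ≤ (n : ℤ) * s := by positivity
      have h1 := h (k + n * s) (by omega) (by linarith)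
      rw [← ih k hk (by linarith), ← h1]
      congr 1
      ring
  have h1 : markerBlock K (2 * K + 1 + 2 * s) = markerBlock K (2 * K + 1) := by
    refine eq_of_conc_eq (bl := bl) hj₀ hj₀c hne fun j hj hjc => ?_
    rw [← hiter (2 * c) ((2 * K + 1) * c + j) (by positivity)]
    · congr 1
      push_cast
      ring
    · push_cast
      have : s * c ≤ K * c := by gcongr
      nlinarith
  simp only [markerBlock, decide_eq_decide] at h1
  omega

lemma marker_not_run (hj₀ : 0 ≤ j₀) (hj₀c : j₀ < c) (hne : bl true j₀ ≠ bl false j₀) (o : ℤ)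
    (h : ∀ k : ℤ, 0 ≤ k → k + c < 6 * c →
      conc c bl (markerBlock K) (o + (k + c)) = conc c bl (markerBlock K) (o + k)) : False := by
  have hc : 0 < c := by omega
  obtain ⟨l, hl, hl'⟩ : ∃ l : ℤ, o ≤ l * c ∧ l * c < o + c := by
    refine ⟨(o + c - 1) / c, ?_, ?_⟩
    · have := Int.lt_ediv_add_one_mul_self (o + c - 1) (b := c) (by omega)
      rw [add_mul, one_mul] at this
      omega
    · have := Int.ediv_mul_le (o + c - 1) (b := c) (by omega)
      omega
  have hstep (i : ℤ) (hi : 0 ≤ i) (hi' : i ≤ 3) :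
      markerBlock K (l + i + 1) = markerBlock K (l + i) := by
    refine eq_of_conc_eq (bl := bl) hj₀ hj₀c hne fun j hj hjc => ?_
    have h1 : 0 ≤ i * (c : ℤ) := by positivity
    have h2 : i * (c : ℤ) ≤ 3 * c := by gcongr
    have h3 := h ((l + i) * c + j - o) (by linarith) (by linarith)
    convert h3 using 2 <;> ring
  have h0 := hstep 0 (by omega) (by omega)
  have h1 := hstep 1 (by omega) (by omega)
  have h2 := hstep 2 (by omega) (by omega)
  have h3 := hstep 3 (by omega) (by omega)
  simp only [markerBlock, decide_eq_decide] at h0 h1 h2 h3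
  omega

end marker

/-- The code over an alphabet of two blocks. -/
def blockCode (c : ℕ) (bl : Bool → ℤ → A) (t : ℕ) (e : C → ℕ) : Code A C where
  lenM := (4 * (6 * c + 12 + t) + 2) * c
  lenD := (12 + t) * c
  marker := conc c bl (markerBlock (6 * c + 12 + t))
  data y := conc c bl (dataBlock (e y))

section blockCode

variable {c t : ℕ} {bl : Bool → ℤ → A} {e : C → ℕ} {j₀ : ℤ}

lemma data_run (hc : 0 < c) {n : ℕ} {q : ℤ}
    (hq : ∀ j : ℤ, 0 ≤ j → j < 6 → q + j ≠ 6 + n) {k : ℤ} (hk : 0 ≤ k) (hkc : k + c < 6 * c) :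
    conc c bl (dataBlock n) (q * c + (k + c)) = conc c bl (dataBlock n) (q * c + k) := by
  have h1 : ∀ j : ℤ, 0 ≤ j → j < 6 → dataBlock n (q + j) = false := fun j hj hj' => by
    simpa [dataBlock] using hq j hj hj'
  have h2 : (k + c) / (c : ℤ) = k / c + 1 := by
    rw [Int.add_ediv_of_dvd_right dvd_rfl, Int.ediv_self (by omega)]
  have h3 : 0 ≤ k / (c : ℤ) := Int.ediv_nonneg hk (by omega)
  have h4 : k / (c : ℤ) < 5 := Int.ediv_lt_of_lt_mul (by omega) (by omega)
  rw [conc_mul_add hc, conc_mul_add hc, h2, h1 _ (by omega) (by omega), h1 _ h3 (by omega),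
    Int.add_emod_right]

lemma blockCode_synchronizing (het : ∀ y, e y < t) (hj₀ : 0 ≤ j₀) (hj₀c : j₀ < c)
    (hne : bl true j₀ ≠ bl false j₀) {x : ℤ → A} {p : ℤ} {y : C} {p' : ℤ}
    (h : (blockCode c bl t e).Occ x p y) (hp : p < p') (hp' : p' < p + (blockCode c bl t e).len) :
    ¬ ∀ k : ℤ, 0 ≤ k → k < (blockCode c bl t e).lenM →
      x (p' + k) = (blockCode c bl t e).marker k := by
  intro hM
  have hc : 0 < c := by omega
  obtain ⟨hl, hm, hr⟩ := h
  have het := het y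
  generalize hK : 6 * c + 12 + t = K at *
  simp only [blockCode, Code.len, hK] at hp' hM hl hm hr
  push_cast at hp' hM hl hm hr
  have hD : ((12 + t : ℤ)) * c = 12 * c + t * c := by ring
  have hD0 : 0 ≤ (t : ℤ) * c := by positivity
  have hDM : ((12 + t : ℤ)) * c ≤ (4 * K + 2) * c :=
    mul_le_mul_of_nonneg_right (by omega) (by omega)
  have h6M : (6 : ℤ) * c ≤ K * 1 := by omega
  generalize hlM : (4 * (K : ℤ) + 2) * c = lM at *
  generalize hlD : ((12 + t : ℤ)) * c = lD at *
  obtain ⟨s, rfl⟩ : ∃ s, p' = p + s := ⟨p' - p, by ring⟩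
  by_cases h1 : s < 6 * c
  · refine marker_not_periodic (K := K) hj₀ hj₀c hne (s := s) (by omega) (by omega)
      fun k hk hks => ?_
    rw [← hM k hk (by omega), ← hl (k + s) (by omega) (by omega)]
    congr 1
    ring
  by_cases h2 : lM + lD - 6 * c < s
  · refine marker_not_periodic (K := K) hj₀ hj₀c hne (s := lM + lD - s) (by omega) (by omega)
      fun k hk hks => ?_
    rw [← hr k hk (by omega), ← hM (k + (lM + lD - s)) (by omega) (by omega)]
    congr 1
    ring
  by_cases h3 : s ≤ lM
  · refine marker_not_run (K := K) hj₀ hj₀c hne (lM - s) fun k hk hkc => ?_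
    have key := data_run (bl := bl) hc (n := e y) (q := 0) (by omega) hk hkc
    simp only [zero_mul, zero_add] at key
    rw [← hM _ (by omega) (by omega), ← hM _ (by omega) (by omega)]
    rw [← hm _ (by omega) (by omega), ← hm _ (by omega) (by omega)] at key
    convert key using 2 <;> ring
  · refine marker_not_run (K := K) hj₀ hj₀c hne (lM + lD - 6 * c - s) fun k hk hkc => ?_
    have key := data_run (bl := bl) hc (n := e y) (q := 6 + t) (by omega) hk hkc
    have hq : (6 + t : ℤ) * c = lD - 6 * c := by linarith
    rw [hq] at key
    rw [← hM _ (by omega) (by omega), ← hM _ (by omega) (by omega)]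
    rw [← hm _ (by omega) (by omega), ← hm _ (by omega) (by omega)] at key
    convert key using 2 <;> ring

lemma ctxEq_cat {L : Language A} {a b : List A} (h : CtxEq L a b) {y z : List Bool}
    (hyz : y.length = z.length) : CtxEq L (cat a b y) (cat a b z) := by
  induction y generalizing z with
  | nil =>
    obtain rfl : z = [] := List.length_eq_zero_iff.1 hyz.symm
    exact CtxEq.refl _ _
  | cons s y ih =>
    cases z with
    | nil => simp at hyz
    | cons s' z =>
      rw [cat_cons, cat_cons]
      refine CtxEq.append ?_ (ih (by simpa using hyz))
      cases s <;> cases s' <;> first | exact CtxEq.refl _ _ | exact h | exact h.symm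

lemma blockCode_isGood {L : Language A} {a b : List A} (hab : CtxEq L a b) (hlen : a.length = c)
    (hbl : ∀ s, word (bl s) 0 c = cond s b a) (he : Function.Injective e) (het : ∀ y, e y < t)
    (hj₀ : 0 ≤ j₀) (hj₀c : j₀ < c) (hne : bl true j₀ ≠ bl false j₀) :
    (blockCode c bl t e).IsGood L where
  injective y y' h := by
    have hc : 0 < c := by omega
    apply he
    have h1 : dataBlock (e y) (6 + e y) = dataBlock (e y') (6 + e y) := by
      refine eq_of_conc_eq (bl := bl) hj₀ hj₀c hne fun j hj hjc => h _ (by positivity) ?_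
      have := het y
      have h2 : (6 + e y + 1 : ℤ) * c ≤ (12 + t) * c :=
        mul_le_mul_of_nonneg_right (by omega) (by omega)
      simp only [blockCode]
      push_cast
      linarith
    simpa [dataBlock] using h1
  ctxEq y y' := by
    have hc : 0 < c := by omega
    have key (y : C) : word ((blockCode c bl t e).data y) 0 (blockCode c bl t e).lenD =
        cat a b (word (dataBlock (e y)) 0 (12 + t)) := by
      subst hlen
      simpa [blockCode] using word_mul_eq_cat (x := conc a.length bl (dataBlock (e y)))
        (fun k => (word_conc hc k).trans (hbl _)) 0 (12 + t)
    rw [key, key]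
    exact ctxEq_cat hab (by simp)
  synchronizing x p y p' h hp hp' := blockCode_synchronizing het hj₀ hj₀c hne h hp hp'

open Classical in
/-- The blocks of a configuration in which `m + 1` markers separate the data `v`. -/
noncomputable def layout (N t : ℕ) (e : C → ℕ) (v : ℤ → Option C) (m : ℕ) (k : ℤ) : Bool :=
  if 0 ≤ k / (4 * N + 2 + (12 + t) : ℤ) ∧ k / (4 * N + 2 + (12 + t) : ℤ) ≤ m ∧
      k % (4 * N + 2 + (12 + t) : ℤ) < 4 * N + 2 then
    markerBlock N (k % (4 * N + 2 + (12 + t) : ℤ))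
  else (v (k / (4 * N + 2 + (12 + t) : ℤ))).elim false
    fun y => dataBlock (e y) (k % (4 * N + 2 + (12 + t) : ℤ) - (4 * N + 2))

lemma layout_mul_add (N t : ℕ) (e : C → ℕ) (v : ℤ → Option C) (m : ℕ) (k : ℤ) {j : ℤ} (hj : 0 ≤ j)
    (hj' : j < 4 * N + 2 + (12 + t)) :
    layout N t e v m (k * (4 * N + 2 + (12 + t)) + j) =
      if 0 ≤ k ∧ k ≤ m ∧ j < 4 * N + 2 then markerBlock N j
      else (v k).elim false fun y => dataBlock (e y) (j - (4 * N + 2)) := by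
  have h1 : (k * (4 * N + 2 + (12 + t) : ℤ) + j) / (4 * N + 2 + (12 + t) : ℤ) = k := by
    rw [add_comm, Int.add_mul_ediv_right _ _ (by omega), Int.ediv_eq_zero_of_lt hj hj', zero_add]
  have h2 : (k * (4 * N + 2 + (12 + t) : ℤ) + j) % (4 * N + 2 + (12 + t) : ℤ) = j := by
    rw [add_comm, Int.add_mul_emod_self_right, Int.emod_eq_of_lt hj hj']
  rw [layout, h1, h2]

lemma view_layout {L : Language A} (h : (blockCode c bl t e).IsGood L) (hj₀ : 0 ≤ j₀)
    (hj₀c : j₀ < c) (hne : bl true j₀ ≠ bl false j₀) {v : ℤ → Option C} {m : ℕ}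
    (hv : ∀ p, v p ≠ none ↔ 0 ≤ p ∧ p < m) :
    (blockCode c bl t e).view (conc c bl (layout (6 * c + 12 + t) t e v m)) 0 = v := by
  have hc : 0 < c := by omega
  generalize hK : 6 * c + 12 + t = K at *
  set B : ℤ := 4 * K + 2 + (12 + t) with hB
  have hlay := layout_mul_add K t e v m
  rw [← hB] at hlay
  have hlen : ((blockCode c bl t e).len : ℤ) = B * c := by
    simp only [blockCode, Code.len, hK]
    push_cast
    ring
  have hlenM : ((blockCode c bl t e).lenM : ℤ) = (4 * K + 2) * c := by
    simp only [blockCode, hK]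
    push_cast
    ring
  have hlenD : ((blockCode c bl t e).lenD : ℤ) = (12 + t) * c := by
    simp only [blockCode]
    push_cast
    ring
  have hmark : (blockCode c bl t e).marker = conc c bl (markerBlock K) := by
    simp only [blockCode, hK]
  have hmarker (k : ℤ) (hk : 0 ≤ k) (hkm : k ≤ m) (i : ℤ) (hi : 0 ≤ i) (hi' : i < (4 * K + 2) * c) :
      conc c bl (layout K t e v m) (k * B * c + i) = conc c bl (markerBlock K) i := by
    have := conc_congr (bl := bl) hc (z := layout K t e v m) (z' := markerBlock K) (k := k * B)
      (k' := 0) (n := 4 * K + 2) (fun j h0 h1 => by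
        rw [hlay k h0 (by omega), if_pos ⟨hk, hkm, h1⟩, zero_add]) hi hi'
    simpa using this
  have hempty (k : ℤ) (hk : ¬ (0 ≤ k ∧ k ≤ m)) : ¬ ∀ i : ℤ, 0 ≤ i → i < (4 * K + 2) * c →
      conc c bl (layout K t e v m) (k * B * c + i) = conc c bl (markerBlock K) i := by
    intro hM
    have hvk : v k = none := by
      by_contra hne'
      have := (hv k).1 hne'
      omega
    have hz : ∀ j : ℤ, 0 ≤ j → j < 6 → layout K t e v m (k * B + j) = false := by
      intro j h0 h1
      rw [hlay k h0 (by omega), if_neg (by tauto), hvk]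
      rfl
    refine marker_not_run (K := K) hj₀ hj₀c hne 0 fun i hi hic => ?_
    have h6 : (6 : ℤ) * c ≤ (4 * K + 2) * c :=
      mul_le_mul_of_nonneg_right (by omega) (by omega)
    have h3 : 0 ≤ i / (c : ℤ) := Int.ediv_nonneg hi (by omega)
    have h4 : i / (c : ℤ) < 5 := Int.ediv_lt_of_lt_mul (by omega) (by omega)
    have h2 : (i + c) / (c : ℤ) = i / c + 1 := by
      rw [Int.add_ediv_of_dvd_right dvd_rfl, Int.ediv_self (by omega)]
    rw [zero_add, zero_add, ← hM i hi (by omega), ← hM _ (by omega) (by omega), conc_mul_add hc,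
      conc_mul_add hc, h2, hz _ (by omega) (by omega), hz _ h3 (by omega), Int.add_emod_right]
  funext k
  rw [Code.view, hlen, zero_add, ← mul_assoc]
  cases hvk : v k with
  | some y =>
    obtain ⟨hk, hkm⟩ := (hv k).1 (by simp [hvk])
    rw [h.content_eq_some]
    refine ⟨fun i hi hi' => ?_, fun i hi hi' => ?_, fun i hi hi' => ?_⟩
    · rw [hmark]
      rw [hlenM] at hi'
      exact hmarker k hk hkm.le i hi hi'
    · rw [hlenD] at hi'
      have := conc_congr (bl := bl) hc (z := layout K t e v m) (z' := dataBlock (e y))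
        (k := k * B + (4 * K + 2)) (k' := 0) (n := 12 + t) (fun j h0 h1 => by
          rw [add_assoc, hlay k (by omega) (by omega), if_neg (by omega), hvk, Option.elim_some]
          congr 1
          ring) hi hi'
      rw [hlenM, ← add_mul, this]
      simp [blockCode]
    · rw [hmark, hlen, ← add_mul, ← add_one_mul]
      rw [hlenM] at hi'
      exact hmarker (k + 1) (by omega) (by omega) i hi hi'
  | none =>
    have hk : ¬ (0 ≤ k ∧ k < m) := fun hk => (hv k).2 hk hvk
    by_contra hne'
    obtain ⟨y, hy⟩ := Option.ne_none_iff_exists'.1 hne'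
    rw [h.content_eq_some] at hy
    by_cases hk0 : 0 ≤ k
    · refine hempty (k + 1) (by omega) fun i hi hi' => ?_
      rw [← hmark, ← hy.right i hi (by rwa [hlenM]), hlen, ← add_mul, ← add_one_mul]
    · refine hempty k (by omega) fun i hi hi' => ?_
      rw [← hmark, ← hy.left i hi (by rwa [hlenM])]

end blockCode

variable [TopologicalSpace A] [DiscreteTopology A] {X : Set (ℤ → A)} {a b : List A}

lemma IsFreePair.exists_code [Finite C] (h : IsFreePair (subshiftLanguage X) a b)
    (hX : IsSubshift X) : ∃ κ : Code A C, κ.IsGood (subshiftLanguage X) ∧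
      ∀ (v : ℤ → Option C) (m : ℕ), (∀ p, v p ≠ none ↔ 0 ≤ p ∧ p < m) →
        ∃ x ∈ X, κ.view x 0 = v := by
  have hc := h.length_pos
  set c := a.length with hc_def
  choose w hwX hw using fun s : Bool => h.exists_mem hX fun _ => s
  have hbl (s : Bool) : word (w s) 0 c = cond s b a := by simpa using hw s 0
  obtain ⟨j₀, hj₀, hj₀c, hne⟩ : ∃ j : ℤ, 0 ≤ j ∧ j < c ∧ w true j ≠ w false j := by
    by_contra! hcon
    refine h.ne ?_
    have h1 : word (w false) 0 c = word (w true) 0 c :=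
      word_eq_word_iff.2 fun k hk => (hcon _ (by omega) (by omega)).symm
    rwa [hbl, hbl] at h1
  obtain ⟨t, ⟨E⟩⟩ := Finite.exists_equiv_fin C
  set e : C → ℕ := fun y => E y
  have hgood := blockCode_isGood (bl := w) (e := e) (t := t) h.ctxEq rfl hbl
    (fun y y' hy => E.injective (Fin.ext hy)) (fun y => (E y).2) hj₀ hj₀c hne
  refine ⟨_, hgood, fun v m hv => ⟨_, ?_, view_layout hgood hj₀ hj₀c hne hv⟩⟩
  obtain ⟨x, hxX, hx⟩ := h.exists_mem hX (layout (6 * c + 12 + t) t e v m)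
  convert hxX
  funext i
  have h1 := hx (i / c)
  rw [← hbl, ← word_conc (bl := w) (z := layout (6 * c + 12 + t) t e v m) hc,
    word_eq_word_iff] at h1
  have h2 : 0 ≤ i % c := Int.emod_nonneg _ (by omega)
  have h3 := h1 (i % c).toNat (by have := Int.emod_lt_of_pos i (b := c) (by omega); omega)
  rw [Int.toNat_of_nonneg h2, Int.ediv_mul_add_emod] at h3
  exact h3.symm

end Sofic

namespace Sofic

section wordNorm

variable {G : Type*} [Group G] {F : Set G} {g h : G}

lemma wordNorm_le_length {w : List G} (hw : ∀ x ∈ w, x ∈ F ∨ x⁻¹ ∈ F) :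
    wordNorm F w.prod ≤ w.length :=
  Nat.sInf_le ⟨w, rfl, hw, rfl⟩

lemma wordNorm_mul_le (hg : g ∈ Subgroup.closure F) (hh : h ∈ Subgroup.closure F) :
    wordNorm F (g * h) ≤ wordNorm F g + wordNorm F h := by
  obtain ⟨v, hv, hvF, hvg⟩ := exists_wordNorm hg
  obtain ⟨w, hw, hwF, hwh⟩ := exists_wordNorm hh
  rw [← hv, ← hw, ← List.length_append]
  nth_rw 1 [← hvg, ← hwh]
  rw [← List.prod_append]
  refine wordNorm_le_length fun x hx => ?_
  rcases List.mem_append.1 hx with hx | hx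
  exacts [hvF x hx, hwF x hx]

lemma wordNorm_map_le {α : Type*} [DecidableEq α] (φ : FreeGroup α →* G)
    (hF : ∀ s, φ (FreeGroup.of s) ∈ F) (u : FreeGroup α) :
    wordNorm F (φ u) ≤ Conveyor.len u := by
  obtain ⟨l, hl, rfl⟩ := Conveyor.exists_prod_eq u
  rw [← hl, map_list_prod, List.map_map, ← List.length_map (as := l)]
  refine wordNorm_le_length fun x hx => ?_
  obtain ⟨⟨s, t⟩, -, rfl⟩ := List.mem_map.1 hx
  cases t
  · exact Or.inr (by simpa using hF s)
  · exact Or.inl (by simpa using hF s)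

open Filter Topology in
lemma tendsto_wordNorm_pow_div (hg : g ∈ Subgroup.closure F) {K : ℕ}
    (hK : ∀ k, wordNorm F (g ^ 3 ^ k) ≤ K * (k + 2) ^ 4) :
    Tendsto (fun n : ℕ => (wordNorm F (g ^ n) : ℝ) / n) atTop (𝓝 0) := by
  have hsub : Subadditive fun n : ℕ => (wordNorm F (g ^ n) : ℝ) := fun m n => by
    simp only [pow_add]
    exact_mod_cast wordNorm_mul_le (Subgroup.pow_mem _ hg m) (Subgroup.pow_mem _ hg n)
  have hlim := hsub.tendsto_lim ⟨0, by rintro _ ⟨n, rfl⟩; positivity⟩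
  have h3 : Tendsto (fun k : ℕ => 3 ^ k) atTop (atTop : Filter ℕ) :=
    tendsto_pow_atTop_atTop_of_one_lt (by norm_num)
  have hz : Tendsto (fun k : ℕ => (K : ℝ) * 9 * (((k + 2 : ℕ) : ℝ) ^ 4 / (3 : ℝ) ^ (k + 2)))
      atTop (𝓝 0) := by
    have h4 := (tendsto_pow_const_div_const_pow_of_one_lt 4 (r := (3 : ℝ)) (by norm_num)).comp
      (tendsto_add_atTop_nat 2)
    simpa using h4.const_mul ((K : ℝ) * 9)
  have hzero : Tendsto (fun k : ℕ => (wordNorm F (g ^ 3 ^ k) : ℝ) / ((3 ^ k : ℕ) : ℝ)) atTop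
      (𝓝 0) := by
    refine squeeze_zero (fun k => by positivity) (fun k => ?_) hz
    have h5 : (wordNorm F (g ^ 3 ^ k) : ℝ) ≤ K * ((k + 2 : ℕ) : ℝ) ^ 4 := by exact_mod_cast hK k
    rw [pow_add, div_le_iff₀ (by positivity)]
    refine h5.trans (le_of_eq ?_)
    push_cast
    field_simp
    norm_num
  rwa [tendsto_nhds_unique (hlim.comp h3) hzero] at hlim

end wordNorm

open Conveyor in
lemma isCellular_evalCA : IsCellular evalCA where
  eq_none_iff := evalCA_eq_none_iff
  shift := evalCA_shift
  exists_local := exists_evalCA_local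

open Conveyor in
lemma exists_isDistortionElement {A : Type*} [TopologicalSpace A] [DiscreteTopology A] [Finite A]
    {X : Set (ℤ → A)} (hX : IsSubshift X) (hreg : (subshiftLanguage X).IsRegular)
    (hc : ¬ X.Countable) : ∃ g : Equiv.Perm X, IsDistortionElement (SubshiftAut X) g := by
  classical
  obtain ⟨a, b, hab⟩ : ∃ a b, IsFreePair (subshiftLanguage X) a b := by
    by_contra! h
    exact hc (countable_of_not_isFreePair hreg h)
  obtain ⟨κ, hκ, hview⟩ := hab.exists_code (C := Cell) hX
  set φ := hκ.liftHom hX isCellular_evalCA with hφ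
  have hfin : (Set.range fun s : Gate => φ (FreeGroup.of s)).Finite := Set.finite_range _
  have hgen (s : Gate) : φ (FreeGroup.of s) ∈ (hfin.toFinset : Set (Equiv.Perm X)) := by simp
  have hcl (u : FreeGroup Gate) :
      φ u ∈ Subgroup.closure (hfin.toFinset : Set (Equiv.Perm X)) := by
    induction u using FreeGroup.induction_on with
    | C1 => simp
    | of s => exact Subgroup.subset_closure (hgen s)
    | inv_of s hs => simpa using hs
    | mul u v hu hv => rw [map_mul]; exact mul_mem hu hv
  refine ⟨φ distortionWord, hκ.liftHom_mem hX _ _, fun N hN h1 => ?_, hfin.toFinset, ?_, hcl _, ?_⟩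
  · obtain ⟨m, hm, hne⟩ := exists_evalAt_distortionWord_pow_ne N hN
    obtain ⟨v, hv, hvne⟩ := exists_evalCA_ne hm hne
    obtain ⟨x, hx, hxv⟩ := hview v m hv
    exact hκ.liftHom_ne_one hX isCellular_evalCA hvne hx hxv (by rw [← hφ, map_pow, h1])
  · rintro _ hf
    obtain ⟨s, rfl⟩ := hfin.mem_toFinset.1 hf
    exact hκ.liftHom_mem hX _ _
  · obtain ⟨K, hK⟩ := exists_short_word
    refine tendsto_wordNorm_pow_div (hcl _) (K := K) fun k => ?_
    obtain ⟨u, hu, hev⟩ := hK k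
    have h1 : evalCA (u * (distortionWord ^ 3 ^ k)⁻¹) = 1 := evalCA_eq_one fun m hm => by
      rw [map_mul, map_inv, hev _ (by omega), mul_inv_cancel]
    rw [map_mul, map_inv, mul_inv_eq_one] at h1
    rw [← map_pow, ← hκ.liftHom_eq_of_eq hX isCellular_evalCA h1]
    exact (wordNorm_map_le φ hgen u).trans hu

end Sofic

/-- **Theorem.** Let `X` be a sofic subshift.  Then `Aut(X)` contains a distortion element
if and only if `X` is uncountable. -/
theorem sofic_aut_distortion_iff_uncountable (A : Type) [TopologicalSpace A]
    [DiscreteTopology A] [Fintype A] (X : Set (ℤ → A)) (hX : IsSubshift X)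
    (hsofic : (subshiftLanguage X).IsRegular) :
    (∃ g : Equiv.Perm X, IsDistortionElement (SubshiftAut X) g) ↔ ¬ X.Countable := by
  exact ⟨fun ⟨g, hg⟩ hc => Sofic.not_isDistortionElement hX hsofic hc g hg,
    Sofic.exists_isDistortionElement hX hsofic⟩
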